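/- Let G be a 3-edge-connected, internally 4-edge-connected graph which is sausage reduced and has |V(G)| ≥ 6. Then G has no immersion of W_4 if and only if G is cubic (every vertex has degree 3). -/

import Mathlib

open scoped Classical

noncomputable section

namespace PaperW4

/-- A finite loopless undirected multigraph on ambient vertex type `V`:
a finite vertex set together with a multiset of (non-loop) edges supported on it. -/
structure MG (V : Type) where
  verts : Finset V
  edges : Multiset (Sym2 V)
  edge_support : ∀ e ∈ edges, ∀ v ∈ e, v ∈ verts
  loopless : ∀ e ∈ edges, ¬ e.IsDiag

variable {V : Type} {W : Type}

/-- `δ_G(X)`: the edges of `G` with exactly one endpoint in `X`. -/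
def cutEdges (G : MG V) (X : Finset V) : Multiset (Sym2 V) :=
  G.edges.filter fun e => ∃ u v, e = s(u, v) ∧ u ∈ X ∧ v ∉ X

/-- `d_G(X) = |δ_G(X)|`. -/
def dcut (G : MG V) (X : Finset V) : ℕ := (cutEdges G X).card

/-- The degree of a vertex: the number of edges incident with it. -/
def deg (G : MG V) (v : V) : ℕ := (G.edges.filter fun e => v ∈ e).card

/-- `e_G(u,v)`: the number of edges joining `u` and `v`. -/
def emult (G : MG V) (u v : V) : ℕ := G.edges.count s(u, v)

/-- `G` is `k`-edge-connected: every edge-cut `δ(X)` with `∅ ≠ X ⊊ V(G)` has size `≥ k`. -/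
def EdgeConn (G : MG V) (k : ℕ) : Prop :=
  ∀ X : Finset V, X ⊆ G.verts → X.Nonempty → X ≠ G.verts → k ≤ dcut G X

/-- `G` is internally `k`-edge-connected: every edge-cut with at least two vertices
on each side has size `≥ k`. -/
def InternallyEdgeConn (G : MG V) (k : ℕ) : Prop :=
  ∀ X : Finset V, X ⊆ G.verts → 2 ≤ X.card → 2 ≤ (G.verts \ X).card → k ≤ dcut G X

/-- Every vertex has degree three. -/
def Cubic (G : MG V) : Prop := ∀ v ∈ G.verts, deg G v = 3

/-- The multiset of edges traversed by a walk, given as its list of vertices. -/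
def walkEdges (l : List V) : Multiset (Sym2 V) :=
  (↑((l.zip l.tail).map fun p => s(p.1, p.2)) : Multiset (Sym2 V))

/-- `l` is (the vertex sequence of) a walk from `u` to `v`. -/
def IsWalk (l : List V) (u v : V) : Prop :=
  l.head? = some u ∧ l.getLast? = some v

/-- `G` is connected: any two of its vertices are joined by a trail in `G`. -/
def Connected (G : MG V) : Prop :=
  ∀ u ∈ G.verts, ∀ v ∈ G.verts,
    ∃ l : List V, IsWalk l u v ∧ walkEdges l ≤ G.edges ∧ ∀ w ∈ l, w ∈ G.verts

/-- An immersion of the loopless multigraph with vertex type `W` and edge multiset `H`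
into `G`, with terminal map `φ`: `φ` is injective, and to each edge `uv` of `H` is
assigned a walk in `G` from `φ u` to `φ v`, these walks being globally edge-disjoint. -/
def ImmersionVia (G : MG V) (H : Multiset (Sym2 W)) (φ : W → V) : Prop :=
  Function.Injective φ ∧ (∀ w : W, φ w ∈ G.verts) ∧
  ∃ P : Multiset (Sym2 W × List V),
    P.map Prod.fst = H ∧
    (∀ p ∈ P, ∃ u v : W, p.1 = s(u, v) ∧ IsWalk p.2 (φ u) (φ v)) ∧
    (P.map fun p => walkEdges p.2).sum ≤ G.edges

/-- The edges of the wheel `W₄`: vertex `0` is the center, `1,2,3,4` the rim cycle. -/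
def w4Edges : Multiset (Sym2 (Fin 5)) :=
  {s(0, 1), s(0, 2), s(0, 3), s(0, 4), s(1, 2), s(2, 3), s(3, 4), s(4, 1)}

/-- `G` has an immersion of `W₄`. -/
def HasW4Immersion (G : MG V) : Prop :=
  ∃ φ : Fin 5 → V, ImmersionVia G w4Edges φ

/-- `G` (rooted at `x`) has a rooted immersion of `W₄`: one in which the
center of `W₄` corresponds to `x`. -/
def HasRootedW4Immersion (G : MG V) (x : V) : Prop :=
  ∃ φ : Fin 5 → V, φ 0 = x ∧ ImmersionVia G w4Edges φ

/-- The edges of `D_m`: roots are `0, 1`; vertices `2, 3` play the role of `y₀, y₁`;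
there are `m - 2` parallel edges between the two roots. -/
def dmEdges (m : ℕ) : Multiset (Sym2 (Fin 4)) :=
  Multiset.replicate (m - 2) s(0, 1) + {s(0, 2), s(0, 3), s(1, 2), s(1, 3), s(2, 3)}

/-- `G` with roots `x0, x1` has a rooted immersion of `D_m`. -/
def HasRootedDmImmersion (G : MG V) (m : ℕ) (x0 x1 : V) : Prop :=
  ∃ φ : Fin 4 → V, φ 0 = x0 ∧ φ 1 = x1 ∧ ImmersionVia G (dmEdges m) φ

/-- The edges of `K₄`. -/
def k4Edges : Multiset (Sym2 (Fin 4)) :=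
  {s(0, 1), s(0, 2), s(0, 3), s(1, 2), s(1, 3), s(2, 3)}

/-- A nested chain of vertex sets `C 0 ⊂ C 1 ⊂ ⋯`, each obtained from the previous
by adding one vertex, all cuts having size exactly `k`. -/
def SegChain (G : MG V) (n : ℕ) (C : Fin (n + 1) → Finset V) (k : ℕ) : Prop :=
  (∀ i, C i ⊆ G.verts) ∧
  (∀ i : Fin n, C i.castSucc ⊆ C i.succ ∧ (C i.succ \ C i.castSucc).card = 1) ∧
  (∀ i, dcut G (C i) = k)

/-- `G` has a segmentation of width `k` relative to `(X, Y)`. -/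
def HasSegmentation (G : MG V) (X Y : Finset V) (k : ℕ) : Prop :=
  ∃ (n : ℕ) (C : Fin (n + 1) → Finset V),
    SegChain G n C k ∧ C 0 = X ∧ G.verts \ C (Fin.last n) = Y

/-- `λ_s(G) ≥ m`: every edge-cut separating `x0` from `x1` has size `≥ m`. -/
def LamSGe (G : MG V) (x0 x1 : V) (m : ℕ) : Prop :=
  ∀ X : Finset V, X ⊆ G.verts → x0 ∈ X → x1 ∉ X → m ≤ dcut G X

/-- `λ_n(G) ≥ m`: every edge-cut not separating `x0` from `x1` has size `≥ m`. -/
def LamNGe (G : MG V) (x0 x1 : V) (m : ℕ) : Prop :=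
  ∀ X : Finset V, X ⊆ G.verts → X.Nonempty → X ≠ G.verts →
    (x0 ∈ X ↔ x1 ∈ X) → m ≤ dcut G X

/-- `λ_n^i(G) ≥ m`: every internal edge-cut not separating `x0` from `x1` has size `≥ m`. -/
def LamNiGe (G : MG V) (x0 x1 : V) (m : ℕ) : Prop :=
  ∀ X : Finset V, X ⊆ G.verts → 2 ≤ X.card → 2 ≤ (G.verts \ X).card →
    (x0 ∈ X ↔ x1 ∈ X) → m ≤ dcut G X

/-- The subgraph of `G` induced on `S`. -/
def induce (G : MG V) (S : Finset V) : MG V where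
  verts := G.verts ∩ S
  edges := G.edges.filter fun e => ∀ v ∈ e, v ∈ S
  edge_support := by
    intro e he v hv
    rw [Multiset.mem_filter] at he
    exact Finset.mem_inter.mpr ⟨G.edge_support e he.1 v hv, he.2 v hv⟩
  loopless := fun e he => G.loopless e (Multiset.mem_of_mem_filter he)

/-- `G` with the vertices of `S` (and all incident edges) deleted. -/
def deleteVerts (G : MG V) (S : Finset V) : MG V := induce G (G.verts \ S)

/-- `C` is (the vertex set of) a connected component of `G`. -/
def IsComponent (G : MG V) (C : Finset V) : Prop :=
  C ⊆ G.verts ∧ C.Nonempty ∧ Connected (induce G C) ∧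
  ∀ e ∈ G.edges, (∃ v ∈ e, v ∈ C) → ∀ v ∈ e, v ∈ C

/-- `G` has type `A_m` with respect to roots `x0, x1`. -/
def TypeA (G : MG V) (m : ℕ) (x0 x1 : V) : Prop :=
  ∃ X0 X1 : Finset V, x0 ∈ X0 ∧ x1 ∈ X1 ∧ X0.card ≤ 2 ∧ X1.card ≤ 2 ∧
    HasSegmentation G X0 X1 m

/-- The edges of the lobe of `G` (with roots `x0, x1`) corresponding to the
component `C` of `G ∖ {x0, x1}`: edges inside `C ∪ {x0, x1}` other than `x0x1`-edges. -/
def lobeEdges (G : MG V) (C : Finset V) (x0 x1 : V) : Multiset (Sym2 V) :=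
  G.edges.filter fun e => (∀ v ∈ e, v ∈ insert x0 (insert x1 C)) ∧ e ≠ s(x0, x1)

/-- `G` has type `B_m` with respect to roots `x0, x1`. -/
def TypeB (G : MG V) (m : ℕ) (x0 x1 : V) : Prop :=
  ∃ (k : ℕ) (C : Fin k → Finset V) (nL : Fin k → ℕ),
    Function.Injective C ∧
    (∀ D : Finset V, IsComponent (deleteVerts G {x0, x1}) D ↔ ∃ i, C i = D) ∧
    (∀ i : Fin k, 2 ≤ nL i ∧
      ∃ l : List V, l.Nodup ∧ IsWalk l x0 x1 ∧
        l.toFinset = insert x0 (insert x1 (C i)) ∧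
        (2 ≤ (C i).card → nL i = 2) ∧
        lobeEdges G (C i) x0 x1 = nL i • walkEdges l) ∧
    emult G x0 x1 + ∑ i, nL i = m + 1

/-- The edge multiset of a cycle of length `n` on the vertices `f 0, f 1, …`. -/
def cycleEdges (n : ℕ) (f : Fin n → V) : Multiset (Sym2 V) :=
  (Finset.univ.val : Multiset (Fin n)).map fun i =>
    s(f i, f ⟨(i.val + 1) % n, Nat.mod_lt _ i.pos⟩)

/-- `G` is a doubled cycle of length `n`. -/
def IsDoubledCycleLen (G : MG V) (n : ℕ) : Prop :=
  ∃ f : Fin n → V, Function.Injective f ∧ Finset.univ.image f = G.verts ∧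
    G.edges = 2 • cycleEdges n f

/-- `G` is a doubled cycle. -/
def IsDoubledCycle (G : MG V) : Prop := ∃ n, 3 ≤ n ∧ IsDoubledCycleLen G n

/-- The map collapsing all of `Y` to the vertex `y0` and fixing everything else. -/
def collapseFun (Y : Finset V) (y0 : V) : V → V := fun v => if v ∈ Y then y0 else v

/-- The image multigraph of `G` under a vertex map `f` (identification of vertices),
with any created loops deleted. -/
def mapGraph (f : V → V) (G : MG V) : MG V where
  verts := G.verts.image f
  edges := (G.edges.map (Sym2.map f)).filter fun e => ¬e.IsDiag
  edge_support := by
    intro e he v hv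
    rw [Multiset.mem_filter] at he
    obtain ⟨he, -⟩ := he
    rw [Multiset.mem_map] at he
    obtain ⟨e', he', rfl⟩ := he
    rw [Sym2.mem_map] at hv
    obtain ⟨u, hu, rfl⟩ := hv
    exact Finset.mem_image_of_mem f (G.edge_support e' he' u hu)
  loopless := by
    intro e he
    rw [Multiset.mem_filter] at he
    exact he.2

/-- `G[X]` is a chain of sausages of order `k` in `G`: identifying `V(G) ∖ X` to a
single vertex yields a doubled cycle of length `k + 1`. -/
def ChainOfSausages (G : MG V) (X : Finset V) (k : ℕ) : Prop :=
  X ⊆ G.verts ∧ X.card = k ∧ 2 ≤ k ∧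
  ∃ y0 ∈ G.verts \ X,
    IsDoubledCycleLen (mapGraph (collapseFun (G.verts \ X) y0) G) (k + 1)

/-- `G` is sausage reduced: it has no chain of sausages of order at least `3`. -/
def SausageReduced (G : MG V) : Prop :=
  ¬ ∃ (X : Finset V) (k : ℕ), 3 ≤ k ∧ ChainOfSausages G X k

/-- One sausage shortening step of a rooted graph: two adjacent vertices of a chain of
sausages of order at least three are identified, carrying the root along. -/
def RootedShortStep (p q : MG V × V) : Prop :=
  ∃ (X : Finset V) (k : ℕ) (a b : V),
    3 ≤ k ∧ ChainOfSausages p.1 X k ∧ a ∈ X ∧ b ∈ X ∧ a ≠ b ∧ s(a, b) ∈ p.1.edges ∧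
    q.1 = mapGraph (fun v => if v = b then a else v) p.1 ∧
    q.2 = (if p.2 = b then a else p.2)

/-- Deleting a single copy of the edge `e` from `G`. -/
def deleteEdge (G : MG V) (e : Sym2 V) : MG V where
  verts := G.verts
  edges := G.edges.erase e
  edge_support := fun e' he' => G.edge_support e' (Multiset.mem_of_mem_erase he')
  loopless := fun e' he' => G.loopless e' (Multiset.mem_of_mem_erase he')

/-- `G` has a tree-decomposition of width at most `k`. -/
def HasTreeDecomp (G : MG V) (k : ℕ) : Prop :=
  ∃ (ι : Type) (T : SimpleGraph ι) (B : ι → Finset V),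
    T.IsTree ∧
    (∀ t, B t ⊆ G.verts) ∧
    (∀ v ∈ G.verts, ∃ t, v ∈ B t) ∧
    (∀ e ∈ G.edges, ∃ t, ∀ v ∈ e, v ∈ B t) ∧
    (∀ v ∈ G.verts, (SimpleGraph.induce {t | v ∈ B t} T).Connected) ∧
    ∀ t, (B t).card ≤ k + 1

/-- The tree-width of `G`. -/
def treewidth (G : MG V) : ℕ := sInf { k | HasTreeDecomp G k }

/-- One subdivision step: an edge `uv` is replaced by a path `u - w - v`
through a new vertex `w`. -/
def SubdivStep (G H : MG V) : Prop :=
  ∃ u v w : V, s(u, v) ∈ G.edges ∧ w ∉ G.verts ∧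
    H.verts = insert w G.verts ∧
    H.edges = (G.edges.erase s(u, v)) + {s(u, w), s(w, v)}

/-- `H` is a subdivision of `G`. -/
def IsSubdivision (G H : MG V) : Prop := Relation.ReflTransGen SubdivStep G H

/-- `G`, rooted at `u`, has type 2 (for the rooted `W₄` theorem). -/
def TypeTwo (G : MG V) (u : V) : Prop :=
  ∃ W0 : Finset V, W0 ⊆ G.verts ∧ u ∉ W0 ∧ 1 ≤ W0.card ∧ W0.card ≤ 2 ∧
    ∃ w0 ∈ W0,
      ∃ n : ℕ, 3 ≤ n ∧
        ∃ f : Fin n → V,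
          Function.Injective f ∧
          Finset.univ.image f = (mapGraph (collapseFun W0 w0) G).verts ∧
          (∃ i, f i = u) ∧ (∃ j, f j = w0) ∧
          ((s(u, w0) ∉ cycleEdges n f ∧
              (mapGraph (collapseFun W0 w0) G).edges =
                2 • cycleEdges n f + {s(u, w0)}) ∨
           (∃ v : V, s(u, v) ∈ cycleEdges n f ∧ s(v, w0) ∈ cycleEdges n f ∧
              (mapGraph (collapseFun W0 w0) G).edges =
                2 • cycleEdges n f + {s(u, v), s(v, w0)}) ∨
           (s(u, w0) ∈ cycleEdges n f ∧
              (mapGraph (collapseFun W0 w0) G).edges =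
                2 • cycleEdges n f + {s(u, w0)}))

/-- `Red E F`: the edge multiset `F` is obtained from `E` by deleting edges and splitting off
pairs of edges at a common endpoint. -/
inductive Red : Multiset (Sym2 V) → Multiset (Sym2 V) → Prop
  | refl (E : Multiset (Sym2 V)) : Red E E
  | del {e : Sym2 V} {E F : Multiset (Sym2 V)} : Red E F → Red (e ::ₘ E) F
  | split {x y z : V} {E F : Multiset (Sym2 V)} :
      Red (s(x, z) ::ₘ E) F → Red (s(x, y) ::ₘ s(y, z) ::ₘ E) F

theorem Red.trans {E F H : Multiset (Sym2 V)} (h : Red E F) (h' : Red F H) : Red E H := by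
  induction h with
  | refl => exact h'
  | del _ ih => exact .del (ih h')
  | split _ ih => exact .split (ih h')

theorem Red.add_right {E F : Multiset (Sym2 V)} (h : Red E F) (H : Multiset (Sym2 V)) :
    Red (E + H) (F + H) := by
  induction h with
  | refl => exact .refl _
  | del _ ih => rw [Multiset.cons_add]; exact .del ih
  | split _ ih =>
    rw [Multiset.cons_add, Multiset.cons_add]
    rw [Multiset.cons_add] at ih
    exact .split ih

theorem Red.add_left {E F : Multiset (Sym2 V)} (h : Red E F) (H : Multiset (Sym2 V)) :
    Red (H + E) (H + F) := by
  rw [add_comm H E, add_comm H F]; exact h.add_right H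

theorem Red.cons {E F : Multiset (Sym2 V)} (h : Red E F) (e : Sym2 V) :
    Red (e ::ₘ E) (e ::ₘ F) := by
  simpa using h.add_left {e}

theorem Red.drop_left (E F : Multiset (Sym2 V)) : Red (E + F) F := by
  induction E using Multiset.induction_on with
  | empty => rw [zero_add]; exact .refl _
  | cons e E ih => rw [Multiset.cons_add]; exact .del ih

theorem Red.of_le {E F : Multiset (Sym2 V)} (h : F ≤ E) : Red E F := by
  obtain ⟨H, rfl⟩ := Multiset.le_iff_exists_add.1 h
  rw [add_comm]; exact .drop_left _ _

theorem Red.of_eq {E F : Multiset (Sym2 V)} (h : E = F) : Red E F := h ▸ .refl _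

theorem Red.mem_support {E F : Multiset (Sym2 V)} (h : Red E F) {v : V}
    (hv : ∃ e ∈ F, v ∈ e) : ∃ e ∈ E, v ∈ e := by
  induction h with
  | refl => exact hv
  | del _ ih =>
    obtain ⟨e, he, hve⟩ := ih hv
    exact ⟨e, Multiset.mem_cons_of_mem he, hve⟩
  | @split x y z E F _ ih =>
    obtain ⟨e, he, hve⟩ := ih hv
    rcases Multiset.mem_cons.1 he with rfl | he
    · rcases Sym2.mem_iff.1 hve with rfl | rfl
      · exact ⟨s(v, y), by simp, by simp⟩
      · exact ⟨s(y, v), by simp, by simp⟩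
    · exact ⟨e, by simp [he], hve⟩

/-- Index of the pair `{u, v}` in the triangular enumeration of pairs of natural numbers. -/
def idx (u v : ℕ) : ℕ :=
  bif Nat.blt u v then Nat.add (Nat.div (Nat.mul v (Nat.pred v)) 2) u
  else Nat.add (Nat.div (Nat.mul u (Nat.pred u)) 2) v

/-- The `i`-th hexadecimal digit of `x`. -/
def nth (x i : ℕ) : ℕ := Nat.land (Nat.shiftRight x (Nat.mul 4 i)) 15

/-- Decrement the `i`-th hexadecimal digit. -/
def decAt (x i : ℕ) : ℕ := Nat.sub x (Nat.shiftLeft 1 (Nat.mul 4 i))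

/-- Increment the `i`-th hexadecimal digit. -/
def incAt (x i : ℕ) : ℕ := Nat.add x (Nat.shiftLeft 1 (Nat.mul 4 i))

/-- `Dom n φ x E`: the edge multiset `E` has at least `nth x (idx u v)` edges between
`φ u` and `φ v`, for all `u < v < n`. -/
def Dom (n : ℕ) (φ : ℕ → V) (x : ℕ) (E : Multiset (Sym2 V)) : Prop :=
  ∀ u v, u < v → v < n → nth x (idx u v) ≤ E.count s(φ u, φ v)

/-- Boolean inequality of natural numbers. -/
def nne (a b : ℕ) : Bool := not (Nat.beq a b)

theorem nne_iff {a b : ℕ} : nne a b = true ↔ a ≠ b := by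
  rw [nne, Bool.not_eq_true', ne_eq, ← Nat.beq_eq, Bool.not_eq_true]

/-- `List.any`, defined directly by the recursor for efficient kernel reduction. -/
def someR {α : Type} (p : α → Bool) (l : List α) : Bool := List.rec false (fun a _ r => p a || r) l

theorem someR_iff {α : Type} {p : α → Bool} {l : List α} :
    someR p l = true ↔ ∃ a ∈ l, p a = true := by
  induction l with
  | nil => simp [someR]
  | cons a l ih =>
    have : someR p (a :: l) = (p a || someR p l) := rfl
    rw [this, Bool.or_eq_true, ih]
    simp

/-- Test whether some walk with at most `f` edges from `u` to `t` through `vs` can be removed from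
the multigraph `x` so that the rest passes the test `k`. -/
def walkThen (vs : List ℕ) (t : ℕ) (k : ℕ → Bool) (f : ℕ) : ℕ → ℕ → Bool :=
  Nat.rec (fun _ _ => false) (fun _ W x u =>
    bif Nat.beq (nth x (idx u t)) 0 then
      someR (fun w => nne w u && (nne w t && (nne (nth x (idx u w)) 0 && W (decAt x (idx u w)) w))) vs
    else k (decAt x (idx u t))) f

/-- Test whether edge-disjoint walks for all demands exist, by a greedy search. -/
def route (vs : List ℕ) (f : ℕ) (dem : List (ℕ × ℕ)) : ℕ → Bool :=
  List.rec (fun _ => true) (fun d _ r x =>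
    bif Nat.beq d.1 d.2 then r x else walkThen vs d.2 r f x d.1) dem

theorem nth_eq (x i : ℕ) : nth x i = x / 16 ^ i % 16 := by
  have h : nth x i = (x >>> (4 * i)) &&& (2 ^ 4 - 1) := rfl
  rw [h, Nat.and_two_pow_sub_one_eq_mod, Nat.shiftRight_eq_div_pow, pow_mul]
  norm_num

theorem incAt_eq (x i : ℕ) : incAt x i = x + 16 ^ i := by
  have h : incAt x i = x + 1 <<< (4 * i) := rfl
  rw [h, Nat.shiftLeft_eq, one_mul, pow_mul]
  norm_num

theorem nth_incAt {x i : ℕ} (h : nth x i < 15) :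
    nth (incAt x i) i = nth x i + 1 ∧ ∀ j, j ≠ i → nth (incAt x i) j = nth x j := by
  simp only [nth_eq, incAt_eq] at *
  have hp : 0 < 16 ^ i := by positivity
  have hq : (x + 16 ^ i) / 16 ^ i = x / 16 ^ i + 1 := Nat.add_div_right _ hp
  refine ⟨by rw [hq]; omega, fun j hj => ?_⟩
  rcases lt_or_gt_of_ne hj with hlt | hlt
  · obtain ⟨k, rfl⟩ := Nat.exists_eq_add_of_lt hlt
    have h1 : x + 16 ^ (j + k + 1) = x + 16 ^ j * (16 * 16 ^ k) := by ring
    rw [h1, Nat.add_mul_div_left _ _ (by positivity)]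
    omega
  · obtain ⟨k, rfl⟩ := Nat.exists_eq_add_of_lt hlt
    have h1 : 16 ^ (i + k + 1) = 16 ^ i * 16 * 16 ^ k := by ring
    rw [h1, ← Nat.div_div_eq_div_mul, ← Nat.div_div_eq_div_mul, hq, ← Nat.div_div_eq_div_mul,
      ← Nat.div_div_eq_div_mul]
    have : (x / 16 ^ i + 1) / 16 = x / 16 ^ i / 16 := by omega
    rw [this]

theorem nth_decAt {x i : ℕ} (h0 : nth x i ≠ 0) :
    nth x i = nth (decAt x i) i + 1 ∧ ∀ j, j ≠ i → nth x j = nth (decAt x i) j := by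
  obtain ⟨y, hy⟩ : ∃ y, decAt x i = y := ⟨_, rfl⟩
  rw [hy]
  have hy : y = x - 16 ^ i := by
    rw [← hy]
    change x - 1 <<< (4 * i) = _
    rw [Nat.shiftLeft_eq, one_mul, pow_mul]
    norm_num
  have hp : 0 < 16 ^ i := by positivity
  have hle : 16 ^ i ≤ x := by
    by_contra hlt
    rw [nth_eq, Nat.div_eq_of_lt (by omega)] at h0
    exact h0 rfl
  have hx : x = incAt y i := by rw [incAt_eq]; omega
  have hlt : nth y i < 15 := by
    rw [nth_eq] at h0 ⊢
    have : x / 16 ^ i = y / 16 ^ i + 1 := by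
      rw [hx, incAt_eq]; exact Nat.add_div_right _ hp
    omega
  rw [hx]
  exact nth_incAt hlt

theorem blt_of_lt {u v : ℕ} (h : u < v) : Nat.blt u v = true ∧ Nat.blt v u = false :=
  ⟨Nat.ble_eq_true_of_le h, Bool.eq_false_iff.2 fun h' => by
    have := Nat.le_of_ble_eq_true h'
    omega⟩

theorem idx_comm (u v : ℕ) : idx u v = idx v u := by
  unfold idx
  rcases lt_trichotomy u v with h | rfl | h
  · rw [(blt_of_lt h).1, (blt_of_lt h).2]; rfl
  · rfl
  · rw [(blt_of_lt h).1, (blt_of_lt h).2]; rfl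

theorem idx_inj : ∀ v < 8, ∀ u < v, ∀ v' < 8, ∀ u' < v', idx u v = idx u' v' → u = u' ∧ v = v' := by
  have key : (List.range 8).all (fun v => (List.range v).all fun u => (List.range 8).all fun v' =>
      (List.range v').all fun u' => bif Nat.beq (idx u v) (idx u' v') then
        Nat.beq u u' && Nat.beq v v' else true) = true := by decide +kernel
  simp only [List.all_eq_true, List.mem_range] at key
  intro v hv u hu v' hv' u' hu' h
  have := key v hv u hu v' hv' u' hu'
  rw [h, Nat.beq_refl, cond_true, Bool.and_eq_true] at this
  exact ⟨Nat.eq_of_beq_eq_true this.1, Nat.eq_of_beq_eq_true this.2⟩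

theorem Dom.decAt_aux {n : ℕ} (hn : n ≤ 8) {φ : ℕ → V} (hφ : ∀ i < n, ∀ j < n, φ i = φ j → i = j)
    {x : ℕ} {E : Multiset (Sym2 V)} (h : Dom n φ x E) {u v : ℕ} (hu : u < v) (hv : v < n)
    (hd : nth x (idx u v) ≠ 0) :
    ∃ E', E = s(φ u, φ v) ::ₘ E' ∧ Dom n φ (decAt x (idx u v)) E' := by
  obtain ⟨h1, h2⟩ := nth_decAt hd
  have hm : s(φ u, φ v) ∈ E := by
    rw [← Multiset.one_le_count_iff_mem]
    have := h u v hu hv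
    omega
  obtain ⟨E', rfl⟩ := Multiset.exists_cons_of_mem hm
  refine ⟨E', rfl, fun u' v' hu' hv' => ?_⟩
  have h3 := h u' v' hu' hv'
  by_cases he : u' = u ∧ v' = v
  · obtain ⟨rfl, rfl⟩ := he
    rw [Multiset.count_cons_self] at h3
    omega
  · have hne : s(φ u', φ v') ≠ s(φ u, φ v) := by
      intro hs
      rcases Sym2.eq_iff.1 hs with ⟨a, b⟩ | ⟨a, b⟩
      · exact he ⟨hφ _ (by omega) _ (by omega) a, hφ _ hv' _ hv b⟩
      · have := hφ _ (by omega) _ (by omega) a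
        have := hφ _ (by omega) _ (by omega) b
        omega
    rw [Multiset.count_cons_of_ne hne, h2 (idx u' v')] at h3
    · exact h3
    · intro hi
      exact he (idx_inj v' (by omega) u' hu' v (by omega) u hu hi)

theorem Dom.decAt {n : ℕ} (hn : n ≤ 8) {φ : ℕ → V} (hφ : ∀ i < n, ∀ j < n, φ i = φ j → i = j)
    {x : ℕ} {E : Multiset (Sym2 V)} (h : Dom n φ x E) {u v : ℕ} (huv : u ≠ v) (hu : u < n)
    (hv : v < n) (hd : nth x (idx u v) ≠ 0) :
    ∃ E', E = s(φ u, φ v) ::ₘ E' ∧ Dom n φ (decAt x (idx u v)) E' := by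
  rcases lt_or_gt_of_ne huv with hlt | hlt
  · exact h.decAt_aux hn hφ hlt hv hd
  · rw [idx_comm] at hd
    rw [Sym2.eq_swap, idx_comm]
    exact h.decAt_aux hn hφ hlt hu hd

theorem walkThen_sound {n : ℕ} (hn : n ≤ 8) {φ : ℕ → V}
    (hφ : ∀ i < n, ∀ j < n, φ i = φ j → i = j) {vs : List ℕ} (hvs : ∀ w ∈ vs, w < n)
    {k : ℕ → Bool} {f x u t : ℕ}
    (hut : u ≠ t) (hu : u < n) (ht : t < n) (h : walkThen vs t k f x u = true)
    {E : Multiset (Sym2 V)} (hE : Dom n φ x E) :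
    ∃ E' y, Red E (s(φ u, φ t) ::ₘ E') ∧ Dom n φ y E' ∧ k y = true := by
  induction f generalizing x u E with
  | zero => exact absurd h Bool.false_ne_true
  | succ f ih =>
    have h' : (bif Nat.beq (nth x (idx u t)) 0 then
      someR (fun w => nne w u && (nne w t && (nne (nth x (idx u w)) 0 &&
        walkThen vs t k f (decAt x (idx u w)) w))) vs
      else k (decAt x (idx u t))) = true := h
    cases hb : Nat.beq (nth x (idx u t)) 0 with
    | false =>
      rw [hb, cond_false] at h'
      obtain ⟨E', rfl, hE'⟩ := hE.decAt hn hφ hut hu ht (Nat.ne_of_beq_eq_false hb)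
      exact ⟨E', _, .refl _, hE', h'⟩
    | true =>
      rw [hb, cond_true, someR_iff] at h'
      obtain ⟨w, hw, h'⟩ := h'
      simp only [Bool.and_eq_true, nne_iff] at h'
      obtain ⟨hwu, hwt, hp, h'⟩ := h'
      have hw := hvs w hw
      obtain ⟨E1, rfl, hE1⟩ := hE.decAt hn hφ hwu.symm hu hw hp
      obtain ⟨E2, z, hr, hz, hk⟩ := ih hwt hw h' hE1
      exact ⟨E2, z, (hr.cons _).trans (.split (.refl _)), hz, hk⟩

/-- The non-loop edges of a list of demands, as an edge multiset. -/
def demEdges (φ : ℕ → V) : List (ℕ × ℕ) → Multiset (Sym2 V)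
  | [] => 0
  | (s, t) :: dem => bif Nat.beq s t then demEdges φ dem else s(φ s, φ t) ::ₘ demEdges φ dem

theorem route_sound {n : ℕ} (hn : n ≤ 8) {φ : ℕ → V}
    (hφ : ∀ i < n, ∀ j < n, φ i = φ j → i = j) {vs : List ℕ} (hvs : ∀ w ∈ vs, w < n) {f : ℕ}
    {dem : List (ℕ × ℕ)} (hdem : ∀ p ∈ dem, p.1 < n ∧ p.2 < n) {x : ℕ}
    (h : route vs f dem x = true)
    {E : Multiset (Sym2 V)} (hE : Dom n φ x E) : Red E (demEdges φ dem) := by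
  induction dem generalizing x E with
  | nil => exact .of_le (Multiset.zero_le _)
  | cons p dem ih =>
    obtain ⟨s, t⟩ := p
    have hp := hdem (s, t) (by simp)
    have hdem' : ∀ p ∈ dem, p.1 < n ∧ p.2 < n := fun p hp => hdem p (by simp [hp])
    have h' : (bif Nat.beq s t then route vs f dem x else
      walkThen vs t (route vs f dem) f x s) = true := h
    cases hst : Nat.beq s t with
    | true =>
      rw [hst, cond_true] at h'
      simp only [demEdges, hst, cond_true]
      exact ih hdem' h' hE
    | false =>
      rw [hst, cond_false] at h'
      simp only [demEdges, hst, cond_false]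
      obtain ⟨E', y, hr, hy, hk⟩ :=
        walkThen_sound hn hφ hvs (Nat.ne_of_beq_eq_false hst) hp.1 hp.2 h' hE
      exact hr.trans ((ih hdem' hk hy).cons _)

/-- Edges of the wheel with hub `p.1`. -/
def wheel (p : ℕ × ℕ × ℕ × ℕ × ℕ) : List (ℕ × ℕ) :=
  match p with
  | (h, a, b, c, d) => [(h, a), (h, b), (h, c), (h, d), (a, b), (b, c), (c, d), (d, a)]

/-- The fifteen labelled wheels on five vertices. -/
def wheels5 : List (ℕ × ℕ × ℕ × ℕ × ℕ) :=
  [(0, 1, 2, 3, 4), (0, 1, 3, 2, 4), (0, 1, 2, 4, 3),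
   (1, 0, 2, 3, 4), (1, 0, 3, 2, 4), (1, 0, 2, 4, 3),
   (2, 0, 1, 3, 4), (2, 0, 3, 1, 4), (2, 0, 1, 4, 3),
   (3, 0, 1, 2, 4), (3, 0, 2, 1, 4), (3, 0, 1, 4, 2),
   (4, 0, 1, 2, 3), (4, 0, 2, 1, 3), (4, 0, 1, 3, 2)]

/-- Sum of the entries of `x` at the given indices. -/
def cutSum (x : ℕ) (l : List ℕ) : ℕ := List.rec 0 (fun i _ s => Nat.add (nth x i) s) l

/-- Number of pairs without an edge. -/
def missing (x : ℕ) (l : List (ℕ × ℕ)) : ℕ :=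
  List.rec 0 (fun d _ r => bif Nat.beq (nth x (idx d.1 d.2)) 0 then Nat.add r 1 else r) l

/-- Greedy test for an immersion of one of the given wheels in a graph with vertices `vs`. -/
def hasWheel (vs : List ℕ) (ws : List (ℕ × ℕ × ℕ × ℕ × ℕ)) (x : ℕ) : Bool :=
  someR (fun p => Nat.ble (Nat.add 8 (missing x (wheel p))) (cutSum x [0,1,2,3,4,5,6,7,8,9]) &&
    route vs 3 ((wheel p).filter (fun d => nne (nth x (idx d.1 d.2)) 0) ++
      (wheel p).filter fun d => Nat.beq (nth x (idx d.1 d.2)) 0) x) ws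

/-- The cuts of a graph on five vertices as (lower bound, list of edge indices). -/
def cuts5 : List (ℕ × List ℕ) :=
  [(3, [0, 1, 3, 6]), (3, [0, 2, 4, 7]), (3, [1, 2, 5, 8]), (3, [3, 4, 5, 9]), (3, [6, 7, 8, 9]),
   (4, [1, 3, 6, 2, 4, 7]), (4, [0, 3, 6, 2, 5, 8]), (4, [0, 4, 7, 1, 5, 8]),
   (4, [0, 1, 6, 4, 5, 9]), (4, [0, 2, 7, 3, 5, 9]), (4, [1, 2, 8, 3, 4, 9]),
   (4, [0, 1, 3, 7, 8, 9]), (4, [0, 2, 4, 6, 8, 9]), (4, [1, 2, 5, 6, 7, 9]),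
   (4, [3, 4, 5, 6, 7, 8])]

/-- Whether the `i`-th hexadecimal digit is positive. -/
def flag (ex i : ℕ) : Bool := nne (nth ex i) 0

/-- No multigraph with lower bounds `x`, exact at the flags `ex`, satisfies the ordering at
vertex `0`. -/
def disordered (x ex : ℕ) : Bool :=
  (flag ex 0 && Nat.blt (nth x 0) (nth x 1)) || ((flag ex 1 && Nat.blt (nth x 1) (nth x 3)) ||
    (flag ex 3 && Nat.blt (nth x 3) (nth x 6)))

/-- Apply `k` to the indices of the first violated cut, and return `d` if there is none. -/
def firstCut (x : ℕ) (k : List ℕ → Bool) (d : Bool) (l : List (ℕ × List ℕ)) : Bool :=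
  List.rec d (fun c _ r => bif Nat.ble c.1 (cutSum x c.2) then r else k c.2) l

/-- The index with smallest entry of `x` among those of `l` whose flag is down, `10` if there
is none. -/
def pick (x ex : ℕ) (l : List ℕ) : ℕ :=
  List.rec 10 (fun i _ j => bif flag ex i then j else bif Nat.beq j 10 then i else
    bif Nat.ble (nth x i) (nth x j) then i else j) l

/-- Existential quantification over the numbers below five. -/
def fives (p : ℕ → Bool) : Bool := someR p [0, 1, 2, 3, 4]

/-- Detection of a chain of three sausages on `a, b, d`, whose edges are exact. -/
def hasChain (x ex : ℕ) : Bool :=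
  let m := fun u v k => flag ex (idx u v) && Nat.beq (nth x (idx u v)) k
  let m2 := fun a u w => flag ex (idx a u) && (flag ex (idx a w) &&
    Nat.beq (Nat.add (nth x (idx a u)) (nth x (idx a w))) 2)
  fives fun b => fives fun a => nne a b && (m a b 2 &&
    fives fun d => nne d a && (nne d b && (m b d 2 && (m a d 0 &&
    fives fun u => nne u a && (nne u b && (nne u d && (m b u 0 &&
    fives fun w => nne w a && (nne w b && (nne w d && (nne w u && (m b w 0 &&
      (m2 a u w && m2 d u w))))))))))))

/-- Detection of the two exceptional graphs, in which `e` is joined by double edges to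
`a, b, g`. -/
def isExc (x : ℕ) : Bool :=
  let m := fun u v k => Nat.beq (nth x (idx u v)) k
  fives fun d => fives fun e => nne d e && (m d e 0 &&
    fives fun a => nne a d && (nne a e && (m a d 1 && (m a e 2 &&
    fives fun b => nne b d && (nne b e && (nne b a && (m b d 1 && (m b e 2 &&
      (m a b 0 &&
    fives fun g => nne g d && (nne g e && (nne g a && (nne g b &&
      ((m g d 1 || m g d 2) && (m g e 2 && (m a g 0 && m b g 0)))))))))))))))

/-- Detection of chains and exceptional graphs. -/
def special (x ex : ℕ) : Bool :=
  hasChain x ex || (not (someR (fun i => not (flag ex i)) [0, 1, 2, 3, 4, 5, 6, 7, 8, 9]) && isExc x)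

/-- Branch on whether the `i`-th entry of `x` is exact. -/
def branch (r : ℕ → ℕ → Bool) (x ex i : ℕ) : Bool :=
  nne i 10 && (Nat.blt (nth x i) 15 && (r x (incAt ex i) && r (incAt x i) ex))

/-- Branch and bound over all multigraphs on five vertices. -/
def search (f : ℕ) : ℕ → ℕ → Bool :=
  Nat.rec (fun _ _ => false) (fun _ r x ex =>
    bif disordered x ex then true else
    firstCut x
      (fun l => bif Nat.beq (pick x ex l) 10 then true else branch r x ex (pick x ex l))
      (bif hasWheel [0, 1, 2, 3, 4] wheels5 x then true else bif special x ex then true else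
        branch r x ex (pick x ex [0, 1, 2, 3, 4, 5, 6, 7, 8, 9]))
      cuts5) f

theorem search_initial : search 50 0 0 = true := by decide +kernel

/-- `x` is a lower bound for `c` on the first ten indices, exact at the flags `ex`. -/
def Bounds (x ex : ℕ) (c : ℕ → ℕ) : Prop :=
  ∀ i < 10, nth x i ≤ c i ∧ (flag ex i = true → nth x i = c i)

/-- The counts of a five-vertex graph containing a chain of three sausages. -/
def ChainCounts (c : ℕ → ℕ) : Prop :=
  ∃ a b d u w, (a < 5 ∧ b < 5 ∧ d < 5 ∧ u < 5 ∧ w < 5) ∧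
    (a ≠ b ∧ d ≠ a ∧ d ≠ b ∧ u ≠ a ∧ u ≠ b ∧ u ≠ d ∧ w ≠ a ∧ w ≠ b ∧ w ≠ d ∧ w ≠ u) ∧
    c (idx a b) = 2 ∧ c (idx b d) = 2 ∧ c (idx a d) = 0 ∧ c (idx b u) = 0 ∧ c (idx b w) = 0 ∧
    c (idx a u) + c (idx a w) = 2 ∧ c (idx d u) + c (idx d w) = 2

/-- The counts of the two exceptional five-vertex graphs. -/
def ExcCounts (c : ℕ → ℕ) : Prop :=
  ∃ d e a b g, (d < 5 ∧ e < 5 ∧ a < 5 ∧ b < 5 ∧ g < 5) ∧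
    (d ≠ e ∧ a ≠ d ∧ a ≠ e ∧ b ≠ d ∧ b ≠ e ∧ b ≠ a ∧ g ≠ d ∧ g ≠ e ∧ g ≠ a ∧ g ≠ b) ∧
    c (idx d e) = 0 ∧ c (idx a d) = 1 ∧ c (idx a e) = 2 ∧ c (idx b d) = 1 ∧ c (idx b e) = 2 ∧
    c (idx a b) = 0 ∧ (c (idx g d) = 1 ∨ c (idx g d) = 2) ∧ c (idx g e) = 2 ∧
    c (idx a g) = 0 ∧ c (idx b g) = 0

theorem fives_iff {p : ℕ → Bool} : fives p = true ↔ ∃ i < 5, p i = true := by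
  rw [fives, someR_iff]
  constructor
  · rintro ⟨i, hi, h⟩
    refine ⟨i, ?_, h⟩
    simp at hi
    omega
  · rintro ⟨i, hi, h⟩
    refine ⟨i, ?_, h⟩
    simp
    omega

theorem idx_lt {u v : ℕ} (hu : u < 5) (hv : v < 5) (h : u ≠ v) : idx u v < 10 := by
  interval_cases u <;> interval_cases v <;> first | exact absurd rfl h | decide

theorem chainCounts_of_hasChain {x ex : ℕ} {c : ℕ → ℕ} (h : hasChain x ex = true)
    (hB : Bounds x ex c) : ChainCounts c := by
  simp only [hasChain, fives_iff, Bool.and_eq_true, nne_iff, Nat.beq_eq, Nat.add_eq] at h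
  obtain ⟨b, hb, a, ha, hab, h1, d, hd, hda, hdb, h2, h3, u, hu, hua, hub, hud, h4, w, hw, hwa,
    hwb, hwd, hwu, h5, h6, h7⟩ := h
  have hx : ∀ {u v}, u < 5 → v < 5 → u ≠ v → flag ex (idx u v) = true →
      nth x (idx u v) = c (idx u v) := fun hu hv h he => (hB _ (idx_lt hu hv h)).2 he
  refine ⟨a, b, d, u, w, ⟨ha, hb, hd, hu, hw⟩,
    ⟨hab, hda, hdb, hua, hub, hud, hwa, hwb, hwd, hwu⟩, ?_, ?_, ?_, ?_, ?_, ?_, ?_⟩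
  · rw [← hx ha hb hab h1.1]; exact h1.2
  · rw [← hx hb hd hdb.symm h2.1]; exact h2.2
  · rw [← hx ha hd hda.symm h3.1]; exact h3.2
  · rw [← hx hb hu hub.symm h4.1]; exact h4.2
  · rw [← hx hb hw hwb.symm h5.1]; exact h5.2
  · rw [← hx ha hu hua.symm h6.1, ← hx ha hw hwa.symm h6.2.1]; exact h6.2.2
  · rw [← hx hd hu hud.symm h7.1, ← hx hd hw hwd.symm h7.2.1]; exact h7.2.2

theorem excCounts_of_isExc {x : ℕ} {c : ℕ → ℕ} (h : isExc x = true)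
    (hB : ∀ i < 10, nth x i = c i) : ExcCounts c := by
  simp only [isExc, fives_iff, Bool.and_eq_true, Bool.or_eq_true, nne_iff, Nat.beq_eq] at h
  obtain ⟨d, hd, e, he, hde, h1, a, ha, had, hae, h2, h3, b, hb, hbd, hbe, hba, h4, h5, h6, g, hg,
    hgd, hge, hga, hgb, h7, h8, h9, h10⟩ := h
  have hx : ∀ {u v}, u < 5 → v < 5 → u ≠ v → nth x (idx u v) = c (idx u v) :=
    fun hu hv h => hB _ (idx_lt hu hv h)
  rw [hx hd he hde] at h1
  rw [hx ha hd had] at h2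
  rw [hx ha he hae] at h3
  rw [hx hb hd hbd] at h4
  rw [hx hb he hbe] at h5
  rw [hx ha hb hba.symm] at h6
  rw [hx hg hd hgd] at h7
  rw [hx hg he hge] at h8
  rw [hx ha hg hga.symm] at h9
  rw [hx hb hg hgb.symm] at h10
  exact ⟨d, e, a, b, g, ⟨hd, he, ha, hb, hg⟩, ⟨hde, had, hae, hbd, hbe, hba, hgd, hge, hga, hgb⟩,
    h1, h2, h3, h4, h5, h6, h7, h8, h9, h10⟩

theorem pick_spec {x ex : ℕ} {l : List ℕ} (hl : ∀ i ∈ l, i < 10) :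
    (pick x ex l = 10 ∧ ∀ i ∈ l, flag ex i = true) ∨
      (pick x ex l < 10 ∧ flag ex (pick x ex l) = false) := by
  induction l with
  | nil => exact .inl ⟨rfl, by simp⟩
  | cons i l ih =>
    have hp : pick x ex (i :: l) = bif flag ex i then pick x ex l else
      bif Nat.beq (pick x ex l) 10 then i else
        bif Nat.ble (nth x i) (nth x (pick x ex l)) then i else pick x ex l := rfl
    have hi := hl i (by simp)
    have ih := ih fun j hj => hl j (by simp [hj])
    rw [hp]
    cases hf : flag ex i with
    | true =>
      rw [cond_true]
      rcases ih with ⟨h1, h2⟩ | h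
      · exact .inl ⟨h1, by simpa [hf] using h2⟩
      · exact .inr h
    | false =>
      rw [cond_false]
      right
      rcases ih with ⟨h1, h2⟩ | h
      · rw [h1, Nat.beq_refl, cond_true]
        exact ⟨hi, hf⟩
      · rw [show Nat.beq (pick x ex l) 10 = false from by
          rw [← Bool.not_eq_true, Nat.beq_eq]; omega, cond_false]
        cases Nat.ble (nth x i) (nth x (pick x ex l)) with
        | true => exact ⟨hi, hf⟩
        | false => exact h

theorem firstCut_spec {x : ℕ} {k : List ℕ → Bool} {d : Bool} {l : List (ℕ × List ℕ)}
    (h : firstCut x k d l = true) :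
    d = true ∨ ∃ c ∈ l, cutSum x c.2 < c.1 ∧ k c.2 = true := by
  induction l with
  | nil => exact .inl h
  | cons c l ih =>
    have h' : (bif Nat.ble c.1 (cutSum x c.2) then firstCut x k d l else k c.2) = true := h
    cases hb : Nat.ble c.1 (cutSum x c.2) with
    | true =>
      rw [hb, cond_true] at h'
      rcases ih h' with h | ⟨c', hc, h⟩
      · exact .inl h
      · exact .inr ⟨c', by simp [hc], h⟩
    | false =>
      rw [hb, cond_false] at h'
      refine .inr ⟨c, by simp, ?_, h'⟩
      by_contra hle
      rw [Nat.ble_eq_true_of_le (by omega)] at hb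
      exact Bool.noConfusion hb

theorem cutSum_eq {x : ℕ} {l : List ℕ} : cutSum x l = (l.map (nth x)).sum := by
  induction l with
  | nil => rfl
  | cons i l ih =>
    have : cutSum x (i :: l) = nth x i + cutSum x l := rfl
    rw [this, ih, List.map_cons, List.sum_cons]

theorem flag_eq_false {ex i : ℕ} : flag ex i = false ↔ nth ex i = 0 := by
  rw [← Bool.not_eq_true, flag, nne_iff, not_not]

theorem branch_sound {r : ℕ → ℕ → Bool} {x ex i : ℕ} {c : ℕ → ℕ} (h : branch r x ex i = true)
    (hi : i < 10 → flag ex i = false) (hi' : i ≤ 10) (hB : Bounds x ex c) :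
    ∃ x' ex', r x' ex' = true ∧ Bounds x' ex' c := by
  simp only [branch, Bool.and_eq_true, nne_iff, Nat.blt_eq] at h
  obtain ⟨h10, h15, h1, h2⟩ := h
  have hi10 : i < 10 := by omega
  have hf := flag_eq_false.1 (hi hi10)
  rcases (hB i hi10).1.eq_or_lt with he | hlt
  · refine ⟨x, _, h1, fun j hj => ⟨(hB j hj).1, fun hfj => ?_⟩⟩
    by_cases hji : j = i
    · rw [hji, he]
    · apply (hB j hj).2
      rwa [flag, (nth_incAt (by omega)).2 j hji] at hfj
  · refine ⟨_, ex, h2, fun j hj => ?_⟩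
    by_cases hji : j = i
    · subst hji
      rw [(nth_incAt h15).1]
      refine ⟨hlt, fun hfj => ?_⟩
      rw [hi hi10] at hfj
      exact Bool.noConfusion hfj
    · rw [(nth_incAt h15).2 j hji]
      exact hB j hj

theorem search_sound {c : ℕ → ℕ} (hcut : ∀ p ∈ cuts5, p.1 ≤ (p.2.map c).sum)
    (hord : c 1 ≤ c 0 ∧ c 3 ≤ c 1 ∧ c 6 ≤ c 3) {f x ex : ℕ} (hB : Bounds x ex c)
    (h : search f x ex = true) :
    (∃ y, hasWheel [0, 1, 2, 3, 4] wheels5 y = true ∧ ∀ i < 10, nth y i ≤ c i) ∨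
      ChainCounts c ∨ ExcCounts c := by
  induction f generalizing x ex with
  | zero => exact Bool.noConfusion h
  | succ f ih =>
    have h' : (bif disordered x ex then true else
      firstCut x
        (fun l => bif Nat.beq (pick x ex l) 10 then true else branch (search f) x ex (pick x ex l))
        (bif hasWheel [0, 1, 2, 3, 4] wheels5 x then true else bif special x ex then true else
          branch (search f) x ex (pick x ex [0, 1, 2, 3, 4, 5, 6, 7, 8, 9])) cuts5) = true := h
    have hd : disordered x ex = false := by
      rw [← Bool.not_eq_true]
      intro hd
      simp only [disordered, Bool.or_eq_true, Bool.and_eq_true, Nat.blt_eq] at hd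
      have h0 := hB 0 (by omega)
      have h1 := hB 1 (by omega)
      have h3 := hB 3 (by omega)
      have h6 := hB 6 (by omega)
      rcases hd with ⟨hd, hd'⟩ | ⟨hd, hd'⟩ | ⟨hd, hd'⟩
      · have := h0.2 hd; omega
      · have := h1.2 hd; omega
      · have := h3.2 hd; omega
    rw [hd, cond_false] at h'
    have hbr : ∀ l : List ℕ, (∀ i ∈ l, i < 10) → branch (search f) x ex (pick x ex l) = true →
        (∃ y, hasWheel [0, 1, 2, 3, 4] wheels5 y = true ∧ ∀ i < 10, nth y i ≤ c i) ∨
          ChainCounts c ∨ ExcCounts c := by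
      intro l hl hb
      obtain ⟨x', ex', h1, h2⟩ := branch_sound hb (fun hlt => by
        rcases pick_spec (x := x) (ex := ex) hl with h | h
        · omega
        · exact h.2) (by rcases pick_spec (x := x) (ex := ex) hl with h | h <;> omega) hB
      exact ih h2 h1
    rcases firstCut_spec h' with h | ⟨p, hp, hlt, h⟩
    · cases hw : hasWheel [0, 1, 2, 3, 4] wheels5 x with
      | true => exact .inl ⟨x, hw, fun i hi => (hB i hi).1⟩
      | false =>
        rw [hw, cond_false] at h
        cases hs : special x ex with
        | true =>
          right
          rw [special, Bool.or_eq_true, Bool.and_eq_true] at hs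
          rcases hs with hs | ⟨hs, hs'⟩
          · exact .inl (chainCounts_of_hasChain hs hB)
          · refine .inr (excCounts_of_isExc hs' fun i hi => (hB i hi).2 ?_)
            by_contra hf
            rw [Bool.not_eq_true', ← Bool.not_eq_true, someR_iff] at hs
            apply hs
            refine ⟨i, by simp; omega, by simpa using hf⟩
        | false =>
          rw [hs, cond_false] at h
          exact hbr _ (by decide) h
    · have hl : ∀ q ∈ cuts5, ∀ i ∈ q.2, i < 10 := by decide
      cases hb : Nat.beq (pick x ex p.2) 10 with
      | false =>
        rw [hb, cond_false] at h
        exact hbr _ (hl p hp) h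
      | true =>
        exfalso
        rcases pick_spec (x := x) (ex := ex) (hl p hp) with h | h
        · have : p.2.map (nth x) = p.2.map c :=
            List.map_congr_left fun i hi => (hB i (hl p hp i hi)).2 (h.2 i hi)
          rw [cutSum_eq, this] at hlt
          have := hcut p hp
          omega
        · rw [Nat.eq_of_beq_eq_true hb] at h
          omega

/-- Contribution of an edge to the cut of `X`. -/
def cr (X : Finset V) : Sym2 V → ℕ :=
  Sym2.lift ⟨fun u v => if (u ∈ X ↔ v ∈ X) then 0 else 1, fun u v => by simp only [iff_comm]⟩

/-- Size of the cut of `X` in the edge multiset `E`. -/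
def d (E : Multiset (Sym2 V)) (X : Finset V) : ℕ := (E.map (cr X)).sum

@[simp] theorem cr_mk (X : Finset V) (u v : V) :
    cr X s(u, v) = if (u ∈ X ↔ v ∈ X) then 0 else 1 := rfl

@[simp] theorem d_zero (X : Finset V) : d 0 X = 0 := rfl

@[simp] theorem d_cons (e : Sym2 V) (E : Multiset (Sym2 V)) (X : Finset V) :
    d (e ::ₘ E) X = cr X e + d E X := by simp [d]

@[simp] theorem d_add (E F : Multiset (Sym2 V)) (X : Finset V) :
    d (E + F) X = d E X + d F X := by simp [d]

@[simp] theorem d_singleton (e : Sym2 V) (X : Finset V) : d {e} X = cr X e := by simp [d]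

theorem d_mono {E F : Multiset (Sym2 V)} (h : E ≤ F) (X : Finset V) : d E X ≤ d F X := by
  obtain ⟨H, rfl⟩ := Multiset.le_iff_exists_add.1 h
  simp

@[simp] theorem d_empty (E : Multiset (Sym2 V)) : d E ∅ = 0 := by
  induction E using Multiset.induction_on with
  | empty => rfl
  | cons e E ih => rw [d_cons, ih]; induction e using Sym2.ind; simp

/-- Number of edges of `E` joining `A` to `B`. -/
def crb (A B : Finset V) : Sym2 V → ℕ :=
  Sym2.lift ⟨fun u v => if (u ∈ A ∧ v ∈ B) ∨ (v ∈ A ∧ u ∈ B) then 1 else 0,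
    fun u v => by simp only [or_comm]⟩

@[simp] theorem crb_mk (A B : Finset V) (u v : V) :
    crb A B s(u, v) = if (u ∈ A ∧ v ∈ B) ∨ (v ∈ A ∧ u ∈ B) then 1 else 0 := rfl

theorem cr_submod (A B : Finset V) (e : Sym2 V) :
    cr (A ∩ B) e + cr (A ∪ B) e + 2 * crb (A \ B) (B \ A) e = cr A e + cr B e := by
  induction e using Sym2.ind with
  | _ u v =>
    simp only [cr_mk, crb_mk, Finset.mem_inter, Finset.mem_union, Finset.mem_sdiff]
    by_cases h1 : u ∈ A <;> by_cases h2 : v ∈ A <;> by_cases h3 : u ∈ B <;> by_cases h4 : v ∈ B <;>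
      simp [h1, h2, h3, h4]

theorem d_submod_eq (E : Multiset (Sym2 V)) (A B : Finset V) :
    d E (A ∩ B) + d E (A ∪ B) + 2 * (E.map (crb (A \ B) (B \ A))).sum = d E A + d E B := by
  induction E using Multiset.induction_on with
  | empty => simp
  | cons e E ih =>
    have := cr_submod A B e
    simp only [d_cons, Multiset.map_cons, Multiset.sum_cons]
    omega

theorem d_submod (E : Multiset (Sym2 V)) (A B : Finset V) :
    d E (A ∩ B) + d E (A ∪ B) ≤ d E A + d E B := by
  have := d_submod_eq E A B
  omega

theorem d_compl {S : Finset V} {E : Multiset (Sym2 V)} (hS : ∀ e ∈ E, ∀ v ∈ e, v ∈ S)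
    (X : Finset V) : d E (S \ X) = d E X := by
  unfold d
  congr 1
  refine Multiset.map_congr rfl fun e he => ?_
  have h := hS e he
  induction e using Sym2.ind with
  | _ u v =>
    have hu := h u (by simp)
    have hv := h v (by simp)
    simp only [cr_mk, Finset.mem_sdiff, hu, hv, true_and, not_iff_not]

theorem cr_eq_sum {S : Finset V} {e : Sym2 V} (h : ∀ v ∈ e, v ∈ S) (X : Finset V) :
    cr X e = ∑ u ∈ X, ∑ w ∈ S \ X, if s(u, w) = e then 1 else 0 := by
  induction e using Sym2.ind with
  | _ a b =>
    have ha := h a (by simp)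
    have hb := h b (by simp)
    by_cases h1 : a ∈ X <;> by_cases h2 : b ∈ X
    · simp only [cr_mk, h1, h2, iff_self, if_true]
      symm
      refine Finset.sum_eq_zero fun u hu => Finset.sum_eq_zero fun w hw => if_neg ?_
      rw [Finset.mem_sdiff] at hw
      rintro h
      rcases Sym2.eq_iff.1 h with ⟨rfl, rfl⟩ | ⟨rfl, rfl⟩ <;> exact hw.2 (by assumption)
    · have hb' : b ∈ S \ X := by simp [hb, h2]
      rw [Finset.sum_eq_single_of_mem a h1, Finset.sum_eq_single_of_mem b hb']
      · simp [h1, h2]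
      · intro w hw hwb
        rw [if_neg]
        rw [Sym2.eq_iff]
        rintro (⟨-, rfl⟩ | ⟨rfl, rfl⟩)
        · exact hwb rfl
        · exact h2 h1
      · intro u hu hua
        refine Finset.sum_eq_zero fun w hw => if_neg ?_
        rw [Sym2.eq_iff]
        rintro (⟨rfl, rfl⟩ | ⟨rfl, rfl⟩)
        · exact hua rfl
        · exact h2 hu
    · have ha' : a ∈ S \ X := by simp [ha, h1]
      rw [Finset.sum_eq_single_of_mem b h2, Finset.sum_eq_single_of_mem a ha']
      · simp [h1, h2]
      · intro w hw hwb
        rw [if_neg]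
        rw [Sym2.eq_iff]
        rintro (⟨rfl, rfl⟩ | ⟨-, rfl⟩)
        · exact h1 h2
        · exact hwb rfl
      · intro u hu hua
        refine Finset.sum_eq_zero fun w hw => if_neg ?_
        rw [Sym2.eq_iff]
        rintro (⟨rfl, rfl⟩ | ⟨rfl, rfl⟩)
        · exact h1 hu
        · exact hua rfl
    · simp only [cr_mk, h1, h2, iff_self, if_true]
      symm
      refine Finset.sum_eq_zero fun u hu => Finset.sum_eq_zero fun w hw => if_neg ?_
      rintro h
      rcases Sym2.eq_iff.1 h with ⟨rfl, rfl⟩ | ⟨rfl, rfl⟩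
      · exact h1 hu
      · exact h2 hu

theorem d_eq_sum {S : Finset V} {E : Multiset (Sym2 V)} (hS : ∀ e ∈ E, ∀ v ∈ e, v ∈ S)
    (X : Finset V) : d E X = ∑ u ∈ X, ∑ w ∈ S \ X, E.count s(u, w) := by
  induction E using Multiset.induction_on with
  | empty => simp
  | cons e E ih =>
    rw [d_cons, ih fun e he => hS e (Multiset.mem_cons_of_mem he),
      cr_eq_sum (hS e (Multiset.mem_cons_self _ _)) X, ← Finset.sum_add_distrib]
    refine Finset.sum_congr rfl fun u _ => ?_
    rw [← Finset.sum_add_distrib]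
    refine Finset.sum_congr rfl fun w _ => ?_
    rw [Multiset.count_cons, add_comm]

/-- `E` is the edge multiset of a 3-edge-connected, internally 4-edge-connected loopless graph with
vertex set `S`. -/
structure Good (S : Finset V) (E : Multiset (Sym2 V)) : Prop where
  supp : ∀ e ∈ E, ∀ v ∈ e, v ∈ S
  loopless : ∀ e ∈ E, ¬ e.IsDiag
  cut3 : ∀ X ⊆ S, X.Nonempty → X ≠ S → 3 ≤ d E X
  cut4 : ∀ X ⊆ S, 2 ≤ X.card → 2 ≤ (S \ X).card → 4 ≤ d E X

/-- Some wheel on four spokes can be obtained from `E` by deletions and splittings. -/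
def W4In (E : Multiset (Sym2 V)) : Prop :=
  ∃ φ : Fin 5 → V, Function.Injective φ ∧ Red E (w4Edges.map (Sym2.map φ))

theorem W4In.of_red {E F : Multiset (Sym2 V)} (h : Red E F) (hF : W4In F) : W4In E := by
  obtain ⟨φ, h1, h2⟩ := hF
  exact ⟨φ, h1, h.trans h2⟩

/-- Three vertices forming a chain of sausages. -/
structure Chain3 (S : Finset V) (E : Multiset (Sym2 V)) (p q r : V) : Prop where
  hp : p ∈ S
  hq : q ∈ S
  hr : r ∈ S
  dp : d E {p} = 4
  dq : d E {q} = 4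
  dr : d E {r} = 4
  pq : E.count s(p, q) = 2
  qr : E.count s(q, r) = 2
  pr : E.count s(p, r) = 0
  npr : p ≠ r

/-- The two exceptional graphs on five vertices, given by their edge multiplicities. -/
structure Exc (S : Finset V) (E : Multiset (Sym2 V)) (a b g c e : V) : Prop where
  hS : S = {a, b, g, c, e}
  nodup : [a, b, g, c, e].Nodup
  ce : E.count s(c, e) = 0
  ac : E.count s(a, c) = 1
  ae : E.count s(a, e) = 2
  bc : E.count s(b, c) = 1
  be : E.count s(b, e) = 2
  ab : E.count s(a, b) = 0
  gc : E.count s(g, c) = 1 ∨ E.count s(g, c) = 2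
  ge : E.count s(g, e) = 2
  ag : E.count s(a, g) = 0
  bg : E.count s(b, g) = 0

theorem demEdges_eq {φ : ℕ → V} {l : List (ℕ × ℕ)} (h : ∀ p ∈ l, p.1 ≠ p.2) :
    demEdges φ l = (↑(l.map fun p => s(φ p.1, φ p.2)) : Multiset (Sym2 V)) := by
  induction l with
  | nil => rfl
  | cons p l ih =>
    have hp : Nat.beq p.1 p.2 = false := by
      rw [← Bool.not_eq_true, Nat.beq_eq]; exact h p (by simp)
    rw [demEdges, hp, cond_false, ih fun q hq => h q (by simp [hq])]
    rfl

theorem w4In_of_route {n : ℕ} (hn : n ≤ 8) {φ : ℕ → V}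
    (hφ : ∀ i < n, ∀ j < n, φ i = φ j → i = j) {vs : List ℕ} (hvs : ∀ w ∈ vs, w < n)
    {h0 a b g e : ℕ} (hnd : [h0, a, b, g, e].Nodup) (hlt : ∀ i ∈ [h0, a, b, g, e], i < n)
    {dem : List (ℕ × ℕ)} (hperm : dem.Perm (wheel (h0, a, b, g, e))) {f x : ℕ}
    (h : route vs f dem x = true) {E : Multiset (Sym2 V)} (hE : Dom n φ x E) : W4In E := by
  simp only [List.mem_cons, List.not_mem_nil, or_false, forall_eq_or_imp, forall_eq] at hlt
  obtain ⟨l0, la, lb, lg, le⟩ := hlt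
  simp only [List.nodup_cons, List.mem_cons, List.not_mem_nil, or_false, not_or,
    not_false_eq_true, List.nodup_nil, and_true] at hnd
  obtain ⟨⟨n1, n2, n3, n4⟩, ⟨n5, n6, n7⟩, ⟨n8, n9⟩, n10⟩ := hnd
  have hw : ∀ q ∈ dem, (q.1 < n ∧ q.2 < n) ∧ q.1 ≠ q.2 := by
    intro q hq
    have hq := hperm.mem_iff.1 hq
    simp only [wheel, List.mem_cons, List.not_mem_nil, or_false] at hq
    rcases hq with rfl | rfl | rfl | rfl | rfl | rfl | rfl | rfl <;> simp <;> omega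
  have hr := route_sound hn hφ hvs (fun q hq => (hw q hq).1) h hE
  rw [demEdges_eq fun q hq => (hw q hq).2] at hr
  refine ⟨![φ h0, φ a, φ b, φ g, φ e], ?_, ?_⟩
  · intro i j hij
    fin_cases i <;> fin_cases j <;> first | rfl | (exfalso; simp at hij; have := hφ _ (by assumption) _ (by assumption) hij; omega)
  · refine hr.trans (.of_eq ?_)
    rw [Multiset.coe_eq_coe.2 (hperm.map _)]
    simp [wheel, w4Edges]
    rfl

theorem w4In_of_hasWheel {n : ℕ} (hn : n ≤ 8) {φ : ℕ → V}
    (hφ : ∀ i < n, ∀ j < n, φ i = φ j → i = j) {vs : List ℕ} (hvs : ∀ w ∈ vs, w < n)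
    {ws : List (ℕ × ℕ × ℕ × ℕ × ℕ)}
    (hws : ∀ p ∈ ws, [p.1, p.2.1, p.2.2.1, p.2.2.2.1, p.2.2.2.2].Nodup ∧
      ∀ i ∈ [p.1, p.2.1, p.2.2.1, p.2.2.2.1, p.2.2.2.2], i < n) {x : ℕ}
    (h : hasWheel vs ws x = true) {E : Multiset (Sym2 V)} (hE : Dom n φ x E) : W4In E := by
  rw [hasWheel, someR_iff] at h
  obtain ⟨⟨h0, a, b, g, e⟩, hp, h⟩ := h
  rw [Bool.and_eq_true] at h
  obtain ⟨hnd, hlt⟩ := hws _ hp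
  refine w4In_of_route hn hφ hvs hnd hlt ?_ h.2 hE
  have := List.filter_append_perm (fun d => nne (nth x (idx d.1 d.2)) 0) (wheel (h0, a, b, g, e))
  simpa only [nne, Bool.not_not] using this

theorem exists_sorted_labelling {S : Finset V} (hc : S.card = 5) (f : V → V → ℕ) :
    ∃ φ : ℕ → V, (∀ i < 5, ∀ j < 5, φ i = φ j → i = j) ∧ S = (Finset.range 5).image φ ∧
      f (φ 0) (φ 2) ≤ f (φ 0) (φ 1) ∧ f (φ 0) (φ 3) ≤ f (φ 0) (φ 2) ∧
      f (φ 0) (φ 4) ≤ f (φ 0) (φ 3) := by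
  obtain ⟨v, hv⟩ : S.Nonempty := Finset.card_pos.1 (by omega)
  have h4 : (S.erase v).card = 4 := by rw [Finset.card_erase_of_mem hv, hc]
  let e := (Finset.equivFinOfCardEq h4).symm
  have hm := Tuple.monotone_sort (fun i => f v (e i))
  set σ := Tuple.sort (fun i => f v (e i))
  let x : Fin 4 → V := fun i => e (σ i)
  have hx : Function.Injective x :=
    Subtype.val_injective.comp (e.injective.comp σ.injective)
  have hxv : ∀ i, x i ∈ S.erase v := fun i => (e (σ i)).2
  have hne : ∀ i, x i ≠ v := fun i => (Finset.mem_erase.1 (hxv i)).1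
  let φ : ℕ → V := fun n => match n with
    | 0 => v | 1 => x 3 | 2 => x 2 | 3 => x 1 | _ => x 0
  have hφ : ∀ i < 5, ∀ j < 5, φ i = φ j → i = j := by
    intro i hi j hj hij
    interval_cases i <;> interval_cases j <;> first
      | rfl
      | exact absurd hij (hne _)
      | exact absurd hij.symm (hne _)
      | exact absurd (hx hij) (by decide)
  refine ⟨φ, hφ, ?_, hm (show (2 : Fin 4) ≤ 3 by decide), hm (show (1 : Fin 4) ≤ 2 by decide),
    hm (show (0 : Fin 4) ≤ 1 by decide)⟩
  symm
  apply Finset.eq_of_subset_of_card_le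
  · intro w hw
    obtain ⟨i, hi, rfl⟩ := Finset.mem_image.1 hw
    rw [Finset.mem_range] at hi
    interval_cases i
    · exact hv
    all_goals exact Finset.mem_of_mem_erase (hxv _)
  · rw [hc, Finset.card_image_of_injOn]
    · simp
    · intro i hi j hj hij
      exact hφ i (by simpa using hi) j (by simpa using hj) hij

theorem d_image_eq_sum {n : ℕ} {φ : ℕ → V} (hφ : ∀ i < n, ∀ j < n, φ i = φ j → i = j)
    {E : Multiset (Sym2 V)} (hS : ∀ e ∈ E, ∀ v ∈ e, v ∈ (Finset.range n).image φ) {I J : Finset ℕ}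
    (hI : I ⊆ Finset.range n) (hJ : Finset.range n \ I = J) :
    d E (I.image φ) = ∑ i ∈ I, ∑ j ∈ J, E.count s(φ i, φ j) := by
  have hinj : Set.InjOn φ (Finset.range n) := fun i hi j hj h =>
    hφ i (by simpa using hi) j (by simpa using hj) h
  have hc : (Finset.range n).image φ \ I.image φ = J.image φ := by
    rw [← hJ, Finset.image_sdiff_of_injOn hinj hI]
  rw [d_eq_sum hS, Finset.sum_image (hinj.mono (Finset.coe_subset.2 hI)), hc]
  refine Finset.sum_congr rfl fun i _ => Finset.sum_image (hinj.mono ?_)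
  rw [← hJ]
  exact_mod_cast Finset.sdiff_subset

/-- The pairs of numbers below five, ordered by `idx`. -/
def tri5 : List (ℕ × ℕ) :=
  [(0, 1), (0, 2), (1, 2), (0, 3), (1, 3), (2, 3), (0, 4), (1, 4), (2, 4), (3, 4)]

set_option maxHeartbeats 1000000 in
theorem base_five {S : Finset V} {E : Multiset (Sym2 V)} (h : Good S E) (hc : S.card = 5) :
    W4In E ∨ (∃ p q r, Chain3 S E p q r) ∨ ∃ a b g c e, Exc S E a b g c e := by
  obtain ⟨φ, hφ, rfl, o1, o2, o3⟩ := exists_sorted_labelling hc fun u v => E.count s(u, v)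
  obtain ⟨c, hcdef⟩ : ∃ c : ℕ → ℕ, c = fun i =>
    E.count s(φ (tri5.getD i (0, 0)).1, φ (tri5.getD i (0, 0)).2) := ⟨_, rfl⟩
  have hidx : ∀ u < 5, ∀ v < 5, u ≠ v → c (idx u v) = E.count s(φ u, φ v) := by
    intro u hu v hv huv
    rw [hcdef]
    interval_cases u <;> interval_cases v <;> first
      | exact absurd rfl huv
      | rfl
      | (rw [Sym2.eq_swap]; rfl)
  have hinj : Set.InjOn φ (Finset.range 5) := fun i hi j hj h =>
    hφ i (by simpa using hi) j (by simpa using hj) h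
  have hcut : ∀ (I J : Finset ℕ) (k : ℕ), I ⊆ Finset.range 5 → Finset.range 5 \ I = J →
      (k = 3 ∧ I.Nonempty ∧ J.Nonempty ∨ k = 4 ∧ 2 ≤ I.card ∧ 2 ≤ J.card) →
      k ≤ ∑ i ∈ I, ∑ j ∈ J, c (idx i j) := by
    intro I J k hI hJ hk
    have hs : ∑ i ∈ I, ∑ j ∈ J, c (idx i j) = d E (I.image φ) := by
      rw [d_image_eq_sum hφ h.supp hI hJ]
      refine Finset.sum_congr rfl fun i hi => Finset.sum_congr rfl fun j hj => ?_
      rw [← hJ, Finset.mem_sdiff] at hj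
      exact hidx i (by simpa using hI hi) j (by simpa using hj.1) fun hij => hj.2 (hij ▸ hi)
    have hcompl : (Finset.range 5).image φ \ I.image φ = J.image φ := by
      rw [← hJ, Finset.image_sdiff_of_injOn hinj hI]
    have hJ' : J ⊆ Finset.range 5 := hJ ▸ Finset.sdiff_subset
    rw [hs]
    rcases hk with ⟨rfl, h1, h2⟩ | ⟨rfl, h1, h2⟩
    · refine h.cut3 _ (Finset.image_subset_image hI) (h1.image φ) fun he => ?_
      rw [he, Finset.sdiff_self] at hcompl
      obtain ⟨j, hj⟩ := h2
      exact Finset.notMem_empty _ (hcompl ▸ Finset.mem_image_of_mem φ hj)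
    · refine h.cut4 _ (Finset.image_subset_image hI) ?_ ?_
      · rwa [Finset.card_image_of_injOn (hinj.mono (Finset.coe_subset.2 hI))]
      · rwa [hcompl, Finset.card_image_of_injOn (hinj.mono (Finset.coe_subset.2 hJ'))]
  have hix : (idx 0 1 = 0 ∧ idx 0 2 = 1 ∧ idx 1 2 = 2 ∧ idx 0 3 = 3 ∧ idx 1 3 = 4) ∧
      (idx 2 3 = 5 ∧ idx 0 4 = 6 ∧ idx 1 4 = 7 ∧ idx 2 4 = 8 ∧ idx 3 4 = 9) ∧
      (idx 1 0 = 0 ∧ idx 2 0 = 1 ∧ idx 2 1 = 2 ∧ idx 3 0 = 3 ∧ idx 3 1 = 4) ∧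
      (idx 3 2 = 5 ∧ idx 4 0 = 6 ∧ idx 4 1 = 7 ∧ idx 4 2 = 8 ∧ idx 4 3 = 9) := by decide
  have hcuts : ∀ p ∈ cuts5, p.1 ≤ (p.2.map c).sum := by
    have H : ∀ p ∈ cuts5, ∃ I J : Finset ℕ, I ⊆ Finset.range 5 ∧ Finset.range 5 \ I = J ∧
      (p.1 = 3 ∧ I.Nonempty ∧ J.Nonempty ∨ p.1 = 4 ∧ 2 ≤ I.card ∧ 2 ≤ J.card) ∧
      ∑ i ∈ I, ∑ j ∈ J, c (idx i j) = (p.2.map c).sum := by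
      simp only [cuts5, List.mem_cons, List.not_mem_nil, or_false]
      rintro p (rfl | rfl | rfl | rfl | rfl | rfl | rfl | rfl | rfl | rfl | rfl | rfl | rfl | rfl | rfl)
      · exact ⟨{0}, {1, 2, 3, 4}, by decide, by decide, by decide, by simp [hix]; try omega⟩
      · exact ⟨{1}, {0, 2, 3, 4}, by decide, by decide, by decide, by simp [hix]; try omega⟩
      · exact ⟨{2}, {0, 1, 3, 4}, by decide, by decide, by decide, by simp [hix]; try omega⟩
      · exact ⟨{3}, {0, 1, 2, 4}, by decide, by decide, by decide, by simp [hix]; try omega⟩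
      · exact ⟨{4}, {0, 1, 2, 3}, by decide, by decide, by decide, by simp [hix]; try omega⟩
      · exact ⟨{0, 1}, {2, 3, 4}, by decide, by decide, by decide, by simp [hix]; try omega⟩
      · exact ⟨{0, 2}, {1, 3, 4}, by decide, by decide, by decide, by simp [hix]; try omega⟩
      · exact ⟨{1, 2}, {0, 3, 4}, by decide, by decide, by decide, by simp [hix]; try omega⟩
      · exact ⟨{0, 3}, {1, 2, 4}, by decide, by decide, by decide, by simp [hix]; try omega⟩
      · exact ⟨{1, 3}, {0, 2, 4}, by decide, by decide, by decide, by simp [hix]; try omega⟩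
      · exact ⟨{2, 3}, {0, 1, 4}, by decide, by decide, by decide, by simp [hix]; try omega⟩
      · exact ⟨{0, 4}, {1, 2, 3}, by decide, by decide, by decide, by simp [hix]; try omega⟩
      · exact ⟨{1, 4}, {0, 2, 3}, by decide, by decide, by decide, by simp [hix]; try omega⟩
      · exact ⟨{2, 4}, {0, 1, 3}, by decide, by decide, by decide, by simp [hix]; try omega⟩
      · exact ⟨{3, 4}, {0, 1, 2}, by decide, by decide, by decide, by simp [hix]; try omega⟩
    intro p hp
    obtain ⟨I, J, h1, h2, h3, h4⟩ := H p hp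
    rw [← h4]
    exact hcut I J _ h1 h2 h3
  have hdeg : ∀ i j k l m : ℕ, (i < 5 ∧ j < 5 ∧ k < 5 ∧ l < 5 ∧ m < 5) → [i, j, k, l, m].Nodup →
      d E {φ i} = c (idx i j) + (c (idx i k) + (c (idx i l) + c (idx i m))) := by
    rintro i j k l m ⟨hi, hj, hk, hl, hm⟩ hnd
    simp only [List.nodup_cons, List.mem_cons, List.not_mem_nil, or_false, not_or,
      not_false_eq_true, List.nodup_nil, and_true] at hnd
    obtain ⟨⟨n1, n2, n3, n4⟩, ⟨n5, n6, n7⟩, ⟨n8, n9⟩, n10⟩ := hnd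
    have hJ : Finset.range 5 \ {i} = {j, k, l, m} := by
      symm
      apply Finset.eq_of_subset_of_card_le
      · intro t ht
        simp only [Finset.mem_insert, Finset.mem_singleton] at ht
        simp only [Finset.mem_sdiff, Finset.mem_range, Finset.mem_singleton]
        omega
      · rw [Finset.card_sdiff_of_subset (by simpa using hi)]
        simp [n5, n6, n7, n8, n9, n10]
    have := d_image_eq_sum hφ h.supp (I := {i}) (by simpa using hi) hJ
    rw [Finset.image_singleton] at this
    rw [this, hidx i hi j hj n1, hidx i hi k hk n2, hidx i hi l hl n3, hidx i hi m hm n4]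
    simp [n5, n6, n7, n8, n9, n10]
  have hS : ∀ i < 5, φ i ∈ (Finset.range 5).image φ := fun i hi =>
    Finset.mem_image_of_mem φ (Finset.mem_range.2 hi)
  have ho : c 1 ≤ c 0 ∧ c 3 ≤ c 1 ∧ c 6 ≤ c 3 := by rw [hcdef]; exact ⟨o1, o2, o3⟩
  have hn0 : ∀ i, nth 0 i = 0 := fun i => by simp [nth_eq]
  rcases search_sound hcuts ho (fun i _ => by simp [hn0, flag, nne]) search_initial with
    ⟨y, hy, hyc⟩ | ⟨a, b, g, u, w, ⟨ha, hb, hg, hu, hw⟩, hne, h1, h2, h3, h4, h5, h6, h7⟩ |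
    ⟨g, e, a, b, t, ⟨hg, he, ha, hb, ht⟩, hne, h1, h2, h3, h4, h5, h6, h7, h8, h9, h10⟩
  · left
    refine w4In_of_hasWheel (by norm_num) hφ (by simp) (by decide) hy fun u v huv hv => ?_
    rw [← hidx u (by omega) v hv (by omega)]
    exact hyc _ (idx_lt (by omega) hv (by omega))
  · right; left
    have e1 := hdeg a b g u w ⟨ha, hb, hg, hu, hw⟩ (by simp; omega)
    have e2 := hdeg b a g u w ⟨hb, ha, hg, hu, hw⟩ (by simp; omega)
    have e3 := hdeg g a b u w ⟨hg, ha, hb, hu, hw⟩ (by simp; omega)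
    rw [idx_comm b a] at e2
    rw [idx_comm g a, idx_comm g b] at e3
    exact ⟨φ a, φ b, φ g, hS a ha, hS b hb, hS g hg, by omega, by omega, by omega,
      by rw [← hidx a ha b hb (by omega), h1], by rw [← hidx b hb g hg (by omega), h2],
      by rw [← hidx a ha g hg (by omega), h3], fun hh => by have := hφ a ha g hg hh; omega⟩
  · right; right
    have hnd : ([a, b, t, g, e].map φ).Nodup := by
      refine List.Nodup.map_on ?_ (by simp; omega)
      intro x hx y hy hxy
      simp only [List.mem_cons, List.not_mem_nil, or_false] at hx hy
      exact hφ x (by omega) y (by omega) hxy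
    refine ⟨φ a, φ b, φ t, φ g, φ e, ?_, hnd, ?_, ?_, ?_, ?_, ?_, ?_, ?_, ?_, ?_, ?_⟩
    · symm
      apply Finset.eq_of_subset_of_card_le
      · intro x hx
        simp only [Finset.mem_insert, Finset.mem_singleton] at hx
        rcases hx with rfl | rfl | rfl | rfl | rfl <;> exact hS _ (by assumption)
      · rw [hc, show ({φ a, φ b, φ t, φ g, φ e} : Finset V) = [φ a, φ b, φ t, φ g, φ e].toFinset by
          simp]
        exact (List.toFinset_card_of_nodup hnd).ge
    · rw [Sym2.eq_swap, ← hidx e he g hg (by omega), idx_comm, h1]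
    · rw [← hidx a ha g hg (by omega), h2]
    · rw [← hidx a ha e he (by omega), h3]
    · rw [← hidx b hb g hg (by omega), h4]
    · rw [← hidx b hb e he (by omega), h5]
    · rw [← hidx a ha b hb (by omega), h6]
    · rwa [← hidx t ht g hg (by omega)]
    · rw [← hidx t ht e he (by omega), h8]
    · rw [← hidx a ha t ht (by omega), h9]
    · rw [← hidx b hb t ht (by omega), h10]

theorem Red.card_le {E F : Multiset (Sym2 V)} (h : Red E F) : F.card ≤ E.card := by
  induction h with
  | refl => exact le_rfl
  | del _ ih => simp; omega
  | split _ ih => simp at ih ⊢; omega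

/-- Number of edges of `E` joining `A` to `B`. -/
def ee (E : Multiset (Sym2 V)) (A B : Finset V) : ℕ := (E.map (crb A B)).sum

@[simp] theorem ee_zero (A B : Finset V) : ee 0 A B = 0 := rfl

@[simp] theorem ee_cons (e : Sym2 V) (E : Multiset (Sym2 V)) (A B : Finset V) :
    ee (e ::ₘ E) A B = crb A B e + ee E A B := by simp [ee]

theorem d_union {E : Multiset (Sym2 V)} {A B : Finset V} (h : Disjoint A B) :
    d E (A ∪ B) + 2 * ee E A B = d E A + d E B := by
  have := d_submod_eq E A B
  rw [Finset.disjoint_iff_inter_eq_empty.1 h, d_empty, Finset.sdiff_eq_self_of_disjoint h,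
    Finset.sdiff_eq_self_of_disjoint h.symm, zero_add] at this
  exact this

theorem ee_singleton (E : Multiset (Sym2 V)) (p q : V) : ee E {p} {q} = E.count s(p, q) := by
  induction E using Multiset.induction_on with
  | empty => simp
  | cons e E ih =>
    rw [ee_cons, ih, Multiset.count_cons, add_comm]
    congr 1
    induction e using Sym2.ind with
    | _ u v =>
      simp only [crb_mk, Finset.mem_singleton, Sym2.eq_iff]
      congr 1
      apply propext
      constructor <;> rintro (⟨rfl, rfl⟩ | ⟨rfl, rfl⟩) <;> simp

theorem d_pair {E : Multiset (Sym2 V)} {p q : V} (h : p ≠ q) :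
    d E {p, q} + 2 * E.count s(p, q) = d E {p} + d E {q} := by
  rw [← ee_singleton, ← d_union (Finset.disjoint_singleton.2 h)]
  rfl

theorem exists_of_ee_pos {E : Multiset (Sym2 V)} {A B : Finset V} (h : 0 < ee E A B) :
    ∃ u ∈ A, ∃ v ∈ B, s(u, v) ∈ E := by
  induction E using Multiset.induction_on with
  | empty => simp at h
  | cons e E ih =>
    rw [ee_cons] at h
    by_cases h1 : 0 < ee E A B
    · obtain ⟨u, hu, v, hv, huv⟩ := ih h1
      exact ⟨u, hu, v, hv, Multiset.mem_cons_of_mem huv⟩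
    · induction e using Sym2.ind with
      | _ u v =>
        rw [crb_mk] at h
        split_ifs at h with h2
        · rcases h2 with ⟨h2, h3⟩ | ⟨h2, h3⟩
          · exact ⟨u, h2, v, h3, Multiset.mem_cons_self _ _⟩
          · exact ⟨v, h2, u, h3, by rw [Sym2.eq_swap]; exact Multiset.mem_cons_self _ _⟩
        · omega

theorem ee_pos_of_mem {E : Multiset (Sym2 V)} {A B : Finset V} {u v : V} (hu : u ∈ A) (hv : v ∈ B)
    (h : s(u, v) ∈ E) : 0 < ee E A B := by
  obtain ⟨F, rfl⟩ := Multiset.exists_cons_of_mem h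
  simp [hu, hv]

theorem d_pos_of_mem {E : Multiset (Sym2 V)} {A : Finset V} {u v : V} (hu : u ∈ A) (hv : v ∉ A)
    (h : s(u, v) ∈ E) : 0 < d E A := by
  obtain ⟨F, rfl⟩ := Multiset.exists_cons_of_mem h
  simp [hu, hv]

/-- The map contracting `X` to `y`. -/
def cmap (X : Finset V) (y : V) (v : V) : V := if v ∈ X then y else v

/-- The edges left after contracting `X` to its vertex `y`. -/
def contr (X : Finset V) (y : V) (E : Multiset (Sym2 V)) : Multiset (Sym2 V) :=
  (E.filter fun e => ¬ ∀ v ∈ e, v ∈ X).map (Sym2.map (cmap X y))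

theorem contr_cons_of_inside {X : Finset V} {y u v : V} {E : Multiset (Sym2 V)} (hu : u ∈ X)
    (hv : v ∈ X) : contr X y (s(u, v) ::ₘ E) = contr X y E := by
  rw [contr, Multiset.filter_cons_of_neg, contr]
  simp [hu, hv]

theorem contr_cons_of_not_inside {X : Finset V} {y u v : V} {E : Multiset (Sym2 V)}
    (h : ¬ (u ∈ X ∧ v ∈ X)) :
    contr X y (s(u, v) ::ₘ E) = s(cmap X y u, cmap X y v) ::ₘ contr X y E := by
  rw [contr, Multiset.filter_cons_of_pos, contr]
  · simp
  · simpa using h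

theorem d_contr (X : Finset V) (y : V) (E : Multiset (Sym2 V)) (Z : Finset V) :
    d (contr X y E) Z = d E (if y ∈ Z then Z ∪ X else Z \ X) := by
  induction E using Multiset.induction_on with
  | empty => simp [contr]
  | cons e E ih =>
    induction e using Sym2.ind with
    | _ u v =>
      by_cases h : u ∈ X ∧ v ∈ X
      · rw [contr_cons_of_inside h.1 h.2, ih, d_cons]
        split_ifs <;> simp [h]
      · rw [contr_cons_of_not_inside h, d_cons, d_cons, ih]
        congr 1
        have hm : ∀ w, cmap X y w ∈ Z ↔ w ∈ (if y ∈ Z then Z ∪ X else Z \ X) := by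
          intro w
          unfold cmap
          by_cases h1 : w ∈ X <;> by_cases h2 : y ∈ Z <;> simp [h1, h2]
        simp only [cr_mk, hm]

theorem red_contr {X : Finset V} {y : V} (hy : y ∈ X) {E : Multiset (Sym2 V)}
    (hE : ∀ W ⊆ X, y ∈ W → d E X ≤ d E W) : Red E (contr X y E) := by
  induction hn : E.card using Nat.strong_induction_on generalizing E with
  | _ n ih =>
  subst hn
  by_cases hb : ∃ z h, z ∉ X ∧ h ∈ X ∧ h ≠ y ∧ s(z, h) ∈ E
  swap
  · have : contr X y E = E.filter fun e => ¬ ∀ v ∈ e, v ∈ X := by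
      rw [contr]
      conv_rhs => rw [← Multiset.map_id (E.filter fun e => ¬ ∀ v ∈ e, v ∈ X)]
      refine Multiset.map_congr rfl fun e he => ?_
      rw [Multiset.mem_filter] at he
      push Not at hb
      induction e using Sym2.ind with
      | _ u v =>
        have h1 : ¬ (u ∈ X ∧ v ∈ X) := by simpa using he.2
        have h2 : u ∈ X → u = y := fun hu => by
          by_contra hne
          exact hb v u (fun hv => h1 ⟨hu, hv⟩) hu hne (by rw [Sym2.eq_swap]; exact he.1)
        have h3 : v ∈ X → v = y := fun hv => by
          by_contra hne
          exact hb u v (fun hu => h1 ⟨hu, hv⟩) hv hne he.1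
        have h4 : ∀ w, (w ∈ X → w = y) → cmap X y w = w := fun w hw => by
          unfold cmap
          split_ifs with h
          · exact (hw h).symm
          · rfl
        simp [h4 u h2, h4 v h3]
    rw [this]
    exact .of_le (Multiset.filter_le _ _)
  by_cases hdel : ∃ u v F, u ∈ X ∧ v ∈ X ∧ E = s(u, v) ::ₘ F ∧ ∀ W ⊆ X, y ∈ W → d E X ≤ d F W
  · obtain ⟨u, v, F, hu, hv, rfl, hF⟩ := hdel
    rw [contr_cons_of_inside hu hv]
    refine Red.del (ih F.card (by simp) (fun W hW hyW => le_trans ?_ (hF W hW hyW)) rfl)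
    simp
  obtain ⟨z, h, hz, hh, hhy, hzh⟩ := hb
  have hzy : ∀ W ⊆ X, z ∉ W := fun W hW hzW => hz (hW hzW)
  obtain ⟨W, hW, hWmin⟩ := Finset.exists_min_image
    (X.powerset.filter fun W => y ∈ W ∧ h ∈ W ∧ d E W = d E X) Finset.card
    ⟨X, by simp [hy, hh]⟩
  simp only [Finset.mem_filter, Finset.mem_powerset] at hW hWmin
  obtain ⟨hWX, hyW, hhW, hdW⟩ := hW
  have hmin : ∀ A ⊆ X, y ∈ A → h ∈ A → d E A = d E X → W ⊆ A := by
    intro A hA hyA hhA hdA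
    have h1 := d_submod E A W
    have h2 := hE (A ∩ W) (Finset.inter_subset_right.trans hWX) (by simp [*])
    have h3 := hE (A ∪ W) (Finset.union_subset hA hWX) (by simp [*])
    have h4 := hWmin (A ∩ W) ⟨Finset.inter_subset_right.trans hWX, by simp [*], by simp [*], by omega⟩
    rw [← Finset.eq_of_subset_of_card_le Finset.inter_subset_right h4]
    exact Finset.inter_subset_left
  obtain ⟨w, hwW, hwh, hhw⟩ : ∃ w ∈ W, w ≠ h ∧ s(h, w) ∈ E := by
    have h1 : d E (W.erase h ∪ {h}) + _ = _ := d_union (E := E) (A := W.erase h) (B := {h}) (by simp)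
    have h2 : W.erase h ∪ {h} = W := by
      rw [Finset.union_comm]; exact Finset.insert_erase hhW
    rw [h2] at h1
    have h3 := hE (W.erase h) ((Finset.erase_subset _ _).trans hWX) (by simp [hyW, hhy.symm])
    have h4 : 0 < d E {h} := d_pos_of_mem (u := h) (v := z) (by simp)
      (by simpa using fun hh' : z = h => hz (hh' ▸ hh)) (by rwa [Sym2.eq_swap])
    obtain ⟨w, hw, h', hh', hm⟩ := exists_of_ee_pos (E := E) (A := W.erase h) (B := {h}) (by omega)
    rw [Finset.mem_singleton] at hh'
    subst hh'
    exact ⟨w, Finset.mem_of_mem_erase hw, Finset.ne_of_mem_erase hw, by rwa [Sym2.eq_swap]⟩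
  have hwX := hWX hwW
  have hzw : z ≠ w := fun hh' => hz (hh' ▸ hwX)
  have hzh' : z ≠ h := fun hh' => hz (hh' ▸ hh)
  obtain ⟨F, rfl⟩ : ∃ F, E = s(z, h) ::ₘ s(h, w) ::ₘ F := by
    obtain ⟨F, rfl⟩ := Multiset.exists_cons_of_mem hzh
    rw [Multiset.mem_cons] at hhw
    rcases hhw with hhw | hhw
    · rcases Sym2.eq_iff.1 hhw with ⟨h1, -⟩ | ⟨-, h1⟩
      · exact absurd h1.symm hzh'
      · exact absurd h1.symm hzw
    · obtain ⟨F, rfl⟩ := Multiset.exists_cons_of_mem hhw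
      exact ⟨F, rfl⟩
  obtain ⟨A, hA, hyA, hdA⟩ : ∃ A ⊆ X, y ∈ A ∧
      d (s(z, h) ::ₘ F) A < d (s(z, h) ::ₘ s(h, w) ::ₘ F) X := by
    by_contra hcon
    push Not at hcon
    exact hdel ⟨h, w, s(z, h) ::ₘ F, hh, hwX, Multiset.cons_swap _ _ _, hcon⟩
  have hA2 := hE A hA hyA
  have hAhw : ¬ (h ∈ A ↔ w ∈ A) := by
    intro hiff
    simp only [d_cons, cr_mk, hiff, iff_self, if_true] at hdA hA2
    omega
  have hAt : d (s(z, h) ::ₘ s(h, w) ::ₘ F) A = d (s(z, h) ::ₘ s(h, w) ::ₘ F) X := by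
    have h1 : cr A s(h, w) = 1 := by rw [cr_mk, if_neg hAhw]
    rw [d_cons] at hdA
    have h2 : d (s(z, h) ::ₘ s(h, w) ::ₘ F) A = cr A s(z, h) + (1 + d F A) := by
      rw [d_cons, d_cons, h1]
    omega
  have hAh : h ∉ A := fun hhA => hAhw ⟨fun _ => hmin A hA hyA hhA hAt hwW, fun _ => hhA⟩
  have hAw : w ∈ A := by by_contra h'; exact hAhw ⟨fun h1 => absurd h1 hAh, fun h1 => absurd h1 h'⟩
  have key : ∀ B ⊆ X, y ∈ B → d (s(z, h) ::ₘ s(h, w) ::ₘ F) X ≤ d (s(z, w) ::ₘ F) B := by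
    intro B hB hyB
    have h1 := hE B hB hyB
    have hzB := hzy B hB
    by_cases hc : h ∈ B ∧ w ∉ B
    · have h2 := d_submod_eq (s(z, h) ::ₘ s(h, w) ::ₘ F) A B
      have h3 := hE (A ∩ B) (Finset.inter_subset_right.trans hB) (by simp [*])
      have h4 := hE (A ∪ B) (Finset.union_subset hA hB) (by simp [*])
      have h5 : 0 < ee (s(z, h) ::ₘ s(h, w) ::ₘ F) (A \ B) (B \ A) :=
        ee_pos_of_mem (u := w) (v := h) (by simp [hAw, hc]) (by simp [hAh, hc]) (by
          rw [Sym2.eq_swap]; simp)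
      rw [ee] at h5
      have h6 : d (s(z, h) ::ₘ s(h, w) ::ₘ F) B = d (s(z, w) ::ₘ F) B + 2 := by
        simp [hc, hzB]; ring
      omega
    · refine h1.trans (le_of_eq ?_)
      by_cases h3 : h ∈ B <;> by_cases h4 : w ∈ B <;> simp_all
  have hX : d (s(z, w) ::ₘ F) X = d (s(z, h) ::ₘ s(h, w) ::ₘ F) X := by simp [hz, hh, hwX]
  have := ih (s(z, w) ::ₘ F).card (by simp) (fun B hB hyB => hX ▸ key B hB hyB) rfl
  refine Red.split this |>.trans (.of_eq ?_)
  rw [contr_cons_of_not_inside (by simp [hz]), contr_cons_of_not_inside (by simp [hz]),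
    contr_cons_of_inside hh hwX]
  simp [cmap, hh, hwX]

theorem sum_count_le (E : Multiset (Sym2 V)) {p : V} {T : Finset V} (hp : p ∉ T) :
    ∑ w ∈ T, E.count s(p, w) ≤ d E {p} := by
  induction E using Multiset.induction_on with
  | empty => simp
  | cons e E ih =>
    rw [d_cons]
    simp only [Multiset.count_cons, Finset.sum_add_distrib]
    rw [add_comm]
    refine Nat.add_le_add ?_ ih
    induction e using Sym2.ind with
    | _ u v =>
      by_cases h : ∃ w ∈ T, s(p, w) = s(u, v)
      · obtain ⟨w, hw, h⟩ := h
        have hpw : w ≠ p := fun h' => hp (h' ▸ hw)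
        rw [← h, Finset.sum_eq_single_of_mem w hw]
        · simp [hpw]
        · intro b _ hb
          rw [if_neg]
          intro hh
          rcases Sym2.eq_iff.1 hh with ⟨-, h1⟩ | ⟨h1, h2⟩
          · exact hb h1
          · exact hpw h1.symm
      · rw [Finset.sum_eq_zero]
        · exact Nat.zero_le _
        · intro w hw
          rw [if_neg]
          exact fun h' => h ⟨w, hw, h'⟩

theorem ee_singleton_eq_sum (E : Multiset (Sym2 V)) {p : V} {T : Finset V} (hp : p ∉ T) :
    ee E {p} T = ∑ w ∈ T, E.count s(p, w) := by
  induction E using Multiset.induction_on with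
  | empty => simp
  | cons e E ih =>
    rw [ee_cons, ih]
    simp only [Multiset.count_cons, Finset.sum_add_distrib]
    rw [add_comm]
    congr 1
    induction e using Sym2.ind with
    | _ u v =>
      by_cases h : ∃ w ∈ T, s(p, w) = s(u, v)
      · obtain ⟨w, hw, h⟩ := h
        rw [← h, Finset.sum_eq_single_of_mem w hw]
        · simp [hw]
        · intro b _ hb
          rw [if_neg]
          intro hh
          rcases Sym2.eq_iff.1 hh with ⟨-, h1⟩ | ⟨h1, h2⟩
          · exact hb h1
          · exact hp (h1 ▸ hw)
      · rw [Finset.sum_eq_zero]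
        · rw [crb_mk, if_neg]
          simp only [Finset.mem_singleton]
          rintro (⟨rfl, h1⟩ | ⟨rfl, h1⟩)
          · exact h ⟨v, h1, rfl⟩
          · exact h ⟨u, h1, Sym2.eq_swap⟩
        · intro w hw
          rw [if_neg]
          exact fun h' => h ⟨w, hw, h'⟩

namespace Good

variable {S : Finset V} {E : Multiset (Sym2 V)}

theorem three_le (h : Good S E) (hc : 2 ≤ S.card) {v : V} (hv : v ∈ S) : 3 ≤ d E {v} :=
  h.cut3 _ (by simpa using hv) (by simp) fun he => by rw [← he] at hc; simp at hc

theorem count_self (h : Good S E) (v : V) : E.count s(v, v) = 0 :=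
  Multiset.count_eq_zero.2 fun hm => h.loopless _ hm (by simp)

theorem ne_of_count (h : Good S E) {u v : V} (hc : 0 < E.count s(u, v)) : u ≠ v := by
  rintro rfl
  rw [h.count_self] at hc
  exact absurd hc (lt_irrefl _)

theorem delete {u v : V} {F : Multiset (Sym2 V)} (h : Good S (s(u, v) ::ₘ F))
    (hu : 4 ≤ d (s(u, v) ::ₘ F) {u}) (hv : 4 ≤ d (s(u, v) ::ₘ F) {v})
    (hZ : ∀ Z ⊆ S, u ∈ Z → v ∉ Z → 2 ≤ Z.card → 2 ≤ (S \ Z).card →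
      5 ≤ d (s(u, v) ::ₘ F) Z) : Good S F := by
  have huS : u ∈ S := h.supp s(u, v) (by simp) u (by simp)
  have hvS : v ∈ S := h.supp s(u, v) (by simp) v (by simp)
  have hsupp : ∀ e ∈ F, ∀ w ∈ e, w ∈ S := fun e he => h.supp e (by simp [he])
  have key : ∀ Z ⊆ S, Z.Nonempty → Z ≠ S → u ∈ Z → v ∉ Z →
      3 ≤ d F Z ∧ (2 ≤ Z.card → 2 ≤ (S \ Z).card → 4 ≤ d F Z) := by
    intro Z hZS hne hnS huZ hvZ
    have h1 : ∀ Y : Finset V, u ∈ Y → v ∉ Y → d (s(u, v) ::ₘ F) Y = d F Y + 1 := by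
      intro Y h1 h2
      rw [d_cons, cr_mk, if_neg (by simp [h1, h2]), add_comm]
    have h2 := h1 Z huZ hvZ
    have h3 : 2 ≤ Z.card → 2 ≤ (S \ Z).card → 4 ≤ d F Z := fun h4 h5 => by
      have := hZ Z hZS huZ hvZ h4 h5
      omega
    refine ⟨?_, h3⟩
    by_cases h4 : 2 ≤ Z.card
    · by_cases h5 : 2 ≤ (S \ Z).card
      · have := h3 h4 h5
        omega
      · have h6 : S \ Z = {v} := by
          symm
          apply Finset.eq_of_subset_of_card_le
          · simp [hvS, hvZ]
          · simp; omega
        rw [← d_compl hsupp, h6]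
        rw [d_cons, cr_mk] at hv
        split_ifs at hv <;> omega
    · have h6 : Z = {u} := by
        symm
        apply Finset.eq_of_subset_of_card_le
        · simpa using huZ
        · simp; omega
      subst h6
      omega
  have key' : ∀ Z ⊆ S, Z.Nonempty → Z ≠ S →
      3 ≤ d F Z ∧ (2 ≤ Z.card → 2 ≤ (S \ Z).card → 4 ≤ d F Z) := by
    intro Z hZS hne hnS
    by_cases h1 : u ∈ Z ↔ v ∈ Z
    · have h2 : d (s(u, v) ::ₘ F) Z = d F Z := by rw [d_cons, cr_mk, if_pos h1, zero_add]
      rw [← h2]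
      exact ⟨h.cut3 Z hZS hne hnS, h.cut4 Z hZS⟩
    · by_cases h2 : u ∈ Z
      · exact key Z hZS hne hnS h2 fun h3 => h1 ⟨fun _ => h3, fun _ => h2⟩
      · have h3 : v ∈ Z := by by_contra h3; exact h1 ⟨fun h => absurd h h2, fun h => absurd h h3⟩
        have := key (S \ Z) Finset.sdiff_subset ⟨u, by simp [huS, h2]⟩
          (fun he => by
            obtain ⟨w, hw⟩ := hne
            exact (Finset.mem_sdiff.1 (he.symm.subset (hZS hw))).2 hw) (by simp [huS, h2]) (by simp [h3])
        rw [d_compl hsupp, Finset.sdiff_sdiff_eq_self hZS] at this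
        exact ⟨this.1, fun h4 h5 => this.2 h5 h4⟩
  exact ⟨hsupp, fun e he => h.loopless e (by simp [he]), fun Z h1 h2 h3 => (key' Z h1 h2 h3).1,
    fun Z h1 h2 h3 => (key' Z h1 (Finset.card_pos.1 (by omega)) (by
      rintro rfl; simp at h3)).2 h2 h3⟩

theorem contr (h : Good S E) {X : Finset V} {y : V} (hX : X ⊆ S) (hy : y ∈ X) :
    Good (insert y (S \ X)) (contr X y E) := by
  have hsub : ∀ Z ⊆ insert y (S \ X), Z ⊆ (if y ∈ Z then Z ∪ X else Z \ X) ∧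
      (if y ∈ Z then Z ∪ X else Z \ X) ⊆ S ∧
      insert y (S \ X) \ Z ⊆ S \ (if y ∈ Z then Z ∪ X else Z \ X) := by
    intro Z hZ
    have h0 : ∀ w ∈ Z, w = y ∨ w ∈ S ∧ w ∉ X := fun w hw => by simpa using hZ hw
    have hyS := hX hy
    refine ⟨fun w hw => ?_, fun w hw => ?_, fun w hw => ?_⟩
    · rcases h0 w hw with rfl | h1
      · simp [hw]
      · split_ifs <;> simp [hw, h1]
    · split_ifs at hw
      · rcases Finset.mem_union.1 hw with hw | hw
        · rcases h0 w hw with rfl | h1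
          · exact hyS
          · exact h1.1
        · exact hX hw
      · rcases h0 w (Finset.mem_sdiff.1 hw).1 with rfl | h1
        · exact hyS
        · exact h1.1
    · simp only [Finset.mem_sdiff, Finset.mem_insert] at hw
      obtain ⟨rfl | h1, h2⟩ := hw
      · simp [h2, hyS]
      · split_ifs <;> simp [h1, h2]
  constructor
  · intro e he v hv
    rw [PaperW4.contr, Multiset.mem_map] at he
    obtain ⟨f, hf, rfl⟩ := he
    obtain ⟨w, hw, rfl⟩ := Sym2.mem_map.1 hv
    have := h.supp f (Multiset.mem_filter.1 hf).1 w hw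
    unfold cmap
    split_ifs with h1 <;> simp [h1, this]
  · intro e he
    rw [PaperW4.contr, Multiset.mem_map] at he
    obtain ⟨f, hf, rfl⟩ := he
    rw [Multiset.mem_filter] at hf
    have := h.loopless f hf.1
    induction f using Sym2.ind with
    | _ u v =>
      have h1 : ¬ (u ∈ X ∧ v ∈ X) := by simpa using hf.2
      have h2 : u ≠ v := by simpa using this
      rw [Sym2.map_mk, Sym2.mk_isDiag_iff]
      unfold cmap
      by_cases h3 : u ∈ X <;> by_cases h4 : v ∈ X
      · exact absurd ⟨h3, h4⟩ h1
      · simp only [h3, h4, if_true, if_false]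
        rintro rfl
        exact h4 hy
      · simp only [h3, h4, if_true, if_false]
        rintro rfl
        exact h3 hy
      · simpa [h3, h4] using h2
  · intro Z hZ hne hnS
    rw [d_contr]
    obtain ⟨h1, h2, h3⟩ := hsub Z hZ
    refine h.cut3 _ h2 (hne.mono h1) fun he => hnS ?_
    rw [he, Finset.sdiff_self, Finset.subset_empty, Finset.sdiff_eq_empty_iff_subset] at h3
    exact Finset.Subset.antisymm hZ h3
  · intro Z hZ hc1 hc2
    rw [d_contr]
    obtain ⟨h1, h2, h3⟩ := hsub Z hZ
    exact h.cut4 _ h2 (hc1.trans (Finset.card_le_card h1)) (hc2.trans (Finset.card_le_card h3))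

end Good

theorem d_contr_of_disjoint {X Z : Finset V} {y : V} (hy : y ∈ X) (h : Disjoint Z X)
    (E : Multiset (Sym2 V)) : d (contr X y E) Z = d E Z := by
  rw [d_contr, if_neg fun hyZ => Finset.disjoint_left.1 h hyZ hy, Finset.sdiff_eq_self_of_disjoint h]

theorem d_contr_self (X : Finset V) {y : V} (hy : y ∈ X)
    (E : Multiset (Sym2 V)) : d (contr X y E) {y} = d E X := by
  rw [d_contr, if_pos (by simp), Finset.union_eq_right.2 (by simpa using hy)]

theorem count_contr_self {X : Finset V} {y v : V} (hy : y ∈ X) (hv : v ∉ X)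
    (E : Multiset (Sym2 V)) : (contr X y E).count s(v, y) = ∑ x ∈ X, E.count s(v, x) := by
  have hvy : v ≠ y := fun h => hv (h ▸ hy)
  have h1 := d_pair (E := contr X y E) hvy
  have h2 : ({v, y} : Finset V) ∪ X = {v} ∪ X := by
    ext w; simp only [Finset.mem_union, Finset.mem_insert, Finset.mem_singleton]
    constructor
    · rintro ((h | rfl) | h) <;> simp [*]
    · rintro (h | h) <;> simp [*]
  rw [d_contr_self X hy, d_contr_of_disjoint (Z := {v}) hy (by simpa using hv), d_contr,
    if_pos (by simp), h2] at h1
  have h3 := d_union (E := E) (A := {v}) (B := X) (by simpa using hv)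
  rw [ee_singleton_eq_sum E hv] at h3
  omega

/-- The conclusion of the structure theorem for graphs with a vertex of degree at least four and no
`W4`. -/
def T (S : Finset V) (E : Multiset (Sym2 V)) : Prop :=
  (∃ p q r, Chain3 S E p q r) ∨ ∃ a b g c e, Exc S E a b g c e

theorem count_congr {E F : Multiset (Sym2 V)} {p q : V} (h : p ≠ q) (h1 : d E {p} = d F {p})
    (h2 : d E {q} = d F {q}) (h3 : d E {p, q} = d F {p, q}) :
    E.count s(p, q) = F.count s(p, q) := by
  have e1 := d_pair (E := E) h
  have e2 := d_pair (E := F) h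
  omega

theorem Chain3.congr {S S' : Finset V} {E E' : Multiset (Sym2 V)} {p q r : V}
    (h : Chain3 S' E' p q r) (hG : Good S' E') (hp : p ∈ S) (hq : q ∈ S) (hr : r ∈ S)
    (hd : ∀ Z ⊆ {p, q, r}, d E Z = d E' Z) : Chain3 S E p q r := by
  have hpq : p ≠ q := hG.ne_of_count (by rw [h.pq]; norm_num)
  have hqr : q ≠ r := hG.ne_of_count (by rw [h.qr]; norm_num)
  have e1 := hd {p} (by simp)
  have e2 := hd {q} (by simp)
  have e3 := hd {r} (by simp)
  refine ⟨hp, hq, hr, e1.trans h.dp, e2.trans h.dq, e3.trans h.dr, ?_, ?_, ?_, h.npr⟩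
  · rw [← h.pq]; exact count_congr hpq e1 e2 (hd _ (by intro; simp; tauto))
  · rw [← h.qr]; exact count_congr hqr e2 e3 (hd _ (by intro; simp; tauto))
  · rw [← h.pr]; exact count_congr h.npr e1 e3 (hd _ (by intro; simp; tauto))

theorem d_singleton_five {S : Finset V} {E : Multiset (Sym2 V)} (hE : ∀ e ∈ E, ∀ v ∈ e, v ∈ S)
    {a b g c e : V} (hS : ∀ v, v ∈ S ↔ v = a ∨ v = b ∨ v = g ∨ v = c ∨ v = e)
    (hnd : [a, b, g, c, e].Nodup) :
    d E {a} = E.count s(a, b) + (E.count s(a, g) + (E.count s(a, c) + E.count s(a, e))) := by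
  simp only [List.nodup_cons, List.mem_cons, List.not_mem_nil, or_false, not_or,
    not_false_eq_true, List.nodup_nil, and_true] at hnd
  obtain ⟨⟨n1, n2, n3, n4⟩, ⟨n5, n6, n7⟩, ⟨n8, n9⟩, n10⟩ := hnd
  have h1 : S \ {a} = {b, g, c, e} := by
    ext v
    simp only [Finset.mem_sdiff, hS, Finset.mem_singleton, Finset.mem_insert]
    constructor
    · tauto
    · rintro (rfl | rfl | rfl | rfl) <;> simp [Ne.symm, *]
  rw [d_eq_sum hE, Finset.sum_singleton, h1]
  simp [*]

namespace Exc

variable {S : Finset V} {E : Multiset (Sym2 V)} {a b g c e : V}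

theorem mem_iff (h : Exc S E a b g c e) (v : V) :
    v ∈ S ↔ v = a ∨ v = b ∨ v = g ∨ v = c ∨ v = e := by
  rw [h.hS]; simp

theorem degrees (h : Exc S E a b g c e) (hE : ∀ e ∈ E, ∀ v ∈ e, v ∈ S) :
    d E {a} = 3 ∧ d E {b} = 3 ∧ d E {g} = E.count s(g, c) + 2 ∧
      d E {c} = E.count s(g, c) + 2 ∧ d E {e} = 6 := by
  have hnd := h.nodup
  have hs := h.mem_iff
  have hn2 : [b, a, g, c, e].Nodup := by simp at hnd ⊢; grind
  have hn3 : [g, a, b, c, e].Nodup := by simp at hnd ⊢; grind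
  have hn4 : [c, a, b, g, e].Nodup := by simp at hnd ⊢; grind
  have hn5 : [e, a, b, g, c].Nodup := by simp at hnd ⊢; grind
  have h1 := d_singleton_five hE hs hnd
  have h2 := d_singleton_five hE (a := b) (b := a) (g := g) (c := c) (e := e)
    (fun v => by rw [hs]; tauto) hn2
  have h3 := d_singleton_five hE (a := g) (b := a) (g := b) (c := c) (e := e)
    (fun v => by rw [hs]; tauto) hn3
  have h4 := d_singleton_five hE (a := c) (b := a) (g := b) (c := g) (e := e)
    (fun v => by rw [hs]; tauto) hn4
  have h5 := d_singleton_five hE (a := e) (b := a) (g := b) (c := g) (e := c)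
    (fun v => by rw [hs]; tauto) hn5
  have := h.ce; have := h.ac; have := h.ae; have := h.bc; have := h.be; have := h.ab
  have := h.gc; have := h.ge; have := h.ag; have := h.bg
  rw [Sym2.eq_swap (a := b) (b := a)] at h2
  rw [Sym2.eq_swap (a := g) (b := a), Sym2.eq_swap (a := g) (b := b)] at h3
  rw [Sym2.eq_swap (a := c) (b := a), Sym2.eq_swap (a := c) (b := b),
    Sym2.eq_swap (a := c) (b := g)] at h4
  rw [Sym2.eq_swap (a := e) (b := a), Sym2.eq_swap (a := e) (b := b),
    Sym2.eq_swap (a := e) (b := g), Sym2.eq_swap (a := e) (b := c)] at h5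
  omega

end Exc

/-- The situation of a graph on at least six vertices to which the structure theorem does not apply,
although it applies to all smaller graphs. -/
structure Min (S : Finset V) (E : Multiset (Sym2 V)) : Prop where
  good : Good S E
  card : 6 ≤ S.card
  noW : ¬ W4In E
  noC : ∀ p q r, ¬ Chain3 S E p q r
  ih : ∀ (S' : Finset V) (E' : Multiset (Sym2 V)), Red E E' → Good S' E' → 5 ≤ S'.card →
    S'.card + E'.card < S.card + E.card → (∃ v ∈ S', 4 ≤ d E' {v}) → T S' E'

theorem not_exc_of_card {S : Finset V} {E : Multiset (Sym2 V)} (h : 6 ≤ S.card) {a b g c e : V} :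
    ¬ Exc S E a b g c e := fun hx => by
  rw [hx.hS] at h
  have := Finset.card_le_five (a := a) (b := b) (c := g) (d := c) (e := e)
  omega

namespace Min

variable {S : Finset V} {E : Multiset (Sym2 V)}

theorem of_card_lt (h : Min S E) {S' : Finset V} {E' : Multiset (Sym2 V)} (hR : Red E E')
    (hG : Good S' E') (h5 : 5 ≤ S'.card) (hlt : S'.card < S.card) (hv : ∃ v ∈ S', 4 ≤ d E' {v}) :
    T S' E' :=
  h.ih S' E' hR hG h5 (by have := hR.card_le; omega) hv

theorem contract (h : Min S E) {X : Finset V} (hX : X ⊆ S) {y : V} (hy : y ∈ X)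
    (hd : d E X = 4) (hy4 : 4 ≤ d E {y}) (h2 : 2 ≤ X.card) (h4 : 4 ≤ (S \ X).card) :
    T (insert y (S \ X)) (contr X y E) := by
  have hc : (insert y (S \ X)).card = (S \ X).card + 1 :=
    Finset.card_insert_of_notMem (by simp [hy])
  have hc2 := Finset.card_sdiff_add_card_eq_card hX
  refine h.of_card_lt (red_contr hy fun W hW hyW => ?_) (h.good.contr hX hy) (by omega) (by omega)
    ⟨y, by simp, by rw [d_contr_self X hy, hd]⟩
  rw [hd]
  by_cases hW2 : 2 ≤ W.card
  · exact h.good.cut4 W (hW.trans hX) hW2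
      (le_trans (by omega) (Finset.card_le_card (Finset.sdiff_subset_sdiff (le_refl S) hW)))
  · have : W = {y} := (Finset.eq_of_subset_of_card_le (by simpa using hyW) (by simp; omega)).symm
    rwa [this]

theorem exists_third (h : Min S E) {p q : V} (hp : p ∈ S) (hq : q ∈ S) (dp : d E {p} = 4)
    (dq : d E {q} = 4) (hpq : E.count s(p, q) = 2) :
    ∃ r ∈ S, r ≠ p ∧ r ≠ q ∧ d E {r} = 4 ∧ E.count s(r, p) + E.count s(r, q) = 2 := by
  have hne : p ≠ q := h.good.ne_of_count (by omega)
  have hX : ({p, q} : Finset V) ⊆ S := by intro v; simp; rintro (rfl | rfl) <;> assumption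
  have hy : p ∈ ({p, q} : Finset V) := by simp
  have hd : d E {p, q} = 4 := by have := d_pair (E := E) hne; omega
  have hc2 := Finset.card_sdiff_add_card_eq_card hX
  have hcard := h.card
  rw [Finset.card_pair hne] at hc2
  have hT := h.contract hX hy hd (by omega) (by rw [Finset.card_pair hne]) (by omega)
  have hG := h.good.contr hX hy
  have key : ∀ r ∈ insert p (S \ {p, q}), r ≠ p → d (contr {p, q} p E) {r} = 4 →
      (contr {p, q} p E).count s(p, r) = 2 →
      ∃ r ∈ S, r ≠ p ∧ r ≠ q ∧ d E {r} = 4 ∧ E.count s(r, p) + E.count s(r, q) = 2 := by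
    intro r hr hrp hr4 hr2
    have hr' : r ∈ S ∧ ¬ (r = p ∨ r = q) := by
      simpa [hrp] using hr
    have hrX : r ∉ ({p, q} : Finset V) := by simpa using hr'.2
    rw [Sym2.eq_swap, count_contr_self hy hrX, Finset.sum_pair hne] at hr2
    rw [d_contr_of_disjoint hy (by simpa using hrX)] at hr4
    exact ⟨r, hr'.1, hrp, fun h' => hr'.2 (Or.inr h'), hr4, hr2⟩
  rcases hT with ⟨a, b, c, hC⟩ | ⟨a, b, g, c, e, hX5⟩
  · have hab : a ≠ b := hG.ne_of_count (by rw [hC.pq]; norm_num)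
    have hbc : b ≠ c := hG.ne_of_count (by rw [hC.qr]; norm_num)
    by_cases ha : a = p
    · subst ha; exact key b hC.hq hab.symm hC.dq hC.pq
    by_cases hb : b = p
    · subst hb; exact key a hC.hp ha hC.dp (by rw [Sym2.eq_swap]; exact hC.pq)
    by_cases hc : c = p
    · subst hc; exact key b hC.hq hb hC.dq (by rw [Sym2.eq_swap]; exact hC.qr)
    have hmem : ∀ v ∈ insert p (S \ {p, q}), v ≠ p → v ∈ S ∧ ¬ (v = p ∨ v = q) := by
      intro v hv hvp; simpa [hvp] using hv
    have ha' := hmem a hC.hp ha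
    have hb' := hmem b hC.hq hb
    have hc' := hmem c hC.hr hc
    refine absurd (hC.congr hG ha'.1 hb'.1 hc'.1 fun Z hZ => ?_) (h.noC a b c)
    refine (d_contr_of_disjoint hy (Finset.disjoint_left.2 fun v hv hv' => ?_) E).symm
    have := hZ hv
    simp only [Finset.mem_insert, Finset.mem_singleton] at this hv'
    rcases this with rfl | rfl | rfl
    exacts [ha'.2 hv', hb'.2 hv', hc'.2 hv']
  · obtain ⟨da, db, dg, dc, de⟩ := hX5.degrees hG.supp
    have hpd : d (contr {p, q} p E) {p} = 4 := by rw [d_contr_self _ hy, hd]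
    have hgc : g ≠ c := hG.ne_of_count (by rcases hX5.gc with h | h <;> rw [h] <;> norm_num)
    have hgS : g ∈ insert p (S \ {p, q}) := (hX5.mem_iff g).2 (by simp)
    have hcS : c ∈ insert p (S \ {p, q}) := (hX5.mem_iff c).2 (by simp)
    have hpS : p ∈ insert p (S \ {p, q}) := by simp
    clear hc2 hd hy
    generalize contr {p, q} p E = E' at *
    generalize insert p (S \ {p, q}) = S' at *
    rcases (hX5.mem_iff p).1 hpS with hx | hx | hx | hx | hx <;> rw [hx] at hpd
    · omega
    · omega
    · exact key c hcS (by rw [hx]; exact hgc.symm) (by omega) (by rw [hx]; omega)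
    · exact key g hgS (by rw [hx]; exact hgc) (by omega) (by rw [hx, Sym2.eq_swap]; omega)
    · omega

theorem no_chain_two (h : Min S E) {p q : V} (hp : p ∈ S) (hq : q ∈ S) (dp : d E {p} = 4)
    (dq : d E {q} = 4) : E.count s(p, q) ≠ 2 := by
  intro hpq
  obtain ⟨r, hr, hrp, hrq, dr, hsum⟩ := h.exists_third hp hq dp dq hpq
  have hne : p ≠ q := h.good.ne_of_count (by omega)
  have c1 : E.count s(r, p) = 1 ∧ E.count s(r, q) = 1 := by
    rcases Nat.lt_or_ge (E.count s(r, p)) 1 with h1 | h1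
    · exact absurd ⟨hp, hq, hr, dp, dq, dr, hpq, by rw [Sym2.eq_swap]; omega,
        by rw [Sym2.eq_swap]; omega, hrp.symm⟩ (h.noC p q r)
    · rcases Nat.lt_or_ge (E.count s(r, q)) 1 with h2 | h2
      · exact absurd ⟨hr, hp, hq, dr, dp, dq, by omega, hpq, by omega, hrq⟩ (h.noC r p q)
      · omega
  obtain ⟨F, rfl⟩ := Multiset.exists_cons_of_mem (Multiset.count_pos.1 (by omega : 0 < E.count s(p, q)))
  have hZ : ∀ {p q : V}, p ≠ q → p ≠ r → q ≠ r → d (s(p, q) ::ₘ F) {p} = 4 →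
      (s(p, q) ::ₘ F).count s(p, q) = 2 → (s(p, q) ::ₘ F).count s(r, p) = 1 →
      Good S (s(p, q) ::ₘ F) →
      ∀ Z ⊆ S, p ∈ Z → q ∉ Z → r ∉ Z → 2 ≤ Z.card → 2 ≤ (S \ Z).card →
      5 ≤ d (s(p, q) ::ₘ F) Z := by
    clear hpq hsum c1 dp dq hne hrp hrq dr
    intro p q hne hpr hqr dp hpq hrp hG Z hZS hpZ hqZ hrZ h1 h2
    have e1 : d (s(p, q) ::ₘ F) Z + 2 * ee (s(p, q) ::ₘ F) {p} (Z.erase p) =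
        d (s(p, q) ::ₘ F) {p} + d (s(p, q) ::ₘ F) (Z.erase p) := by
      rw [← d_union (by simp), ← Finset.insert_eq, Finset.insert_erase hpZ]
    have e2 : ee (s(p, q) ::ₘ F) {p} (Z.erase p) + 3 ≤ 4 := by
      rw [ee_singleton_eq_sum _ (by simp)]
      have := sum_count_le (s(p, q) ::ₘ F) (p := p) (T := insert q (insert r (Z.erase p)))
        (by simp [hne, hpr])
      rw [Finset.sum_insert (by simp [hqr, hqZ]), Finset.sum_insert (by simp [hrZ]),
        hpq, Sym2.eq_swap (a := p) (b := r), hrp] at this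
      omega
    have e3 : 3 ≤ d (s(p, q) ::ₘ F) (Z.erase p) :=
      hG.cut3 _ ((Finset.erase_subset _ _).trans hZS)
        (Finset.card_pos.1 (by rw [Finset.card_erase_of_mem hpZ]; omega))
        (fun he => by rw [← he] at hZS; exact Finset.notMem_erase p Z (he ▸ hZS hpZ))
    by_cases hlt : 2 ≤ (Z.erase p).card
    · have e4 := hG.cut4 _ ((Finset.erase_subset p _).trans hZS) hlt
        (h2.trans (Finset.card_le_card (Finset.sdiff_subset_sdiff (le_refl S) (Finset.erase_subset _ _))))
      rcases Nat.lt_or_ge (d (s(p, q) ::ₘ F) Z) 5 with h3 | h3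
      · omega
      · exact h3
    · omega
  have hF : Good S F := by
    refine h.good.delete (by omega) (by omega) fun Z hZS hpZ hqZ h1 h2 => ?_
    by_cases hrZ : r ∈ Z
    · rw [← d_compl h.good.supp]
      have hsw : s(p, q) = s(q, p) := Sym2.eq_swap
      have hg := h.good
      rw [hsw] at hg hpq dq c1 ⊢
      exact hZ hne.symm hrq.symm hrp.symm dq hpq c1.2 hg _ Finset.sdiff_subset (by simp [hq, hqZ])
        (by simp [hpZ]) (by simp [hrZ]) h2 (by rwa [Finset.sdiff_sdiff_eq_self hZS])
    · exact hZ hne hrp.symm hrq.symm dp hpq c1.1 h.good Z hZS hpZ hqZ hrZ h1 h2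
  have hdF : ∀ Z : Finset V, (p ∈ Z ↔ q ∈ Z) → d (s(p, q) ::ₘ F) Z = d F Z := fun Z hz => by
    rw [d_cons, cr_mk, if_pos hz, zero_add]
  have hcard := h.card
  rcases h.ih S F (Red.del (Red.refl F)) hF (by omega) (by simp)
    ⟨r, hr, by rw [← hdF _ (by simp [hrp.symm, hrq.symm])]; omega⟩ with ⟨a, b, c, hC⟩ | ⟨a, b, g, c, e, hX⟩
  · have hp3 : d F {p} = 3 := by
      rw [d_cons, cr_mk, if_neg (by simp [hne.symm])] at dp; omega
    have hq3 : d F {q} = 3 := by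
      rw [d_cons, cr_mk, if_neg (by simp [hne])] at dq; omega
    have hn : ∀ v, d F {v} = 4 → v ≠ p ∧ v ≠ q := fun v hv =>
      ⟨by rintro rfl; omega, by rintro rfl; omega⟩
    refine h.noC a b c (hC.congr hF hC.hp hC.hq hC.hr fun Z hZ' => hdF Z ?_)
    have ha := hn a hC.dp
    have hb := hn b hC.dq
    have hc := hn c hC.dr
    have : ∀ v ∈ Z, v ≠ p ∧ v ≠ q := fun v hv => by
      have := hZ' hv
      simp only [Finset.mem_insert, Finset.mem_singleton] at this
      rcases this with rfl | rfl | rfl <;> assumption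
    exact ⟨fun h' => absurd rfl (this p h').1, fun h' => absurd rfl (this q h').2⟩
  · exact not_exc_of_card h.card hX

end Min

/-- The edges of `E` split along the four-edge cut `X`: `EX` lies inside `X`, `EY` inside its
complement, and the cut consists of the four edges joining `x i` to `y i`. -/
structure Split (S : Finset V) (E : Multiset (Sym2 V)) (X : Finset V) (EX EY : Multiset (Sym2 V))
    (x y : Fin 4 → V) : Prop where
  hX : X ⊆ S
  suppX : ∀ e ∈ EX, ∀ v ∈ e, v ∈ X
  suppY : ∀ e ∈ EY, ∀ v ∈ e, v ∈ S \ X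
  hx : ∀ i, x i ∈ X
  hy : ∀ i, y i ∈ S \ X
  eq : E = EX + EY + ∑ i, {s(x i, y i)}

theorem d_eq_card_filter (E : Multiset (Sym2 V)) (X : Finset V) :
    d E X = (E.filter fun e => cr X e ≠ 0).card := by
  induction E using Multiset.induction_on with
  | empty => simp
  | cons e E ih =>
    rw [d_cons, ih, Multiset.filter_cons]
    induction e using Sym2.ind with
    | _ u v =>
      rw [cr_mk]
      by_cases h : (u ∈ X ↔ v ∈ X) <;> simp [h, add_comm]

theorem d_eq_zero_of_supp {E : Multiset (Sym2 V)} {A Z : Finset V} (hE : ∀ e ∈ E, ∀ v ∈ e, v ∈ A)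
    (h : Disjoint A Z ∨ A ⊆ Z) : d E Z = 0 := by
  rw [d, Multiset.sum_eq_zero_iff]
  intro n hn
  obtain ⟨e, he, rfl⟩ := Multiset.mem_map.1 hn
  induction e using Sym2.ind with
  | _ u v =>
    have hu := hE _ he u (by simp)
    have hv := hE _ he v (by simp)
    rw [cr_mk, if_pos]
    rcases h with h | h
    · exact ⟨fun h' => absurd h' (Finset.disjoint_left.1 h hu),
        fun h' => absurd h' (Finset.disjoint_left.1 h hv)⟩
    · exact ⟨fun _ => h hv, fun _ => h hu⟩

theorem d_inter_of_supp {E : Multiset (Sym2 V)} {A : Finset V} (hE : ∀ e ∈ E, ∀ v ∈ e, v ∈ A)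
    (Z : Finset V) : d E Z = d E (Z ∩ A) := by
  unfold d
  congr 1
  refine Multiset.map_congr rfl fun e he => ?_
  induction e using Sym2.ind with
  | _ u v =>
    have hu := hE _ he u (by simp)
    have hv := hE _ he v (by simp)
    simp [cr_mk, hu, hv]

theorem exists_split {S : Finset V} {E : Multiset (Sym2 V)} (hE : ∀ e ∈ E, ∀ v ∈ e, v ∈ S)
    {X : Finset V} (hX : X ⊆ S) (hd : d E X = 4) :
    ∃ EX EY x y, Split S E X EX EY x y := by
  have h1 : ∀ F : Multiset (Sym2 V), (∀ e ∈ F, ∀ v ∈ e, v ∈ S) → (∀ e ∈ F, cr X e ≠ 0) →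
      ∃ l : List (V × V), (∀ p ∈ l, p.1 ∈ X ∧ p.2 ∈ S \ X) ∧ F = (l.map fun p => s(p.1, p.2)) := by
    intro F
    induction F using Multiset.induction_on with
    | empty => intro _ _; exact ⟨[], by simp, rfl⟩
    | cons e F ih =>
      intro hF1 hF2
      obtain ⟨l, hl, rfl⟩ := ih (fun e he => hF1 e (by simp [he])) fun e he => hF2 e (by simp [he])
      have h2 := hF2 e (by simp)
      have h3 := hF1 e (by simp)
      induction e using Sym2.ind with
      | _ u v =>
        have hu := h3 u (by simp)
        have hv := h3 v (by simp)
        rw [cr_mk] at h2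
        by_cases hux : u ∈ X
        · have hvx : v ∉ X := fun h => h2 (by simp [h, hux])
          exact ⟨(u, v) :: l, by simpa [hux, hvx, hv] using hl, rfl⟩
        · have hvx : v ∈ X := by by_contra h; exact h2 (by simp [h, hux])
          refine ⟨(v, u) :: l, by simpa [hux, hvx, hu] using hl, ?_⟩
          rw [Sym2.eq_swap]; rfl
  obtain ⟨l, hl, hle⟩ := h1 (E.filter fun e => cr X e ≠ 0)
    (fun e he => hE e (Multiset.mem_filter.1 he).1) fun e he => (Multiset.mem_filter.1 he).2
  have hlen : l.length = 4 := by
    rw [d_eq_card_filter, hle] at hd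
    simpa using hd
  have hin : ∀ e ∈ E, cr X e = 0 → (∀ v ∈ e, v ∈ X) ∨ ∀ v ∈ e, v ∈ S \ X := by
    intro e he h0
    have h3 := hE e he
    induction e using Sym2.ind with
    | _ u v =>
      have hu := h3 u (by simp)
      have hv := h3 v (by simp)
      have h4 : u ∈ X ↔ v ∈ X := by
        by_contra h4; rw [cr_mk, if_neg h4] at h0; exact one_ne_zero h0
      by_cases hux : u ∈ X
      · left; simp [hux, h4.1 hux]
      · right; simp [hux, mt h4.2 hux, hu, hv]
  obtain ⟨⟨p0, q0⟩, l, rfl⟩ := List.exists_cons_of_length_eq_add_one hlen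
  obtain ⟨⟨p1, q1⟩, l, rfl⟩ := List.exists_cons_of_length_eq_add_one (n := 2) (l := l) (by simpa using hlen)
  obtain ⟨⟨p2, q2⟩, l, rfl⟩ := List.exists_cons_of_length_eq_add_one (n := 1) (l := l) (by simpa using hlen)
  obtain ⟨⟨p3, q3⟩, l, rfl⟩ := List.exists_cons_of_length_eq_add_one (n := 0) (l := l) (by simpa using hlen)
  obtain rfl : l = [] := by simpa using hlen
  simp only [List.mem_cons, List.not_mem_nil, or_false, forall_eq_or_imp, forall_eq] at hl
  obtain ⟨⟨a0, b0⟩, ⟨a1, b1⟩, ⟨a2, b2⟩, a3, b3⟩ := hl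
  refine ⟨(E.filter fun e => cr X e = 0).filter fun e => ∀ v ∈ e, v ∈ X,
    (E.filter fun e => cr X e = 0).filter fun e => ¬ ∀ v ∈ e, v ∈ X,
    ![p0, p1, p2, p3], ![q0, q1, q2, q3], hX, fun e he => (Multiset.mem_filter.1 he).2, ?_, ?_, ?_, ?_⟩
  · intro e he
    rw [Multiset.mem_filter, Multiset.mem_filter] at he
    exact (hin e he.1.1 he.1.2).resolve_left he.2
  · intro i; fin_cases i <;> assumption
  · intro i; fin_cases i <;> assumption
  · rw [Multiset.filter_add_not, Fin.sum_univ_four]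
    conv_lhs => rw [← Multiset.filter_add_not (fun e => cr X e = 0) E, hle]
    rfl

namespace Split

variable {S X : Finset V} {E EX EY : Multiset (Sym2 V)} {x y : Fin 4 → V}

theorem perm (h : Split S E X EX EY x y) (σ : Equiv.Perm (Fin 4)) :
    Split S E X EX EY (x ∘ σ) (y ∘ σ) :=
  ⟨h.hX, h.suppX, h.suppY, fun i => h.hx _, fun i => h.hy _, by
    rw [h.eq]
    congr 1
    exact (Equiv.sum_comp σ fun i => ({s(x i, y i)} : Multiset (Sym2 V))).symm⟩

theorem symm (h : Split S E X EX EY x y) : Split S E (S \ X) EY EX y x :=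
  ⟨Finset.sdiff_subset, h.suppY, by
    rw [Finset.sdiff_sdiff_eq_self h.hX]; exact h.suppX, h.hy, by
    rw [Finset.sdiff_sdiff_eq_self h.hX]; exact h.hx, by
    rw [h.eq, add_comm EX EY]
    simp only [Sym2.eq_swap (a := x _)]⟩

theorem d_of_subset (h : Split S E X EX EY x y) {Z : Finset V} (hZ : Z ⊆ X) :
    d E Z = d EX Z + ((if x 0 ∈ Z then 1 else 0) + (if x 1 ∈ Z then 1 else 0) +
      (if x 2 ∈ Z then 1 else 0) + (if x 3 ∈ Z then 1 else 0)) := by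
  have h1 : d EY Z = 0 := d_eq_zero_of_supp h.suppY
    (Or.inl (Finset.disjoint_left.2 fun v hv hv' => (Finset.mem_sdiff.1 hv).2 (hZ hv')))
  have h2 : ∀ i, y i ∉ Z := fun i hi => (Finset.mem_sdiff.1 (h.hy i)).2 (hZ hi)
  rw [h.eq, Fin.sum_univ_four]
  simp only [d_add, h1, d_singleton, cr_mk, h2, iff_false]
  by_cases a0 : x 0 ∈ Z <;> by_cases a1 : x 1 ∈ Z <;> by_cases a2 : x 2 ∈ Z <;>
    by_cases a3 : x 3 ∈ Z <;> simp [a0, a1, a2, a3]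

theorem d_union_compl (h : Split S E X EX EY x y) {Z : Finset V} (hZ : Z ⊆ X) :
    d E (Z ∪ (S \ X)) = d EX Z + ((if x 0 ∈ Z then 0 else 1) + (if x 1 ∈ Z then 0 else 1) +
      (if x 2 ∈ Z then 0 else 1) + (if x 3 ∈ Z then 0 else 1)) := by
  have h1 : d EY (Z ∪ (S \ X)) = 0 := d_eq_zero_of_supp h.suppY (Or.inr Finset.subset_union_right)
  have h2 : ∀ i, y i ∈ Z ∪ (S \ X) := fun i => Finset.mem_union_right _ (h.hy i)
  have h3 : d EX (Z ∪ (S \ X)) = d EX Z := by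
    rw [d_inter_of_supp h.suppX]
    congr 1
    ext v
    have := @hZ v
    simp only [Finset.mem_inter, Finset.mem_union, Finset.mem_sdiff]
    tauto
  have h4 : ∀ i, x i ∈ Z ∪ (S \ X) ↔ x i ∈ Z := fun i => by
    have := h.hx i
    simp only [Finset.mem_union, Finset.mem_sdiff]
    tauto
  rw [h.eq, Fin.sum_univ_four]
  simp only [d_add, h1, d_singleton, cr_mk, h2, iff_true, h3, h4]
  by_cases a0 : x 0 ∈ Z <;> by_cases a1 : x 1 ∈ Z <;> by_cases a2 : x 2 ∈ Z <;>
    by_cases a3 : x 3 ∈ Z <;> simp [a0, a1, a2, a3]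

theorem d_self (h : Split S E X EX EY x y) : d E X = 4 := by
  rw [h.d_of_subset (le_refl _), d_eq_zero_of_supp h.suppX (Or.inr (le_refl _))]
  simp [h.hx]

end Split

/-- A small cut of `EX` separating the first two attachment vertices from the other two. -/
def Bad (X : Finset V) (EX : Multiset (Sym2 V)) (x : Fin 4 → V) : Prop :=
  ∃ Z ⊆ X, x 0 ∈ Z ∧ x 1 ∈ Z ∧ x 2 ∉ Z ∧ x 3 ∉ Z ∧ d EX Z ≤ 2

/-- The edges attaching an adjacent pair `a`, `b` of cubic vertices. -/
def pairEdges (x : Fin 4 → V) (a b : V) : Multiset (Sym2 V) :=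
  s(x 0, a) ::ₘ s(x 1, a) ::ₘ s(x 2, b) ::ₘ s(x 3, b) ::ₘ {s(a, b)}

theorem Split.bad_of_bad {S X : Finset V} {E EX EY : Multiset (Sym2 V)} {x y : Fin 4 → V}
    (h : Split S E X EX EY x y) (hG : Good S E) (h2 : 2 ≤ (S \ X).card) (hb : Bad X EX x)
    (hb' : Bad X EX (x ∘ Equiv.swap 1 2)) : ∀ v ∈ X, d E {v} = 3 := by
  obtain ⟨Z, hZ, z0, z1, z2, z3, hdZ⟩ := hb
  obtain ⟨W, hW, w0, w1, w2, w3, hdW⟩ := hb'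
  have e1 : (Equiv.swap (1 : Fin 4) 2) 0 = 0 := by decide
  have e2 : (Equiv.swap (1 : Fin 4) 2) 1 = 2 := by decide
  have e3 : (Equiv.swap (1 : Fin 4) 2) 2 = 1 := by decide
  have e4 : (Equiv.swap (1 : Fin 4) 2) 3 = 3 := by decide
  simp only [Function.comp, e1, e2, e3, e4] at w0 w1 w2 w3
  have lower : ∀ A ⊆ X, A.Nonempty → 3 ≤ d E A := fun A hA hne => by
    refine hG.cut3 A (hA.trans h.hX) hne fun he => ?_
    rw [← he, Finset.sdiff_eq_empty_iff_subset.2 hA] at h2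
    simp at h2
  have sub1 := d_submod EX Z W
  have sub2 := d_submod EX Z (X \ W)
  rw [d_compl h.suppX] at sub2
  rw [← d_compl h.suppX (Z ∪ W)] at sub1
  rw [← d_compl h.suppX (Z ∪ X \ W)] at sub2
  have m := h.hx
  have p1 := h.d_of_subset (Z := Z ∩ W) (Finset.inter_subset_left.trans hZ)
  have p2 := h.d_of_subset (Z := X \ (Z ∪ W)) Finset.sdiff_subset
  have p3 := h.d_of_subset (Z := Z ∩ (X \ W)) (Finset.inter_subset_left.trans hZ)
  have p4 := h.d_of_subset (Z := X \ (Z ∪ X \ W)) Finset.sdiff_subset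
  simp only [Finset.mem_inter, Finset.mem_sdiff, Finset.mem_union, m, z0, z1, z2, z3, w0, w1, w2, w3,
    and_true, and_false, not_true, not_false_eq_true, or_true, or_false, if_true, if_false, zero_add, add_zero] at p1 p2 p3 p4
  have q1 := lower (Z ∩ W) (Finset.inter_subset_left.trans hZ) ⟨x 0, by simp [z0, w0]⟩
  have q2 := lower (X \ (Z ∪ W)) Finset.sdiff_subset ⟨x 3, by simp [z3, w3, m]⟩
  have q3 := lower (Z ∩ (X \ W)) (Finset.inter_subset_left.trans hZ) ⟨x 1, by simp [z1, w2, m]⟩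
  have q4 := lower (X \ (Z ∪ X \ W)) Finset.sdiff_subset ⟨x 2, by simp [z2, w1, m]⟩
  have single : ∀ A ⊆ X, d E A = 3 → ∀ v ∈ A, d E {v} = 3 := fun A hA hdA v hv => by
    have : A.card ≤ 1 := by
      by_contra hc
      have := hG.cut4 A (hA.trans h.hX) (by omega)
        (h2.trans (Finset.card_le_card (Finset.sdiff_subset_sdiff (le_refl S) hA)))
      omega
    have : {v} = A := Finset.eq_of_subset_of_card_le (by simpa using hv) (by simpa using this)
    rw [this, hdA]
  intro v hv
  by_cases hz : v ∈ Z <;> by_cases hw : v ∈ W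
  · exact single (Z ∩ W) (Finset.inter_subset_left.trans hZ) (by omega) v (by simp [hz, hw])
  · exact single (Z ∩ (X \ W)) (Finset.inter_subset_left.trans hZ) (by omega) v (by simp [hz, hw, hv])
  · exact single _ (Finset.sdiff_subset (s := X) (t := Z ∪ X \ W)) (by omega) v (by simp [hz, hw, hv])
  · exact single _ (Finset.sdiff_subset (s := X) (t := Z ∪ W)) (by omega) v (by simp [hz, hw, hv])

theorem d_pairEdges {Z : Finset V} {x : Fin 4 → V} {a b : V} :
    d (pairEdges x a b) Z = (if x 0 ∈ Z ↔ a ∈ Z then 0 else 1) + (if x 1 ∈ Z ↔ a ∈ Z then 0 else 1) +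
      (if x 2 ∈ Z ↔ b ∈ Z then 0 else 1) + (if x 3 ∈ Z ↔ b ∈ Z then 0 else 1) +
      (if a ∈ Z ↔ b ∈ Z then 0 else 1) := by
  unfold pairEdges
  simp only [d_cons, d_singleton, cr_mk]
  omega

theorem Split.good_pair {S X : Finset V} {E EX EY : Multiset (Sym2 V)} {x y : Fin 4 → V}
    (h : Split S E X EX EY x y) (hG : Good S E) (h2 : 2 ≤ (S \ X).card) (hb : ¬ Bad X EX x) {a b : V}
    (ha : a ∈ S \ X) (hb' : b ∈ S \ X) (hab : a ≠ b) :
    Good (insert a (insert b X)) (EX + pairEdges x a b) := by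
  have haX := (Finset.mem_sdiff.1 ha).2
  have hbX := (Finset.mem_sdiff.1 hb').2
  have hxa : ∀ i, x i ≠ a := fun i hi => haX (hi ▸ h.hx i)
  have hxb : ∀ i, x i ≠ b := fun i hi => hbX (hi ▸ h.hx i)
  have lower : ∀ A ⊆ X, A.Nonempty → 3 ≤ d E A := fun A hA hne => by
    refine hG.cut3 A (hA.trans h.hX) hne fun he => ?_
    rw [← he, Finset.sdiff_eq_empty_iff_subset.2 hA] at h2
    simp at h2
  have hd : ∀ Z : Finset V, d (EX + pairEdges x a b) Z = d EX (Z ∩ X) +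
      ((if x 0 ∈ Z ∩ X ↔ a ∈ Z then 0 else 1) + (if x 1 ∈ Z ∩ X ↔ a ∈ Z then 0 else 1) +
      (if x 2 ∈ Z ∩ X ↔ b ∈ Z then 0 else 1) + (if x 3 ∈ Z ∩ X ↔ b ∈ Z then 0 else 1) +
      (if a ∈ Z ↔ b ∈ Z then 0 else 1)) := by
    intro Z
    rw [d_add, d_pairEdges, d_inter_of_supp h.suppX]
    simp only [Finset.mem_inter, h.hx, and_true]
  have crossing : ∀ Z, ¬ (a ∈ Z ↔ b ∈ Z) → (Z ∩ X = ∅ ∨ Z ∩ X = X) ∨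
      4 ≤ d (EX + pairEdges x a b) Z := by
    intro Z hZ
    by_cases he : Z ∩ X = ∅
    · exact Or.inl (Or.inl he)
    by_cases he' : Z ∩ X = X
    · exact Or.inl (Or.inr he')
    right
    rw [hd]
    have hsub : Z ∩ X ⊆ X := Finset.inter_subset_right
    generalize Z ∩ X = Y at *
    have l1 := lower Y hsub (Finset.nonempty_iff_ne_empty.2 he)
    have l2 := lower (X \ Y) Finset.sdiff_subset (Finset.nonempty_iff_ne_empty.2 fun h' =>
      he' (Finset.Subset.antisymm hsub (Finset.sdiff_eq_empty_iff_subset.1 h')))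
    rw [h.d_of_subset hsub] at l1
    rw [h.d_of_subset Finset.sdiff_subset, d_compl h.suppX] at l2
    have m := h.hx
    simp only [Finset.mem_sdiff, m, true_and] at l2
    have hbad : ∀ W ⊆ X, x 0 ∈ W → x 1 ∈ W → x 2 ∉ W → x 3 ∉ W → 3 ≤ d EX W :=
      fun W hW h0 h1 h2 h3 => by
        by_contra hlt
        exact hb ⟨W, hW, h0, h1, h2, h3, by omega⟩
    have b1 := hbad Y hsub
    have b2 := hbad (X \ Y) Finset.sdiff_subset
    rw [d_compl h.suppX] at b2
    simp only [Finset.mem_sdiff, m, true_and] at b2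
    clear hbad hd lower hb
    by_cases a0 : x 0 ∈ Y <;> by_cases a1 : x 1 ∈ Y <;> by_cases a2 : x 2 ∈ Y <;>
      by_cases a3 : x 3 ∈ Y <;> by_cases h1 : a ∈ Z <;> by_cases h3 : b ∈ Z <;>
      first
        | exact absurd (iff_of_true h1 h3) hZ
        | exact absurd (iff_of_false h1 h3) hZ
        | (simp only [a0, a1, a2, a3, h1, h3, if_true, if_false, not_true, not_false_eq_true,
            true_implies, false_implies, iff_true, iff_false, iff_self] at l1 l2 b1 b2 ⊢; omega)
  have same : ∀ Z, (a ∈ Z ↔ b ∈ Z) → d (EX + pairEdges x a b) Z =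
      d E (if a ∈ Z then (Z ∩ X) ∪ (S \ X) else Z ∩ X) := by
    intro Z hZ
    rw [hd]
    by_cases h1 : a ∈ Z
    · have h3 := hZ.1 h1
      rw [if_pos h1, h.d_union_compl Finset.inter_subset_right]
      simp [h1, h3]
    · have h3 := mt hZ.2 h1
      rw [if_neg h1, h.d_of_subset Finset.inter_subset_right]
      simp only [h1, h3, iff_false, iff_self, if_true, add_zero, ite_not]
  have hsdiff : ∀ Z, a ∈ Z → b ∈ Z → insert a (insert b X) \ Z = X \ (Z ∩ X) := by
    intro Z h1 h3
    ext v
    simp only [Finset.mem_sdiff, Finset.mem_insert, Finset.mem_inter]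
    constructor
    · rintro ⟨rfl | rfl | h4, h5⟩ <;> tauto
    · tauto
  have hinter : ∀ Z ⊆ insert a (insert b X), a ∉ Z → b ∉ Z → Z ∩ X = Z := by
    intro Z hZ h1 h3
    ext v
    simp only [Finset.mem_inter, and_iff_left_iff_imp]
    intro hv
    rcases Finset.mem_insert.1 (hZ hv) with rfl | h4
    · exact absurd hv h1
    rcases Finset.mem_insert.1 h4 with rfl | h4
    · exact absurd hv h3
    exact h4
  have hSX : ∀ Z : Finset V, S \ (Z ∩ X ∪ S \ X) = X \ (Z ∩ X) := by
    intro Z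
    ext v
    have := @h.hX v
    simp only [Finset.mem_sdiff, Finset.mem_inter, Finset.mem_union]
    tauto
  refine ⟨?_, ?_, ?_, ?_⟩
  · intro e he v hv
    rcases Multiset.mem_add.1 he with he | he
    · simp [h.suppX e he v hv]
    · simp only [pairEdges, Multiset.mem_cons, Multiset.mem_singleton] at he
      rcases he with rfl | rfl | rfl | rfl | rfl <;>
        rcases Sym2.mem_iff.1 hv with rfl | rfl <;> simp [h.hx]
  · intro e he
    rcases Multiset.mem_add.1 he with he | he
    · exact hG.loopless e (by rw [h.eq]; simp [he])
    · simp only [pairEdges, Multiset.mem_cons, Multiset.mem_singleton] at he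
      rcases he with rfl | rfl | rfl | rfl | rfl <;> simp [hxa, hxb, hab]
  · intro Z hZ hne hnS
    by_cases h1 : a ∈ Z ↔ b ∈ Z
    · rw [same Z h1]
      by_cases h3 : a ∈ Z
      · rw [if_pos h3]
        refine hG.cut3 _ (Finset.union_subset (Finset.inter_subset_right.trans h.hX) Finset.sdiff_subset)
          ⟨a, by simp only [Finset.mem_union]; exact Or.inr ha⟩ fun he => hnS ?_
        have h4 := hSX Z
        rw [he, Finset.sdiff_self, ← hsdiff Z h3 (h1.1 h3)] at h4
        exact Finset.Subset.antisymm hZ (Finset.sdiff_eq_empty_iff_subset.1 h4.symm)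
      · rw [if_neg h3, hinter Z hZ h3 (mt h1.2 h3)]
        refine lower Z ?_ hne
        rw [← hinter Z hZ h3 (mt h1.2 h3)]
        exact Finset.inter_subset_right
    · rcases crossing Z h1 with h3 | h3
      · rw [hd]
        by_cases h4 : a ∈ Z <;> by_cases h5 : b ∈ Z
        · exact absurd (by simp [h4, h5]) h1
        · rcases h3 with h3 | h3 <;> simp [h3, h4, h5, h.hx]
        · rcases h3 with h3 | h3 <;> simp [h3, h4, h5, h.hx]
        · exact absurd (by simp [h4, h5]) h1
      · omega
  · intro Z hZ hc1 hc2
    by_cases h1 : a ∈ Z ↔ b ∈ Z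
    · rw [same Z h1]
      by_cases h3 : a ∈ Z
      · rw [if_pos h3]
        refine hG.cut4 _ (Finset.union_subset (Finset.inter_subset_right.trans h.hX) Finset.sdiff_subset)
          (h2.trans (Finset.card_le_card Finset.subset_union_right)) ?_
        rwa [hSX, ← hsdiff Z h3 (h1.1 h3)]
      · have h4 := hinter Z hZ h3 (mt h1.2 h3)
        have h5 : Z ⊆ X := by rw [← h4]; exact Finset.inter_subset_right
        rw [if_neg h3, h4]
        exact hG.cut4 Z (h5.trans h.hX) hc1
          (h2.trans (Finset.card_le_card (Finset.sdiff_subset_sdiff (le_refl S) h5)))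
    · rcases crossing Z h1 with h3 | h3
      · exfalso
        have key : ∀ {a b : V}, a ∈ Z → b ∉ Z → Z ⊆ insert a (insert b X) →
            2 ≤ (insert a (insert b X) \ Z).card → False := by
          intro a b ha hb hZ hc2
          rcases h3 with h3 | h3
          · have : Z ⊆ {a} := fun v hv => by
              rcases Finset.mem_insert.1 (hZ hv) with rfl | h4
              · simp
              rcases Finset.mem_insert.1 h4 with rfl | h4
              · exact absurd hv hb
              · exact absurd (Finset.mem_inter.2 ⟨hv, h4⟩) (by simp [h3])
            have := Finset.card_le_card this
            simp at this; omega
          · have : insert a (insert b X) \ Z ⊆ {b} := fun v hv => by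
              rw [Finset.mem_sdiff] at hv
              rcases Finset.mem_insert.1 hv.1 with rfl | h4
              · exact absurd ha hv.2
              rcases Finset.mem_insert.1 h4 with rfl | h4
              · simp
              · rw [← h3] at h4
                exact absurd (Finset.mem_inter.1 h4).1 hv.2
            have := Finset.card_le_card this
            simp at this; omega
        by_cases h4 : a ∈ Z
        · exact key h4 (fun h5 => h1 (by simp [h4, h5])) hZ hc2
        · have h5 : b ∈ Z := by by_contra h5; exact h1 (by simp [h4, h5])
          rw [Finset.insert_comm] at hZ hc2
          exact key h5 h4 hZ hc2
      · exact h3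

/-- Test whether edge-disjoint walks link `o0`, `o1` to some `a` and `o2`, `o3` to some `b`, together
with a walk linking `a` to `b`, where `a` and `b` are distinct numbers below `n`. -/
def linkOK (n x : ℕ) (o0 o1 o2 o3 : ℕ) : Bool :=
  someR (fun a => someR (fun b => nne a b &&
    route (List.range n) 4 [(a, b), (o0, a), (o1, a), (o2, b), (o3, b)] x) (List.range n)) (List.range n)

/-- The number of the four given entries that equal `j`. -/
def outs (o0 o1 o2 o3 j : ℕ) : ℕ :=
  (bif Nat.beq o0 j then 1 else 0) + (bif Nat.beq o1 j then 1 else 0) +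
    (bif Nat.beq o2 j then 1 else 0) + (bif Nat.beq o3 j then 1 else 0)

/-- Test a Boolean predicate on all four-tuples of numbers below `n`. -/
def allTuples (n : ℕ) (P : ℕ → ℕ → ℕ → ℕ → Bool) : Bool :=
  (List.range n).all fun a => (List.range n).all fun b => (List.range n).all fun c =>
    (List.range n).all fun e => P a b c e

theorem allTuples_spec {n : ℕ} {P : ℕ → ℕ → ℕ → ℕ → Bool} (h : allTuples n P = true) {a b c e : ℕ}
    (ha : a < n) (hb : b < n) (hc : c < n) (he : e < n) : P a b c e = true := by
  simp only [allTuples, List.all_eq_true, List.mem_range] at h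
  exact h a ha b hb c hc e he

theorem link_two : allTuples 2 (fun o0 o1 o2 o3 => (List.range 5).all fun p =>
    !(Nat.ble 3 (outs o0 o1 o2 o3 0 + p) && Nat.ble 3 (outs o0 o1 o2 o3 1 + p) &&
      !(Nat.beq (outs o0 o1 o2 o3 0) 2 && Nat.ble p 2)) || linkOK 2 p o0 o1 o2 o3) = true := by
  decide +kernel

theorem link_three : allTuples 3 (fun o0 o1 o2 o3 => (List.range 5).all fun p =>
    (List.range 5).all fun q => (List.range 5).all fun r =>
    !(Nat.ble 3 (outs o0 o1 o2 o3 0 + p + q) && Nat.ble 3 (outs o0 o1 o2 o3 1 + p + r) &&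
      Nat.ble 3 (outs o0 o1 o2 o3 2 + q + r) &&
      Nat.ble 4 (outs o0 o1 o2 o3 0 + outs o0 o1 o2 o3 1 + q + r) &&
      Nat.ble 4 (outs o0 o1 o2 o3 0 + outs o0 o1 o2 o3 2 + p + r) &&
      Nat.ble 4 (outs o0 o1 o2 o3 1 + outs o0 o1 o2 o3 2 + p + q) &&
      !(Nat.beq (outs o0 o1 o2 o3 2) 0 && Nat.beq (outs o0 o1 o2 o3 0) 2 && Nat.beq p 0 &&
        Nat.beq q 2 && Nat.beq r 2) &&
      !(Nat.beq (outs o0 o1 o2 o3 1) 0 && Nat.beq (outs o0 o1 o2 o3 0) 2 && Nat.beq q 0 &&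
        Nat.beq p 2 && Nat.beq r 2) &&
      !(Nat.beq (outs o0 o1 o2 o3 0) 0 && Nat.beq (outs o0 o1 o2 o3 1) 2 && Nat.beq r 0 &&
        Nat.beq p 2 && Nat.beq q 2)) ||
      linkOK 3 (p + 16 * q + 256 * r) o0 o1 o2 o3) = true := by
  decide +kernel

theorem link_four_chain : allTuples 4 (fun o0 o1 o2 o3 =>
    !(Nat.beq (outs o0 o1 o2 o3 0) 2 && Nat.beq (outs o0 o1 o2 o3 1) 2) ||
      linkOK 4 1118480 o0 o1 o2 o3) = true := by
  decide +kernel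

theorem link_four_center : allTuples 4 (fun o0 o1 o2 o3 =>
    !(Nat.beq (outs o0 o1 o2 o3 0) 1 && Nat.beq (outs o0 o1 o2 o3 1) 1 &&
      Nat.beq (outs o0 o1 o2 o3 2) 2) ||
      linkOK 4 2236416 o0 o1 o2 o3) = true := by
  decide +kernel

theorem link_four_rim : allTuples 4 (fun o0 o1 o2 o3 =>
    !(Nat.beq (outs o0 o1 o2 o3 2) 2 && Nat.beq (outs o0 o1 o2 o3 3) 2) ||
      linkOK 4 139536 o0 o1 o2 o3) = true := by
  decide +kernel

/-- The edge joining `u` to `v`, or nothing when `u = v`. -/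
def lk (u v : V) : Multiset (Sym2 V) := if u = v then 0 else {s(u, v)}

/-- The vertices `y 0, y 1` can be linked to some `a` and `y 2, y 3` to some `b`, with `a` linked to
`b`, by edge-disjoint walks in `EY`. -/
def Linked (Y : Finset V) (EY : Multiset (Sym2 V)) (y : Fin 4 → V) : Prop :=
  ∃ a ∈ Y, ∃ b ∈ Y, a ≠ b ∧
    Red EY (lk a b + (lk (y 0) a + (lk (y 1) a + (lk (y 2) b + lk (y 3) b))))

theorem demEdges_cons {n : ℕ} {φ : ℕ → V} (hφ : ∀ i < n, ∀ j < n, φ i = φ j → i = j) {s t : ℕ}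
    (hs : s < n) (ht : t < n) (dem : List (ℕ × ℕ)) :
    demEdges φ ((s, t) :: dem) = lk (φ s) (φ t) + demEdges φ dem := by
  by_cases h : s = t
  · subst h
    simp [demEdges, lk]
  · have h1 : Nat.beq s t = false := by rw [← Bool.not_eq_true, Nat.beq_eq]; exact h
    have h2 : φ s ≠ φ t := fun h' => h (hφ s hs t ht h')
    simp [demEdges, lk, h1, h2]

theorem linked_of_linkOK {n : ℕ} (hn : n ≤ 8) {φ : ℕ → V}
    (hφ : ∀ i < n, ∀ j < n, φ i = φ j → i = j) {Y : Finset V} (hY : ∀ i < n, φ i ∈ Y) {x : ℕ}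
    {o : Fin 4 → ℕ} (ho : ∀ i, o i < n) {EY : Multiset (Sym2 V)} (hE : Dom n φ x EY)
    (h : linkOK n x (o 0) (o 1) (o 2) (o 3) = true) {y : Fin 4 → V} (hy : ∀ i, y i = φ (o i)) :
    Linked Y EY y := by
  simp only [linkOK, someR_iff, Bool.and_eq_true, nne_iff, List.mem_range] at h
  obtain ⟨a, ha, b, hb, hab, hr⟩ := h
  refine ⟨φ a, hY a ha, φ b, hY b hb, fun h => hab (hφ a ha b hb h), ?_⟩
  have := route_sound hn hφ (vs := List.range n) (by simp) (by simp [ha, hb, ho]) hr hE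
  rw [demEdges_cons hφ ha hb, demEdges_cons hφ (ho _) ha, demEdges_cons hφ (ho _) ha,
    demEdges_cons hφ (ho _) hb, demEdges_cons hφ (ho _) hb] at this
  simpa [demEdges, hy] using this

theorem exists_labelling {l : List V} (h : l.Nodup) (v : V) :
    ∃ φ : ℕ → V, (∀ i < l.length, ∀ j < l.length, φ i = φ j → i = j) ∧
      l.toFinset = (Finset.range l.length).image φ ∧ ∀ i, φ i = l.getD i v := by
  refine ⟨fun i => l.getD i v, ?_, ?_, fun _ => rfl⟩
  · intro i hi j hj hij
    simp only [List.getD_eq_getElem _ _ hi, List.getD_eq_getElem _ _ hj] at hij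
    exact (h.getElem_inj_iff).1 hij
  · ext w
    simp only [Finset.mem_image, Finset.mem_range, List.mem_toFinset, List.mem_iff_getElem]
    constructor
    · rintro ⟨i, hi, rfl⟩; exact ⟨i, hi, List.getD_eq_getElem _ _ hi⟩
    · rintro ⟨i, hi, rfl⟩; exact ⟨i, hi, (List.getD_eq_getElem _ _ hi).symm⟩

theorem outs_eq (o : Fin 4 → ℕ) (j : ℕ) : outs (o 0) (o 1) (o 2) (o 3) j =
    (if o 0 = j then 1 else 0) + (if o 1 = j then 1 else 0) + (if o 2 = j then 1 else 0) +
      (if o 3 = j then 1 else 0) := by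
  have : ∀ a b : ℕ, (bif Nat.beq a b then 1 else 0 : ℕ) = if a = b then 1 else 0 := fun a b => by
    simp [cond_eq_ite]
  simp only [outs, this]

namespace Split

variable {S X : Finset V} {E EX EY : Multiset (Sym2 V)} {x y : Fin 4 → V}

theorem count_outer (h : Split S E X EX EY x y) {u v : V} (hu : u ∉ X) (hv : v ∉ X) :
    EY.count s(u, v) = E.count s(u, v) := by
  have h1 : EX.count s(u, v) = 0 := Multiset.count_eq_zero.2 fun hm => hu (h.suppX _ hm u (by simp))
  have h2 : ∀ i, ({s(x i, y i)} : Multiset (Sym2 V)).count s(u, v) = 0 := fun i => by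
    rw [Multiset.count_singleton, if_neg]
    intro he
    have : x i ∈ s(u, v) := by rw [he]; simp
    rcases Sym2.mem_iff.1 this with h3 | h3
    · exact hu (h3 ▸ h.hx i)
    · exact hv (h3 ▸ h.hx i)
  rw [h.eq, Fin.sum_univ_four]
  simp only [Multiset.count_add, h1, h2, zero_add, add_zero]

theorem exists_labels (h : Split S E X EX EY x y) {n : ℕ} {φ : ℕ → V}
    (hφ : ∀ i < n, ∀ j < n, φ i = φ j → i = j) (hY : S \ X = (Finset.range n).image φ) :
    ∃ o : Fin 4 → ℕ, (∀ i, o i < n) ∧ (∀ i, y i = φ (o i)) ∧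
      (∀ j < n, d E {φ j} = outs (o 0) (o 1) (o 2) (o 3) j +
        ∑ k ∈ Finset.range n \ {j}, E.count s(φ j, φ k)) ∧
      ∀ i < n, ∀ j < n, EY.count s(φ i, φ j) = E.count s(φ i, φ j) := by
  have hm : ∀ i, ∃ o < n, φ o = y i := fun i => by
    have := h.hy i
    rw [hY] at this
    simpa using this
  choose o ho hoy using hm
  have hin : ∀ j < n, φ j ∈ S \ X := fun j hj => by
    rw [hY]; exact Finset.mem_image_of_mem φ (by simpa using hj)
  have hcount : ∀ i < n, ∀ j < n, EY.count s(φ i, φ j) = E.count s(φ i, φ j) := fun i hi j hj =>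
    h.count_outer (Finset.mem_sdiff.1 (hin i hi)).2 (Finset.mem_sdiff.1 (hin j hj)).2
  refine ⟨o, ho, fun i => (hoy i).symm, fun j hj => ?_, hcount⟩
  have h1 := h.symm.d_of_subset (Z := {φ j}) (by simpa using hin j hj)
  have h2 := d_image_eq_sum hφ (E := EY) (by rw [← hY]; exact h.suppY) (I := {j}) (by simpa using hj) rfl
  rw [Finset.image_singleton, Finset.sum_singleton] at h2
  rw [h1, h2, outs_eq, add_comm]
  congr 1
  · have : ∀ i, (y i ∈ ({φ j} : Finset V)) ↔ o i = j := fun i => by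
      rw [Finset.mem_singleton, ← hoy]
      exact ⟨hφ _ (ho i) _ hj, fun h => by rw [h]⟩
    simp only [this]
  · refine Finset.sum_congr rfl fun k hk => hcount j hj k ?_
    simpa using (Finset.mem_sdiff.1 hk).1

end Split

theorem dom_of_count {n : ℕ} {φ : ℕ → V} {x : ℕ} {E : Multiset (Sym2 V)}
    (h : ∀ v < n, ∀ u < v, nth x (idx u v) ≤ E.count s(φ u, φ v)) : Dom n φ x E :=
  fun u v huv hv => h v hv u huv

namespace Min

variable {S X : Finset V} {E EX EY : Multiset (Sym2 V)} {x y : Fin 4 → V}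

theorem linked_two (h : Min S E) (hs : Split S E X EX EY x y) (hY : (S \ X).card = 2)
    (hnc : ∃ v ∈ S \ X, 4 ≤ d E {v}) : Linked (S \ X) EY y ∧ 2 ≤ EY.card := by
  obtain ⟨a, b, hab, hYe⟩ := Finset.card_eq_two.1 hY
  obtain ⟨φ, hφ, hYφ, hφe⟩ := exists_labelling (l := [a, b]) (by simpa using hab) a
  obtain rfl : φ 0 = a := hφe 0
  obtain rfl : φ 1 = b := hφe 1
  rw [show ([φ 0, φ 1] : List V).toFinset = {φ 0, φ 1} by simp, ← hYe] at hYφ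
  change ∀ i < 2, ∀ j < 2, φ i = φ j → i = j at hφ
  change _ = (Finset.range 2).image φ at hYφ
  obtain ⟨o, ho, hoy, hdeg, hcnt⟩ := hs.exists_labels hφ hYφ
  have d0 := hdeg 0 (by norm_num)
  have d1 := hdeg 1 (by norm_num)
  have c01 := hcnt 0 (by norm_num) 1 (by norm_num)
  rw [show Finset.range 2 \ {0} = {1} by decide, Finset.sum_singleton] at d0
  rw [show Finset.range 2 \ {1} = {0} by decide, Finset.sum_singleton,
    Sym2.eq_swap (a := φ 1)] at d1
  have hin : ∀ i < 2, φ i ∈ S \ X := fun i hi => by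
    rw [hYφ]; exact Finset.mem_image_of_mem _ (by simpa using hi)
  have ha : φ 0 ∈ S := (Finset.mem_sdiff.1 (hin 0 (by norm_num))).1
  have hb : φ 1 ∈ S := (Finset.mem_sdiff.1 (hin 1 (by norm_num))).1
  have hcard := h.card
  have e0 := h.good.three_le (by omega) ha
  have e1 := h.good.three_le (by omega) hb
  have hdY : d E {φ 0, φ 1} = 4 := by
    rw [← hYe, d_compl h.good.supp]; exact hs.d_self
  have hp := d_pair (E := E) hab
  have hnc' : 4 ≤ d E {φ 0} ∨ 4 ≤ d E {φ 1} := by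
    obtain ⟨v, hv, hv4⟩ := hnc
    rw [hYe] at hv
    simp only [Finset.mem_insert, Finset.mem_singleton] at hv
    rcases hv with rfl | rfl
    · exact Or.inl hv4
    · exact Or.inr hv4
  have htwo := h.no_chain_two ha hb
  have hp2 : 2 ≤ E.count s(φ 0, φ 1) := by omega
  refine ⟨?_, ?_⟩
  · have hl := allTuples_spec link_two (ho 0) (ho 1) (ho 2) (ho 3)
    rw [List.all_eq_true] at hl
    have hl' := hl (min (E.count s(φ 0, φ 1)) 4) (by simp)
    rw [Bool.or_eq_true, Bool.not_eq_true'] at hl'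
    refine linked_of_linkOK (by norm_num) hφ hin ho (x := min (E.count s(φ 0, φ 1)) 4) ?_
      (hl'.resolve_left ?_) hoy
    · refine dom_of_count fun v hv u huv => ?_
      interval_cases v <;> interval_cases u
      have : idx 0 1 = 0 := by decide
      rw [c01, this, nth_eq]
      omega
    · rw [Bool.not_eq_false]
      simp only [Bool.and_eq_true, Nat.ble_eq, Bool.not_eq_true',
        ← Bool.not_eq_true, Nat.beq_eq]
      omega
  · rw [← c01] at hp2
    exact hp2.trans (Multiset.count_le_card _ _)

end Min

theorem sum_range_sdiff_three (f : ℕ → ℕ) : (∑ k ∈ Finset.range 3 \ {0}, f k = f 1 + f 2) ∧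
    (∑ k ∈ Finset.range 3 \ {1}, f k = f 0 + f 2) ∧ ∑ k ∈ Finset.range 3 \ {2}, f k = f 0 + f 1 := by
  rw [show Finset.range 3 \ {0} = {1, 2} by decide, show Finset.range 3 \ {1} = {0, 2} by decide,
    show Finset.range 3 \ {2} = {0, 1} by decide]
  simp

theorem outs_sum_three {o : Fin 4 → ℕ} (ho : ∀ i, o i < 3) :
    outs (o 0) (o 1) (o 2) (o 3) 0 + outs (o 0) (o 1) (o 2) (o 3) 1 +
      outs (o 0) (o 1) (o 2) (o 3) 2 = 4 := by
  have key : ∀ k < 3, (if k = 0 then 1 else 0) + (if k = 1 then 1 else 0) +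
      (if k = 2 then 1 else 0) = 1 := by
    intro k hk; interval_cases k <;> rfl
  have h0 := key _ (ho 0)
  have h1 := key _ (ho 1)
  have h2 := key _ (ho 2)
  have h3 := key _ (ho 3)
  rw [outs_eq, outs_eq, outs_eq]
  omega

theorem nth_three_le (p q r : ℕ) :
    nth (min p 4 + 16 * min q 4 + 256 * min r 4) 0 ≤ p ∧
    nth (min p 4 + 16 * min q 4 + 256 * min r 4) 1 ≤ q ∧
    nth (min p 4 + 16 * min q 4 + 256 * min r 4) 2 ≤ r := by
  rw [nth_eq, nth_eq, nth_eq, pow_zero, pow_one, show (16 : ℕ) ^ 2 = 256 by norm_num]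
  refine ⟨?_, ?_, ?_⟩ <;> omega

theorem linkOK_three {o : Fin 4 → ℕ} (ho : ∀ i, o i < 3) {a b c p q r : ℕ}
    (hsum : a + b + c = 4) (ha : outs (o 0) (o 1) (o 2) (o 3) 0 = a)
    (hb : outs (o 0) (o 1) (o 2) (o 3) 1 = b) (hc : outs (o 0) (o 1) (o 2) (o 3) 2 = c)
    (h0 : 3 ≤ a + p + q) (h1 : 3 ≤ b + p + r) (h2 : 3 ≤ c + q + r) (h01 : 4 ≤ a + b + q + r)
    (h02 : 4 ≤ a + c + p + r) (h12 : 4 ≤ b + c + p + q)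
    (g0 : c = 0 → a = 2 → p = 0 → q = 2 → r = 2 → False)
    (g1 : b = 0 → a = 2 → q = 0 → p = 2 → r = 2 → False)
    (g2 : a = 0 → b = 2 → r = 0 → p = 2 → q = 2 → False) :
    linkOK 3 (min p 4 + 16 * min q 4 + 256 * min r 4) (o 0) (o 1) (o 2) (o 3) = true := by
  have hl := allTuples_spec link_three (ho 0) (ho 1) (ho 2) (ho 3)
  simp only [List.all_eq_true] at hl
  have hl' := hl (min p 4) (by simp) (min q 4) (by simp) (min r 4) (by simp)
  rw [Bool.or_eq_true, Bool.not_eq_true', ha, hb, hc] at hl'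
  refine hl'.resolve_left ?_
  rw [Bool.not_eq_false]
  simp only [Bool.and_eq_true, Nat.ble_eq, Bool.not_eq_true', ← Bool.not_eq_true, Nat.beq_eq]
  refine ⟨⟨⟨⟨⟨⟨⟨⟨?_, ?_⟩, ?_⟩, ?_⟩, ?_⟩, ?_⟩, ?_⟩, ?_⟩, ?_⟩
  iterate 6 omega
  · rintro ⟨⟨⟨⟨u1, u2⟩, u3⟩, u4⟩, u5⟩; exact g0 u1 u2 (by omega) (by omega) (by omega)
  · rintro ⟨⟨⟨⟨u1, u2⟩, u3⟩, u4⟩, u5⟩; exact g1 u1 u2 (by omega) (by omega) (by omega)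
  · rintro ⟨⟨⟨⟨u1, u2⟩, u3⟩, u4⟩, u5⟩; exact g2 u1 u2 (by omega) (by omega) (by omega)

namespace Min

variable {S X : Finset V} {E EX EY : Multiset (Sym2 V)} {x y : Fin 4 → V}

theorem linked_three (h : Min S E) (hs : Split S E X EX EY x y) (hY : (S \ X).card = 3) :
    Linked (S \ X) EY y ∧ ∃ v ∈ S \ X, 4 ≤ d E {v} := by
  obtain ⟨a, b, c, hab, hac, hbc, hYe⟩ := Finset.card_eq_three.1 hY
  obtain ⟨φ, hφ, hYφ, hφe⟩ := exists_labelling (l := [a, b, c]) (by simp [hab, hac, hbc]) a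
  obtain rfl : φ 0 = a := hφe 0
  obtain rfl : φ 1 = b := hφe 1
  obtain rfl : φ 2 = c := hφe 2
  rw [show ([φ 0, φ 1, φ 2] : List V).toFinset = {φ 0, φ 1, φ 2} by simp, ← hYe] at hYφ
  change ∀ i < 3, ∀ j < 3, φ i = φ j → i = j at hφ
  change _ = (Finset.range 3).image φ at hYφ
  obtain ⟨o, ho, hoy, hdeg, hcnt⟩ := hs.exists_labels hφ hYφ
  have d0 := hdeg 0 (by norm_num)
  have d1 := hdeg 1 (by norm_num)
  have d2 := hdeg 2 (by norm_num)
  have c01 := hcnt 0 (by norm_num) 1 (by norm_num)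
  have c02 := hcnt 0 (by norm_num) 2 (by norm_num)
  have c12 := hcnt 1 (by norm_num) 2 (by norm_num)
  rw [(sum_range_sdiff_three _).1] at d0
  rw [(sum_range_sdiff_three _).2.1, Sym2.eq_swap (a := φ 1) (b := φ 0)] at d1
  rw [(sum_range_sdiff_three _).2.2, Sym2.eq_swap (a := φ 2) (b := φ 0),
    Sym2.eq_swap (a := φ 2) (b := φ 1)] at d2
  have hin : ∀ i < 3, φ i ∈ S \ X := fun i hi => by
    rw [hYφ]; exact Finset.mem_image_of_mem _ (by simpa using hi)
  have hS : ∀ i < 3, φ i ∈ S := fun i hi => (Finset.mem_sdiff.1 (hin i hi)).1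
  have hcard := h.card
  have e0 := h.good.three_le (by omega) (hS 0 (by norm_num))
  have e1 := h.good.three_le (by omega) (hS 1 (by norm_num))
  have e2 := h.good.three_le (by omega) (hS 2 (by norm_num))
  have hpair : ∀ i < 3, ∀ j < 3, φ i ≠ φ j → 4 ≤ d E {φ i, φ j} := fun i hi j hj hij => by
    have hsub : ({φ i, φ j} : Finset V) ⊆ S := by
      intro v; simp only [Finset.mem_insert, Finset.mem_singleton]
      rintro (rfl | rfl)
      exacts [hS _ hi, hS _ hj]
    refine h.good.cut4 _ hsub (by rw [Finset.card_pair hij]) ?_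
    rw [Finset.card_sdiff_of_subset hsub, Finset.card_pair hij]; omega
  have p01 := hpair 0 (by norm_num) 1 (by norm_num) hab
  have p02 := hpair 0 (by norm_num) 2 (by norm_num) hac
  have p12 := hpair 1 (by norm_num) 2 (by norm_num) hbc
  have q01 := d_pair (E := E) hab
  have q02 := d_pair (E := E) hac
  have q12 := d_pair (E := E) hbc
  have t01 := h.no_chain_two (hS 0 (by norm_num)) (hS 1 (by norm_num))
  have t02 := h.no_chain_two (hS 0 (by norm_num)) (hS 2 (by norm_num))
  have t12 := h.no_chain_two (hS 1 (by norm_num)) (hS 2 (by norm_num))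
  have hsum := outs_sum_three ho
  constructor
  · refine linked_of_linkOK (by norm_num) hφ hin ho ?_
      (linkOK_three ho hsum rfl rfl rfl (p := E.count s(φ 0, φ 1)) (q := E.count s(φ 0, φ 2))
        (r := E.count s(φ 1, φ 2)) (by omega) (by omega) (by omega) (by omega) (by omega) (by omega)
        (fun u1 u2 u3 u4 u5 => t02 (by omega) (by omega) u4)
        (fun u1 u2 u3 u4 u5 => t01 (by omega) (by omega) u4)
        (fun u1 u2 u3 u4 u5 => t01 (by omega) (by omega) u4)) hoy
    obtain ⟨n0, n1, n2⟩ := nth_three_le (E.count s(φ 0, φ 1)) (E.count s(φ 0, φ 2))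
      (E.count s(φ 1, φ 2))
    refine dom_of_count fun v hv u huv => ?_
    have i0 : idx 0 1 = 0 := by decide
    have i1 : idx 0 2 = 1 := by decide
    have i2 : idx 1 2 = 2 := by decide
    interval_cases v <;> interval_cases u
    · rwa [i0, c01]
    · rwa [i1, c02]
    · rwa [i2, c12]
  · by_contra hcon
    push Not at hcon
    have k0 := hcon _ (hin 0 (by norm_num))
    have k1 := hcon _ (hin 1 (by norm_num))
    have k2 := hcon _ (hin 2 (by norm_num))
    omega

end Min

theorem count_contr_of_notMem {X : Finset V} {y u v : V} (hy : y ∈ X) (hu : u ∉ X) (hv : v ∉ X)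
    (huv : u ≠ v) (E : Multiset (Sym2 V)) : (contr X y E).count s(u, v) = E.count s(u, v) := by
  refine count_congr huv ?_ ?_ ?_ <;> refine d_contr_of_disjoint hy ?_ E
  · simpa using hu
  · simpa using hv
  · simp [hu, hv]

namespace Split

variable {S X : Finset V} {E EX EY : Multiset (Sym2 V)} {x y : Fin 4 → V}

theorem outs_eq_count (hE : ∀ e ∈ E, ∀ v ∈ e, v ∈ S) {x₀ : V} (hx₀ : x₀ ∈ X) (hXS : X ⊆ S) {n : ℕ}
    {φ : ℕ → V} (hφ : ∀ i < n, ∀ j < n, φ i = φ j → i = j) (hY : S \ X = (Finset.range n).image φ)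
    {o : Fin 4 → ℕ} {j : ℕ} (hj : j < n) (ho : d E {φ j} = outs (o 0) (o 1) (o 2) (o 3) j +
        ∑ k ∈ Finset.range n \ {j}, E.count s(φ j, φ k)) :
    outs (o 0) (o 1) (o 2) (o 3) j = (contr X x₀ E).count s(φ j, x₀) := by
  have hjY : φ j ∈ S \ X := by rw [hY]; exact Finset.mem_image_of_mem φ (by simpa using hj)
  have hjX := (Finset.mem_sdiff.1 hjY).2
  have h1 := d_eq_sum hE {φ j}
  have h2 : S \ {φ j} = X ∪ (Finset.range n \ {j}).image φ := by
    have h3 : (Finset.range n \ {j}).image φ = (S \ X) \ {φ j} := by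
      rw [hY]
      ext v
      simp only [Finset.mem_image, Finset.mem_sdiff, Finset.mem_range, Finset.mem_singleton]
      constructor
      · rintro ⟨a, ⟨ha, haj⟩, rfl⟩
        exact ⟨⟨a, ha, rfl⟩, fun h => haj (hφ a ha j hj h)⟩
      · rintro ⟨⟨a, ha, rfl⟩, h⟩
        exact ⟨a, ⟨ha, fun h' => h (by rw [h'])⟩, rfl⟩
    rw [h3]
    ext v
    simp only [Finset.mem_union, Finset.mem_sdiff, Finset.mem_singleton]
    constructor
    · tauto
    · rintro (h | h)
      · exact ⟨hXS h, fun h' => hjX (h' ▸ h)⟩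
      · tauto
  rw [Finset.sum_singleton, h2, Finset.sum_union, Finset.sum_image] at h1
  · rw [count_contr_self hx₀ hjX]
    omega
  · intro a ha b hb hab
    simp only [Finset.coe_sdiff, Finset.coe_range, Finset.coe_singleton, Set.mem_sdiff, Set.mem_Iio] at ha hb
    exact hφ a ha.1 b hb.1 hab
  · rw [Finset.disjoint_left]
    intro v hv hv'
    obtain ⟨a, ha, rfl⟩ := Finset.mem_image.1 hv'
    have : φ a ∈ S \ X := by
      rw [hY]; exact Finset.mem_image_of_mem φ (Finset.mem_sdiff.1 ha).1
    exact (Finset.mem_sdiff.1 this).2 hv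

theorem linked_of_four (h : Split S E X EX EY x y) (hE : ∀ e ∈ E, ∀ v ∈ e, v ∈ S) {x₀ : V}
    (hx₀ : x₀ ∈ X) {v0 v1 v2 v3 : V} (hnd : [v0, v1, v2, v3].Nodup) (hY : S \ X = {v0, v1, v2, v3})
    {z : ℕ} (h01 : nth z 0 ≤ (contr X x₀ E).count s(v0, v1))
    (h02 : nth z 1 ≤ (contr X x₀ E).count s(v0, v2))
    (h12 : nth z 2 ≤ (contr X x₀ E).count s(v1, v2))
    (h03 : nth z 3 ≤ (contr X x₀ E).count s(v0, v3))
    (h13 : nth z 4 ≤ (contr X x₀ E).count s(v1, v3))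
    (h23 : nth z 5 ≤ (contr X x₀ E).count s(v2, v3))
    (hl : ∀ o : Fin 4 → ℕ, (∀ i, o i < 4) →
      outs (o 0) (o 1) (o 2) (o 3) 0 = (contr X x₀ E).count s(v0, x₀) →
      outs (o 0) (o 1) (o 2) (o 3) 1 = (contr X x₀ E).count s(v1, x₀) →
      outs (o 0) (o 1) (o 2) (o 3) 2 = (contr X x₀ E).count s(v2, x₀) →
      outs (o 0) (o 1) (o 2) (o 3) 3 = (contr X x₀ E).count s(v3, x₀) →
      linkOK 4 z (o 0) (o 1) (o 2) (o 3) = true) : Linked (S \ X) EY y := by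
  obtain ⟨φ, hφ, hYφ, hφe⟩ := exists_labelling hnd v0
  obtain rfl : φ 0 = v0 := hφe 0
  obtain rfl : φ 1 = v1 := hφe 1
  obtain rfl : φ 2 = v2 := hφe 2
  obtain rfl : φ 3 = v3 := hφe 3
  rw [show ([φ 0, φ 1, φ 2, φ 3] : List V).toFinset = {φ 0, φ 1, φ 2, φ 3} by simp, ← hY] at hYφ
  change ∀ i < 4, ∀ j < 4, φ i = φ j → i = j at hφ
  change _ = (Finset.range 4).image φ at hYφ
  obtain ⟨o, ho, hoy, hdeg, hcnt⟩ := h.exists_labels hφ hYφ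
  have hin : ∀ i < 4, φ i ∈ S \ X := fun i hi => by
    rw [hYφ]; exact Finset.mem_image_of_mem _ (by simpa using hi)
  have hout : ∀ j < 4, outs (o 0) (o 1) (o 2) (o 3) j = (contr X x₀ E).count s(φ j, x₀) :=
    fun j hj => outs_eq_count hE hx₀ h.hX hφ hYφ hj (hdeg j hj)
  have hc : ∀ i < 4, ∀ j < 4, i ≠ j → EY.count s(φ i, φ j) = (contr X x₀ E).count s(φ i, φ j) :=
    fun i hi j hj hij => by
      rw [hcnt i hi j hj, count_contr_of_notMem hx₀ (Finset.mem_sdiff.1 (hin i hi)).2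
        (Finset.mem_sdiff.1 (hin j hj)).2 fun h => hij (hφ i hi j hj h)]
  refine linked_of_linkOK (by norm_num) hφ hin ho ?_
    (hl o ho (hout 0 (by norm_num)) (hout 1 (by norm_num)) (hout 2 (by norm_num))
      (hout 3 (by norm_num))) hoy
  have i0 : idx 0 1 = 0 := by decide
  have i1 : idx 0 2 = 1 := by decide
  have i2 : idx 1 2 = 2 := by decide
  have i3 : idx 0 3 = 3 := by decide
  have i4 : idx 1 3 = 4 := by decide
  have i5 : idx 2 3 = 5 := by decide
  refine dom_of_count fun v hv u huv => ?_
  interval_cases v <;> interval_cases u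
  · rwa [i0, hc 0 (by norm_num) 1 (by norm_num) (by norm_num)]
  · rwa [i1, hc 0 (by norm_num) 2 (by norm_num) (by norm_num)]
  · rwa [i2, hc 1 (by norm_num) 2 (by norm_num) (by norm_num)]
  · rwa [i3, hc 0 (by norm_num) 3 (by norm_num) (by norm_num)]
  · rwa [i4, hc 1 (by norm_num) 3 (by norm_num) (by norm_num)]
  · rwa [i5, hc 2 (by norm_num) 3 (by norm_num) (by norm_num)]

end Split

/-- `Y` is one side of a cut with four edges, the other side contains a vertex of degree at least
four, and `Y` is not a pair of cubic vertices. -/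
structure Cand (S : Finset V) (E : Multiset (Sym2 V)) (Y : Finset V) : Prop where
  sub : Y ⊆ S
  cut : d E Y = 4
  two : 2 ≤ Y.card
  two' : 2 ≤ (S \ Y).card
  noncubic : ∃ v ∈ S \ Y, 4 ≤ d E {v}
  notPair : Y.card = 2 → ∃ v ∈ Y, 4 ≤ d E {v}

theorem Chain3.d_triple {S : Finset V} {E : Multiset (Sym2 V)} {p q r : V} (h : Chain3 S E p q r)
    (hG : Good S E) : d E {p, q, r} = 4 := by
  have hpq : p ≠ q := hG.ne_of_count (by rw [h.pq]; norm_num)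
  have hqr : q ≠ r := hG.ne_of_count (by rw [h.qr]; norm_num)
  have h1 := d_pair (E := E) hqr
  have hp : p ∉ ({q, r} : Finset V) := by simp [hpq, h.npr]
  have h2 := d_union (E := E) (A := {p}) (B := {q, r}) (by simpa using hp)
  rw [ee_singleton_eq_sum _ hp, Finset.sum_pair hqr, h.pq, h.pr, h.dp, ← Finset.insert_eq] at h2
  rw [h.dq, h.dr, h.qr] at h1
  omega

namespace Min

variable {S X : Finset V} {E EX EY : Multiset (Sym2 V)} {x y : Fin 4 → V}

theorem linked_chain (h : Min S E) (hs : Split S E X EX EY x y) (hY : 4 ≤ (S \ X).card)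
    (hmin : ∀ Z, Cand S E Z → (S \ X).card ≤ Z.card) {p x₀ r : V} (hx₀ : x₀ ∈ X)
    (hG : Good (insert x₀ (S \ X)) (contr X x₀ E)) (hp : p ∈ S \ X) (hr : r ∈ S \ X)
    (hc : Chain3 (insert x₀ (S \ X)) (contr X x₀ E) p x₀ r) :
    Linked (S \ X) EY y ∧ ∃ v ∈ S \ X, 4 ≤ d E {v} := by
  have hpr := hc.npr
  have hd : ∀ Z ⊆ S \ X, d (contr X x₀ E) Z = d E Z := fun Z hZ =>
    d_contr_of_disjoint hx₀ (Finset.disjoint_left.2 fun v hv hv' =>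
      (Finset.mem_sdiff.1 (hZ hv)).2 hv') E
  have dp : d E {p} = 4 := by rw [← hd _ (by simpa using hp), hc.dp]
  have dr : d E {r} = 4 := by rw [← hd _ (by simpa using hr), hc.dr]
  refine ⟨?_, p, hp, dp.ge⟩
  have hpS := (Finset.mem_sdiff.1 hp).1
  have hrS := (Finset.mem_sdiff.1 hr).1
  have hpX := (Finset.mem_sdiff.1 hp).2
  have hrX := (Finset.mem_sdiff.1 hr).2
  have hsub : ({p, r} : Finset V) ⊆ S \ X := by
    intro v; simp only [Finset.mem_insert, Finset.mem_singleton]; rintro (rfl | rfl) <;> assumption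
  have hYc : ((S \ X) \ {p, r}).card + 2 = (S \ X).card := by
    have := Finset.card_le_card hsub
    rw [Finset.card_sdiff_of_subset hsub, Finset.card_pair hpr] at *
    omega
  have hdY : d E ((S \ X) \ {p, r}) = 4 := by
    rw [← hd _ Finset.sdiff_subset, ← hc.d_triple hG, ← d_compl hG.supp {p, x₀, r}]
    congr 1
    ext v
    simp only [Finset.mem_sdiff, Finset.mem_insert, Finset.mem_singleton]
    constructor
    · rintro ⟨⟨hv, hv'⟩, h2⟩
      exact ⟨Or.inr ⟨hv, hv'⟩, fun h3 => by
        rcases h3 with h3 | h3 | h3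
        · exact h2 (Or.inl h3)
        · exact hv' (h3 ▸ hx₀)
        · exact h2 (Or.inr h3)⟩
    · rintro ⟨hv | hv, h2⟩
      · exact absurd (Or.inr (Or.inl hv)) h2
      · exact ⟨hv, fun h3 => h2 (by tauto)⟩
  have hpair : ((S \ X) \ {p, r}).card = 2 ∧ ∀ v ∈ (S \ X) \ {p, r}, d E {v} < 4 := by
    by_contra hcon
    have : Cand S E ((S \ X) \ {p, r}) :=
      { sub := Finset.sdiff_subset.trans Finset.sdiff_subset
        cut := hdY
        two := by omega
        two' := by
          rw [← Finset.card_pair hpr]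
          refine Finset.card_le_card fun v hv => ?_
          exact Finset.mem_sdiff.2 ⟨(Finset.mem_sdiff.1 (hsub hv)).1,
            fun h' => (Finset.mem_sdiff.1 h').2 hv⟩
        noncubic := ⟨p, by simp [hpS], dp.ge⟩
        notPair := fun h2 => by
          by_contra h3
          push Not at h3
          exact hcon ⟨h2, h3⟩ }
    have := hmin _ this
    omega
  obtain ⟨s, t, hst, hYe⟩ := Finset.card_eq_two.1 hpair.1
  have hsm : s ∈ (S \ X) \ {p, r} := by simp [hYe]
  have htm : t ∈ (S \ X) \ {p, r} := by simp [hYe]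
  have hcard := h.card
  have ds : d E {s} = 3 := by
    have h1 := hpair.2 s hsm
    have h2 := h.good.three_le (by omega) (Finset.mem_sdiff.1 (Finset.mem_sdiff.1 hsm).1).1
    omega
  have dt : d E {t} = 3 := by
    have h1 := hpair.2 t htm
    have h2 := h.good.three_le (by omega) (Finset.mem_sdiff.1 (Finset.mem_sdiff.1 htm).1).1
    omega
  have hst1 : E.count s(s, t) = 1 := by
    have := d_pair (E := E) hst
    rw [← hYe, hdY, ds, dt] at this
    omega
  obtain ⟨hsY, hspr⟩ := Finset.mem_sdiff.1 hsm
  obtain ⟨htY, htpr⟩ := Finset.mem_sdiff.1 htm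
  simp only [Finset.mem_insert, Finset.mem_singleton, not_or] at hspr htpr
  obtain ⟨hsS, hsX⟩ := Finset.mem_sdiff.1 hsY
  obtain ⟨htS, htX⟩ := Finset.mem_sdiff.1 htY
  have hle : ∀ u ∈ S, ∀ v ∈ S, u ≠ v → d E {u} = 4 → d E {v} = 3 → E.count s(u, v) ≤ 1 := by
    intro u hu v hv huv du dv
    have h1 := d_pair (E := E) huv
    have hsub : ({u, v} : Finset V) ⊆ S := by
      intro w; simp only [Finset.mem_insert, Finset.mem_singleton]; rintro (rfl | rfl) <;> assumption
    have h2 := h.good.cut4 {u, v} hsub (by rw [Finset.card_pair huv])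
      (by rw [Finset.card_sdiff_of_subset hsub, Finset.card_pair huv]; omega)
    omega
  have hYset : S \ X = {p, r, s, t} := by
    rw [← Finset.sdiff_union_of_subset hsub, hYe]
    ext v; simp only [Finset.mem_union, Finset.mem_insert, Finset.mem_singleton]; tauto
  have hnd : [p, r, s, t].Nodup := by
    simp [hpr, hst, Ne.symm hspr.1, Ne.symm hspr.2, Ne.symm htpr.1, Ne.symm htpr.2]
  have hsum : ∀ u ∈ ({p, r} : Finset V), d (contr X x₀ E) {u} = (contr X x₀ E).count s(u, x₀) +
      ((contr X x₀ E).count s(p, r) + ((contr X x₀ E).count s(u, s) + (contr X x₀ E).count s(u, t))) := by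
    intro u hu
    have hx : x₀ ∉ ({p, r, s, t} : Finset V) := by
      rw [← hYset]; simp [hx₀]
    rw [d_eq_sum hG.supp, Finset.sum_singleton]
    simp only [List.nodup_cons, List.mem_cons, List.not_mem_nil, or_false, not_or] at hnd
    obtain ⟨⟨n1, n2, n3⟩, ⟨n4, n5⟩, n6, -⟩ := hnd
    simp only [Finset.mem_insert, Finset.mem_singleton, not_or] at hx
    obtain ⟨m1, m2, m3, m4⟩ := hx
    simp only [Finset.mem_insert, Finset.mem_singleton] at hu
    rw [hYset]
    rcases hu with rfl | rfl
    · rw [show insert x₀ {u, r, s, t} \ {u} = ({x₀, r, s, t} : Finset V) by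
        ext v; simp only [Finset.mem_sdiff, Finset.mem_insert, Finset.mem_singleton]; grind]
      rw [Finset.sum_insert (by simp [*]), Finset.sum_insert (by simp [*]), Finset.sum_pair n6]
    · rw [show insert x₀ {p, u, s, t} \ {u} = ({x₀, p, s, t} : Finset V) by
        ext v; simp only [Finset.mem_sdiff, Finset.mem_insert, Finset.mem_singleton]; grind]
      rw [Finset.sum_insert (by simp [*]), Finset.sum_insert (by simp; grind), Finset.sum_pair n6,
        Sym2.eq_swap (a := u) (b := p)]
  have hin : ∀ {u v : V}, u ∉ X → v ∉ X → u ≠ v → (contr X x₀ E).count s(u, v) = E.count s(u, v) :=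
    fun hu hv huv => count_contr_of_notMem hx₀ hu hv huv E
  have kp := hsum p (by simp)
  have kr := hsum r (by simp)
  rw [hc.dp, hc.pq, hc.pr] at kp
  rw [hc.dr, hc.pr, Sym2.eq_swap, hc.qr] at kr
  have b1 := hin hpX hsX (Ne.symm hspr.1)
  have b2 := hin hpX htX (Ne.symm htpr.1)
  have b3 := hin hrX hsX (Ne.symm hspr.2)
  have b4 := hin hrX htX (Ne.symm htpr.2)
  have l1 := hle p hpS s hsS (Ne.symm hspr.1) dp ds
  have l2 := hle p hpS t htS (Ne.symm htpr.1) dp dt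
  have l3 := hle r hrS s hsS (Ne.symm hspr.2) dr ds
  have l4 := hle r hrS t htS (Ne.symm htpr.2) dr dt
  refine hs.linked_of_four h.good.supp hx₀ hnd hYset (z := 1118480) ?_ ?_ ?_ ?_ ?_ ?_ ?_
  · rw [nth_eq]; norm_num
  · rw [nth_eq]; norm_num; omega
  · rw [nth_eq]; norm_num; omega
  · rw [nth_eq]; norm_num; omega
  · rw [nth_eq]; norm_num; omega
  · rw [hin hsX htX hst, hst1, nth_eq]; norm_num
  · intro o ho o0 o1 _ _
    have hl := allTuples_spec link_four_chain (ho 0) (ho 1) (ho 2) (ho 3)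
    rw [hc.pq] at o0
    rw [Sym2.eq_swap, hc.qr] at o1
    simpa [o0, o1] using hl

theorem linked_exc_center (h : Min S E) (hs : Split S E X EX EY x y) {a b g x₀ e : V} (hx₀ : x₀ ∈ X)
    (hc : Exc (insert x₀ (S \ X)) (contr X x₀ E) a b g x₀ e)
    (hg : (contr X x₀ E).count s(g, x₀) = 2) : Linked (S \ X) EY y := by
  have hnd := hc.nodup
  simp only [List.nodup_cons, List.mem_cons, List.not_mem_nil, or_false, not_or] at hnd
  have hY : S \ X = {a, b, g, e} := by
    rw [← Finset.erase_insert (show x₀ ∉ S \ X by simp [hx₀]), hc.hS]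
    ext v
    simp only [Finset.mem_erase, Finset.mem_insert, Finset.mem_singleton]
    grind
  refine hs.linked_of_four h.good.supp hx₀ (v0 := a) (v1 := b) (v2 := g) (v3 := e) ?_ hY
    (z := 2236416) ?_ ?_ ?_ ?_ ?_ ?_ ?_
  · simp only [List.nodup_cons, List.mem_cons, List.not_mem_nil, or_false, not_or]
    tauto
  · rw [nth_eq]; norm_num
  · rw [nth_eq]; norm_num
  · rw [nth_eq]; norm_num
  · rw [nth_eq, hc.ae]; norm_num
  · rw [nth_eq, hc.be]; norm_num
  · rw [nth_eq, hc.ge]; norm_num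
  · intro o ho o0 o1 o2 _
    have hl := allTuples_spec link_four_center (ho 0) (ho 1) (ho 2) (ho 3)
    rw [hc.ac] at o0
    rw [hc.bc] at o1
    rw [hg] at o2
    simpa [o0, o1, o2] using hl

theorem linked_exc_rim (h : Min S E) (hs : Split S E X EX EY x y) {a b x₀ c e : V} (hx₀ : x₀ ∈ X)
    (hc : Exc (insert x₀ (S \ X)) (contr X x₀ E) a b x₀ c e)
    (hg : (contr X x₀ E).count s(x₀, c) = 2) : Linked (S \ X) EY y := by
  have hnd := hc.nodup
  simp only [List.nodup_cons, List.mem_cons, List.not_mem_nil, or_false, not_or] at hnd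
  have hY : S \ X = {a, b, c, e} := by
    rw [← Finset.erase_insert (show x₀ ∉ S \ X by simp [hx₀]), hc.hS]
    ext v
    simp only [Finset.mem_erase, Finset.mem_insert, Finset.mem_singleton]
    grind
  refine hs.linked_of_four h.good.supp hx₀ (v0 := a) (v1 := b) (v2 := c) (v3 := e) ?_ hY
    (z := 139536) ?_ ?_ ?_ ?_ ?_ ?_ ?_
  · simp only [List.nodup_cons, List.mem_cons, List.not_mem_nil, or_false, not_or]
    tauto
  · rw [nth_eq]; norm_num
  · rw [nth_eq, hc.ac]; norm_num
  · rw [nth_eq, hc.bc]; norm_num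
  · rw [nth_eq, hc.ae]; norm_num
  · rw [nth_eq, hc.be]; norm_num
  · rw [nth_eq]; norm_num
  · intro o ho _ _ o2 o3
    have hl := allTuples_spec link_four_rim (ho 0) (ho 1) (ho 2) (ho 3)
    rw [Sym2.eq_swap, hg] at o2
    rw [Sym2.eq_swap, hc.ge] at o3
    simpa [o2, o3] using hl

theorem linked_four (h : Min S E) (hs : Split S E X EX EY x y) (hY : 4 ≤ (S \ X).card)
    (hX : 2 ≤ X.card) (hnc : ∃ v ∈ X, 4 ≤ d E {v})
    (hmin : ∀ Z, Cand S E Z → (S \ X).card ≤ Z.card) :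
    Linked (S \ X) EY y ∧ ∃ v ∈ S \ X, 4 ≤ d E {v} := by
  obtain ⟨x₀, hx₀, hx4⟩ := hnc
  have hG := h.good.contr hs.hX hx₀
  have hdx : d (contr X x₀ E) {x₀} = 4 := by rw [d_contr_self X hx₀, hs.d_self]
  have hd : ∀ Z ⊆ S \ X, d (contr X x₀ E) Z = d E Z := fun Z hZ =>
    d_contr_of_disjoint hx₀ (Finset.disjoint_left.2 fun v hv hv' =>
      (Finset.mem_sdiff.1 (hZ hv)).2 hv') E
  have hcount : ∀ {u v : V}, u ∈ S \ X → v ∈ S \ X → u ≠ v →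
      (contr X x₀ E).count s(u, v) = E.count s(u, v) := fun hu hv huv =>
    count_contr_of_notMem hx₀ (Finset.mem_sdiff.1 hu).2 (Finset.mem_sdiff.1 hv).2 huv E
  rcases h.contract hs.hX hx₀ hs.d_self hx4 hX hY with ⟨p, q, r, hc⟩ | ⟨a, b, g, c, e, hc⟩
  · have hpq : p ≠ q := hG.ne_of_count (by rw [hc.pq]; norm_num)
    have hqr : q ≠ r := hG.ne_of_count (by rw [hc.qr]; norm_num)
    have hin : ∀ {v}, v ∈ insert x₀ (S \ X) → v ≠ x₀ → v ∈ S \ X := fun h1 h2 =>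
      (Finset.mem_insert.1 h1).resolve_left h2
    have hdeg : ∀ {v}, v ∈ S \ X → d (contr X x₀ E) {v} = 4 → d E {v} = 4 := fun h1 h2 => by
      rw [← hd _ (by simpa using h1), h2]
    rcases eq_or_ne q x₀ with rfl | hq
    · exact h.linked_chain hs hY hmin hx₀ hG (hin hc.hp hpq) (hin hc.hr hqr.symm) hc
    · have hq' := hin hc.hq hq
      have hqS := (Finset.mem_sdiff.1 hq').1
      rcases eq_or_ne p x₀ with rfl | hp
      · have hr := hin hc.hr hc.npr.symm
        exact absurd (by rw [← hcount hq' hr hqr, hc.qr]) (h.no_chain_two hqS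
          (Finset.mem_sdiff.1 hr).1 (hdeg hq' hc.dq) (hdeg hr hc.dr))
      · have hp' := hin hc.hp hp
        have hpS := (Finset.mem_sdiff.1 hp').1
        exact absurd (by rw [← hcount hp' hq' hpq, hc.pq])
          (h.no_chain_two hpS hqS (hdeg hp' hc.dp) (hdeg hq' hc.dq))
  · obtain ⟨da, db, dg, dc, de⟩ := hc.degrees hG.supp
    have hmem := (hc.mem_iff x₀).1 (Finset.mem_insert_self _ _)
    have he : e ∈ S \ X := by
      refine (Finset.mem_insert.1 ((hc.mem_iff e).2 (by simp))).resolve_left fun h' => ?_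
      rw [h'] at de; omega
    refine ⟨?_, e, he, by rw [← hd _ (by simpa using he)]; omega⟩
    rcases hmem with hx | hx | hx | hx | hx
    · rw [← hx] at da; omega
    · rw [← hx] at db; omega
    · subst hx; exact h.linked_exc_rim hs hx₀ hc (by omega)
    · subst hx; exact h.linked_exc_center hs hx₀ hc (by omega)
    · rw [← hx] at de; omega

end Min

theorem red_lk (u v a : V) : Red ({s(u, v)} + lk v a) {s(u, a)} := by
  unfold lk
  split_ifs with h
  · subst h; exact .of_eq (by simp)
  · rw [Multiset.singleton_add]
    exact Red.split (E := 0) (.refl _)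

theorem Split.red_pairEdges {S X : Finset V} {E EX EY : Multiset (Sym2 V)} {x y : Fin 4 → V}
    (h : Split S E X EX EY x y) {a b : V} (hab : a ≠ b)
    (hl : Red EY (lk a b + (lk (y 0) a + (lk (y 1) a + (lk (y 2) b + lk (y 3) b))))) :
    Red E (EX + pairEdges x a b) := by
  rw [h.eq, Fin.sum_univ_four, add_assoc]
  refine Red.add_left ?_ EX
  refine (hl.add_right _).trans ?_
  have h1 : lk a b = {s(a, b)} := by rw [lk, if_neg hab]
  have h2 : lk a b + (lk (y 0) a + (lk (y 1) a + (lk (y 2) b + lk (y 3) b))) +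
      ({s(x 0, y 0)} + {s(x 1, y 1)} + {s(x 2, y 2)} + {s(x 3, y 3)}) =
      ({s(x 0, y 0)} + lk (y 0) a) + (({s(x 1, y 1)} + lk (y 1) a) +
        (({s(x 2, y 2)} + lk (y 2) b) + (({s(x 3, y 3)} + lk (y 3) b) + lk a b))) := by
    abel
  rw [h2, h1, show pairEdges x a b = {s(x 0, a)} + ({s(x 1, a)} + ({s(x 2, b)} + ({s(x 3, b)} +
    {s(a, b)}))) from rfl]
  refine ((red_lk _ _ _).add_right _).trans (Red.add_left ?_ _)
  refine ((red_lk _ _ _).add_right _).trans (Red.add_left ?_ _)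
  refine ((red_lk _ _ _).add_right _).trans (Red.add_left ?_ _)
  exact (red_lk _ _ _).add_right _

theorem Exc.adjacent_cubic {S : Finset V} {E : Multiset (Sym2 V)} {α β g c e a b : V}
    (h : Exc S E α β g c e) (hG : Good S E) (ha : a ∈ S) (hb : b ∈ S) (da : d E {a} = 3)
    (db : d E {b} = 3) (hab : 0 < E.count s(a, b)) :
    E.count s(a, e) = 2 ∧ E.count s(b, e) = 0 ∨ E.count s(a, e) = 0 ∧ E.count s(b, e) = 2 := by
  obtain ⟨e1, e2, e3, e4, e5⟩ := h.degrees hG.supp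
  have h1 := h.ce; have h2 := h.ac; have h3 := h.ae; have h4 := h.bc; have h5 := h.be
  have h6 := h.ab; have h7 := h.ge; have h8 := h.ag; have h9 := h.bg
  have hne := hG.ne_of_count hab
  have sw : ∀ u v : V, E.count s(u, v) = E.count s(v, u) := fun u v => by rw [Sym2.eq_swap]
  rcases (h.mem_iff a).1 ha with rfl | rfl | rfl | rfl | rfl <;>
    rcases (h.mem_iff b).1 hb with rfl | rfl | rfl | rfl | rfl <;>
    first
    | exact absurd rfl hne
    | omega
    | (rw [sw] at hab; omega)

theorem count_pairEdges {x : Fin 4 → V} {a b e : V} (hab : a ≠ b) (hae : a ≠ e) (hbe : b ≠ e)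
    (hx : ∀ i, x i ≠ a ∧ x i ≠ b) :
    (pairEdges x a b).count s(a, e) = (if x 0 = e then 1 else 0) + (if x 1 = e then 1 else 0) ∧
    (pairEdges x a b).count s(b, e) = (if x 2 = e then 1 else 0) + (if x 3 = e then 1 else 0) := by
  have h1 : ∀ i c c', (c = a ∨ c = b) → (c' = a ∨ c' = b) →
      (s(c, e) = s(x i, c') ↔ x i = e ∧ c = c') := fun i c c' hc hc' => by
    have := hx i
    rw [Sym2.eq_iff]
    constructor
    · rintro (⟨h, -⟩ | ⟨h, h'⟩)
      · rcases hc with rfl | rfl <;> simp_all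
      · exact ⟨h'.symm, h⟩
    · rintro ⟨h, h'⟩; exact Or.inr ⟨h', h.symm⟩
  have h2 : s(a, e) ≠ s(a, b) := by simp [hbe.symm, hab]
  have h3 : s(b, e) ≠ s(a, b) := by simp [hab.symm, hae.symm]
  unfold pairEdges
  simp only [Multiset.count_cons, Multiset.count_singleton, h1 _ _ _ (Or.inl rfl) (Or.inl rfl),
    h1 _ _ _ (Or.inl rfl) (Or.inr rfl), h1 _ _ _ (Or.inr rfl) (Or.inl rfl),
    h1 _ _ _ (Or.inr rfl) (Or.inr rfl), h2, h3, hab, hab.symm, and_true, and_false, if_false]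
  constructor <;> ring

namespace Min

variable {S X : Finset V} {E EX EY : Multiset (Sym2 V)} {x y : Fin 4 → V}

theorem exc_of_not_bad (h : Min S E) (hs : Split S E X EX EY x y) (hl : Linked (S \ X) EY y)
    (hY : 2 ≤ (S \ X).card) (hlt : 4 ≤ (S \ X).card + EY.card) (hX : 3 ≤ X.card)
    (hnc : ∃ v ∈ X, 4 ≤ d E {v}) (hb : ¬ Bad X EX x) : X.card = 3 ∧
      ∃ e, x 0 = e ∧ x 1 = e ∧ x 2 ≠ e ∧ x 3 ≠ e ∨ x 0 ≠ e ∧ x 1 ≠ e ∧ x 2 = e ∧ x 3 = e := by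
  obtain ⟨a, ha, b, hb', hab, hr⟩ := hl
  have haX := (Finset.mem_sdiff.1 ha).2
  have hbX := (Finset.mem_sdiff.1 hb').2
  have hR := hs.red_pairEdges hab hr
  have hG := hs.good_pair h.good hY hb ha hb' hab
  have hcard : (insert a (insert b X)).card = X.card + 2 := by
    rw [Finset.card_insert_of_notMem (by simp [hab, haX]), Finset.card_insert_of_notMem hbX]
  have hx : ∀ i, x i ≠ a ∧ x i ≠ b := fun i =>
    ⟨fun h' => haX (h' ▸ hs.hx i), fun h' => hbX (h' ▸ hs.hx i)⟩
  have hd : ∀ Z ⊆ X, d (EX + pairEdges x a b) Z = d E Z := fun Z hZ => by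
    rw [d_add, d_pairEdges, hs.d_of_subset hZ]
    have h1 : a ∉ Z := fun h' => haX (hZ h')
    have h2 : b ∉ Z := fun h' => hbX (hZ h')
    simp only [h1, h2, iff_false, ite_not, iff_self, if_true, add_zero]
  have hcub : d (EX + pairEdges x a b) {a} = 3 ∧ d (EX + pairEdges x a b) {b} = 3 := by
    have h1 : d EX {a} = 0 := d_eq_zero_of_supp hs.suppX (Or.inl (by simpa using haX))
    have h2 : d EX {b} = 0 := d_eq_zero_of_supp hs.suppX (Or.inl (by simpa using hbX))
    rw [d_add, d_add, d_pairEdges, d_pairEdges, h1, h2]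
    simp [hx, hab, hab.symm]
  have hT : T (insert a (insert b X)) (EX + pairEdges x a b) := by
    refine h.ih _ _ hR hG (by omega) ?_ ?_
    · have h1 : E.card = EX.card + EY.card + 4 := by rw [hs.eq]; simp
      have h2 := Finset.card_sdiff_add_card_eq_card hs.hX
      have h3 : (EX + pairEdges x a b).card = EX.card + 5 := by simp [pairEdges]
      omega
    · obtain ⟨v, hv, h4⟩ := hnc
      exact ⟨v, by simp [hv], by rwa [hd _ (by simpa using hv)]⟩
  have hin : ∀ v ∈ insert a (insert b X), d (EX + pairEdges x a b) {v} ≠ 3 → v ∈ X := by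
    intro v hv h4
    simp only [Finset.mem_insert] at hv
    rcases hv with rfl | rfl | hv
    · exact absurd hcub.1 h4
    · exact absurd hcub.2 h4
    · exact hv
  rcases hT with ⟨p, q, r, hc⟩ | ⟨α, β, g, c, e, hc⟩
  · have hp := hin p hc.hp (by rw [hc.dp]; norm_num)
    have hq := hin q hc.hq (by rw [hc.dq]; norm_num)
    have hr := hin r hc.hr (by rw [hc.dr]; norm_num)
    refine absurd (hc.congr hG (hs.hX hp) (hs.hX hq) (hs.hX hr) fun Z hZ => (hd Z ?_).symm) (h.noC p q r)
    refine hZ.trans fun v hv => ?_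
    simp only [Finset.mem_insert, Finset.mem_singleton] at hv
    rcases hv with rfl | rfl | rfl <;> assumption
  · have h5 : (insert a (insert b X)).card ≤ 5 := by rw [hc.hS]; exact Finset.card_le_five
    have he := hin e ((hc.mem_iff e).2 (by simp)) (by rw [(hc.degrees hG.supp).2.2.2.2]; norm_num)
    have hae : a ≠ e := fun h' => haX (h' ▸ he)
    have hbe : b ≠ e := fun h' => hbX (h' ▸ he)
    have hEX : ∀ {w}, w ∉ X → EX.count s(w, e) = 0 := fun hw =>
      Multiset.count_eq_zero.2 fun hm => hw (hs.suppX _ hm _ (by simp))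
    have hcount := count_pairEdges hab hae hbe hx
    have := hc.adjacent_cubic hG (by simp) (by simp) hcub.1 hcub.2
      (Multiset.count_pos.2 (by simp [pairEdges]))
    rw [Multiset.count_add, Multiset.count_add, hEX haX, hEX hbX, hcount.1, hcount.2] at this
    refine ⟨by omega, e, ?_⟩
    split_ifs at this <;> simp_all

theorem not_all_linked (h : Min S E) (hs : Split S E X EX EY x y)
    (hl : ∀ σ : Equiv.Perm (Fin 4), Linked (S \ X) EY (y ∘ σ))
    (hY : 2 ≤ (S \ X).card) (hlt : 4 ≤ (S \ X).card + EY.card) (hX : 3 ≤ X.card)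
    (hnc : ∃ v ∈ X, 4 ≤ d E {v}) : False := by
  have key := fun σ => h.exc_of_not_bad (hs.perm σ) (hl σ) hY hlt hX hnc
  have hbad : ∀ σ : Equiv.Perm (Fin 4), ¬ (Bad X EX (x ∘ σ) ∧ Bad X EX ((x ∘ σ) ∘ Equiv.swap 1 2)) := by
    rintro σ ⟨h1, h2⟩
    obtain ⟨v, hv, h4⟩ := hnc
    have := (hs.perm σ).bad_of_bad h.good hY h1 h2 v hv
    omega
  have hflip : ∀ z : Fin 4 → V, Bad X EX z → Bad X EX (z ∘ Equiv.swap 2 3) := by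
    rintro z ⟨Z, hZ, z0, z1, z2, z3, hdZ⟩
    exact ⟨Z, hZ, z0, z1, z3, z2, hdZ⟩
  have a0 : Equiv.swap (1 : Fin 4) 2 0 = 0 := by decide
  have a1 : Equiv.swap (1 : Fin 4) 2 1 = 2 := by decide
  have a2 : Equiv.swap (1 : Fin 4) 2 2 = 1 := by decide
  have a3 : Equiv.swap (1 : Fin 4) 2 3 = 3 := by decide
  have b0 : Equiv.swap (2 : Fin 4) 3 0 = 0 := by decide
  have b1 : Equiv.swap (2 : Fin 4) 3 1 = 1 := by decide
  have b2 : Equiv.swap (2 : Fin 4) 3 2 = 3 := by decide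
  have b3 : Equiv.swap (2 : Fin 4) 3 3 = 2 := by decide
  have k0 := key 1
  have k1 := key (Equiv.swap 1 2)
  have k2 := key (Equiv.swap 2 3 * Equiv.swap 1 2)
  have t0 := hbad 1
  have t1 := hbad (Equiv.swap 2 3)
  have t2 := hbad (Equiv.swap 1 2 * Equiv.swap 2 3)
  have e2 : x ∘ ⇑(Equiv.swap 2 3 * Equiv.swap 1 2 : Equiv.Perm (Fin 4)) =
    (x ∘ Equiv.swap 2 3) ∘ Equiv.swap 1 2 := rfl
  have e3 : x ∘ ⇑(Equiv.swap 1 2 * Equiv.swap 2 3 : Equiv.Perm (Fin 4)) =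
    (x ∘ Equiv.swap 1 2) ∘ Equiv.swap 2 3 := rfl
  have e4 : ((x ∘ Equiv.swap 1 2) ∘ Equiv.swap 2 3) ∘ Equiv.swap 1 2 =
      ((x ∘ Equiv.swap 2 3) ∘ Equiv.swap 1 2) ∘ Equiv.swap 2 3 := by
    funext i; fin_cases i <;> simp [a0, a1, a2, a3, b0, b1, b2, b3]
  rw [e3, e4] at t2
  rw [e2] at k2
  rw [Equiv.Perm.coe_one, Function.comp_id] at k0 t0
  have f0 := hflip x
  have f1 := hflip (x ∘ Equiv.swap 1 2)
  have f2 := hflip ((x ∘ Equiv.swap 2 3) ∘ Equiv.swap 1 2)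
  simp only [Function.comp_apply, a0, a1, a2, a3, b0, b1, b2, b3] at k0 k1 k2
  have hk0 : Bad X EX x ∨ ∃ e, x 0 = e ∧ x 1 = e ∧ x 2 ≠ e ∧ x 3 ≠ e ∨
      x 0 ≠ e ∧ x 1 ≠ e ∧ x 2 = e ∧ x 3 = e := or_iff_not_imp_left.2 fun hb => (k0 hb).2
  have hk1 : Bad X EX (x ∘ Equiv.swap 1 2) ∨ ∃ e, x 0 = e ∧ x 2 = e ∧ x 1 ≠ e ∧ x 3 ≠ e ∨
      x 0 ≠ e ∧ x 2 ≠ e ∧ x 1 = e ∧ x 3 = e := or_iff_not_imp_left.2 fun hb => (k1 hb).2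
  have hk2 : Bad X EX ((x ∘ Equiv.swap 2 3) ∘ Equiv.swap 1 2) ∨
      ∃ e, x 0 = e ∧ x 3 = e ∧ x 1 ≠ e ∧ x 2 ≠ e ∨ x 0 ≠ e ∧ x 3 ≠ e ∧ x 1 = e ∧ x 2 = e :=
    or_iff_not_imp_left.2 fun hb => (k2 hb).2
  clear k0 k1 k2 key hbad hflip
  rcases hk0 with hb0 | ⟨e, h0⟩
  · rcases hk1 with hb1 | ⟨f, h1⟩
    · exact t0 ⟨hb0, hb1⟩
    · rcases hk2 with hb2 | ⟨g, h2⟩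
      · exact t1 ⟨f0 hb0, hb2⟩
      · grind
  · rcases hk1 with hb1 | ⟨f, h1⟩
    · rcases hk2 with hb2 | ⟨g, h2⟩
      · exact t2 ⟨f1 hb1, f2 hb2⟩
      · grind
    · grind

theorem linked (h : Min S E) (hs : Split S E X EX EY x y) (hY : 2 ≤ (S \ X).card) (hX : 2 ≤ X.card)
    (hnc : ∃ v ∈ X, 4 ≤ d E {v}) (hp : (S \ X).card = 2 → ∃ v ∈ S \ X, 4 ≤ d E {v})
    (hmin : ∀ Z, Cand S E Z → (S \ X).card ≤ Z.card) : Linked (S \ X) EY y ∧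
      4 ≤ (S \ X).card + EY.card ∧ ∃ v ∈ S \ X, 4 ≤ d E {v} := by
  rcases Nat.lt_or_ge (S \ X).card 4 with h4 | h4
  · obtain h2 | h3 : (S \ X).card = 2 ∨ (S \ X).card = 3 := by omega
    · obtain ⟨h5, h6⟩ := h.linked_two hs h2 (hp h2)
      exact ⟨h5, by omega, hp h2⟩
    · obtain ⟨h5, h6⟩ := h.linked_three hs h3
      refine ⟨h5, ?_, h6⟩
      obtain ⟨a, -, b, -, hab, hr⟩ := h5
      have := hr.card_le
      simp only [Multiset.card_add, lk, if_neg hab, Multiset.card_singleton] at this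
      omega
  · obtain ⟨h5, h6⟩ := h.linked_four hs h4 hX hnc hmin
    exact ⟨h5, by omega, h6⟩

theorem not_cand (h : Min S E) (Y : Finset V) : ¬ Cand S E Y := by
  induction hn : Y.card using Nat.strong_induction_on generalizing Y with
  | _ n ih =>
    intro hY
    have hmin : ∀ Z, Cand S E Z → Y.card ≤ Z.card := fun Z hZ => by
      by_contra hlt
      exact ih Z.card (by omega) Z rfl hZ
    have hYc : S \ (S \ Y) = Y := Finset.sdiff_sdiff_eq_self hY.sub
    obtain ⟨EX, EY, x, y, hs⟩ := exists_split h.good.supp Finset.sdiff_subset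
      (show d E (S \ Y) = 4 by rw [d_compl h.good.supp, hY.cut])
    have hl := fun σ => h.linked (hs.perm σ) (by rw [hYc]; exact hY.two) hY.two' hY.noncubic
      (by rw [hYc]; exact hY.notPair) (by rw [hYc]; exact hmin)
    rw [hYc] at hl
    have hcard := Finset.card_sdiff_add_card_eq_card hY.sub
    have h6 := h.card
    have hle := hmin (S \ Y)
      { sub := Finset.sdiff_subset
        cut := by rw [d_compl h.good.supp, hY.cut]
        two := hY.two'
        two' := by rw [hYc]; exact hY.two
        noncubic := by rw [hYc]; exact (hl 1).2.2
        notPair := fun _ => hY.noncubic }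
    refine h.not_all_linked hs (by rw [hYc]; exact fun σ => (hl σ).1) (by rw [hYc]; exact hY.two)
      (by rw [hYc]; exact (hl 1).2.1) (by omega) hY.noncubic

theorem cubic_pair_of_cut (h : Min S E) (hnc : ∃ v ∈ S, 4 ≤ d E {v}) (hX : X ⊆ S) (hd : d E X = 4)
    (h2 : 2 ≤ X.card) (h2' : 2 ≤ (S \ X).card) : (X.card = 2 ∧ ∀ v ∈ X, d E {v} = 3) ∨
      ((S \ X).card = 2 ∧ ∀ v ∈ S \ X, d E {v} = 3) := by
  have h3 : ∀ v ∈ S, d E {v} < 4 → d E {v} = 3 := fun v hv h4 => by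
    have h6 := h.card
    have := h.good.three_le (by omega) hv
    omega
  have key : ∀ X ⊆ S, d E X = 4 → 2 ≤ X.card → 2 ≤ (S \ X).card → (∃ v ∈ S \ X, 4 ≤ d E {v}) →
      X.card = 2 ∧ ∀ v ∈ X, d E {v} = 3 := by
    intro X hX hd h2 h2' hv
    by_contra hcon
    refine h.not_cand X ⟨hX, hd, h2, h2', hv, fun hc => ?_⟩
    by_contra hall
    push Not at hall
    exact hcon ⟨hc, fun v hv => h3 v (hX hv) (hall v hv)⟩
  obtain ⟨v, hv, hv4⟩ := hnc
  by_cases hvX : v ∈ X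
  · refine Or.inr (key _ Finset.sdiff_subset (by rw [d_compl h.good.supp, hd]) h2' ?_ ?_)
    · rwa [Finset.sdiff_sdiff_eq_self hX]
    · rw [Finset.sdiff_sdiff_eq_self hX]; exact ⟨v, hvX, hv4⟩
  · exact Or.inl (key X hX hd h2 h2' ⟨v, by simp [hv, hvX], hv4⟩)

end Min

theorem exists_star {E : Multiset (Sym2 V)} (hE : ∀ e ∈ E, ¬ e.IsDiag) {x l : V} (hd : d E {x} = 3)
    (hl : s(x, l) ∈ E) : ∃ x₁ x₂ R, E = s(x, l) ::ₘ s(x, x₁) ::ₘ s(x, x₂) ::ₘ R ∧ ∀ e ∈ R, x ∉ e := by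
  have hcr : ∀ e ∈ E, cr {x} e ≠ 0 ↔ x ∈ e := by
    intro e he
    have h1 := hE e he
    induction e using Sym2.ind with
    | _ u v =>
      simp only [Sym2.mk_isDiag_iff] at h1
      simp only [cr_mk, Finset.mem_singleton, Sym2.mem_iff, @eq_comm _ x]
      split_ifs <;> simp_all <;> grind
  have h1 : (E.filter fun e => x ∈ e).card = 3 := by
    rw [← hd, d_eq_card_filter, Multiset.filter_congr hcr]
  obtain ⟨F, hF⟩ := Multiset.exists_cons_of_mem
    (Multiset.mem_filter.2 ⟨hl, by simp⟩ : s(x, l) ∈ E.filter fun e => x ∈ e)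
  rw [hF, Multiset.card_cons] at h1
  obtain ⟨f₁, f₂, rfl⟩ := Multiset.card_eq_two.1 (by omega : F.card = 2)
  have hm : ∀ f ∈ E.filter (fun e => x ∈ e), ∃ w, f = s(x, w) := fun f hf =>
    (Multiset.mem_filter.1 hf).2
  obtain ⟨x₁, rfl⟩ := hm f₁ (by rw [hF]; simp)
  obtain ⟨x₂, rfl⟩ := hm f₂ (by rw [hF]; simp)
  refine ⟨x₁, x₂, E.filter fun e => ¬ x ∈ e, ?_, fun e he => (Multiset.mem_filter.1 he).2⟩
  rw [← Multiset.filter_add_not (fun e => x ∈ e) E, hF]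
  simp

theorem d_suppress {x x₁ x₂ : V} {R : Multiset (Sym2 V)} (h₁ : x₁ ≠ x) (h₂ : x₂ ≠ x)
    (hR : ∀ e ∈ R, x ∉ e) {Z : Finset V} (hZ : x ∉ Z) : d (lk x₁ x₂ + R) Z =
      d (s(x, x₁) ::ₘ s(x, x₂) ::ₘ R) (if x₁ ∈ Z then insert x Z else Z) := by
  have hRZ : d R (insert x Z) = d R Z := by
    unfold d
    congr 1
    refine Multiset.map_congr rfl fun e he => ?_
    have h := hR e he
    induction e using Sym2.ind with
    | _ u v =>
      simp only [Sym2.mem_iff, not_or] at h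
      simp [cr_mk, Ne.symm h.1, Ne.symm h.2]
  rw [d_add, d_cons, d_cons]
  have hlk : d (lk x₁ x₂) Z = if x₁ ∈ Z ↔ x₂ ∈ Z then 0 else 1 := by
    unfold lk
    split_ifs with h1 h2 <;> simp_all [cr_mk]
  rw [hlk]
  split_ifs with h1 h2 h2 <;> simp_all [cr_mk]

theorem red_suppress (x x₁ x₂ : V) (R : Multiset (Sym2 V)) :
    Red (s(x, x₁) ::ₘ s(x, x₂) ::ₘ R) (lk x₁ x₂ + R) := by
  unfold lk
  split_ifs with h
  · rw [zero_add]; exact .del (.del (.refl _))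
  · rw [Sym2.eq_swap (a := x) (b := x₁)]
    exact Red.split (.refl _)

theorem mem_lk {u v : V} {e : Sym2 V} (h : e ∈ lk u v) : u ≠ v ∧ e = s(u, v) := by
  unfold lk at h
  split_ifs at h with h1
  · simp at h
  · exact ⟨h1, by simpa using h⟩

namespace Min

variable {S : Finset V} {E : Multiset (Sym2 V)}

theorem good_of_lift (h : Min S E) (hnc : ∃ v ∈ S, 4 ≤ d E {v}) {a b : V} {F : Multiset (Sym2 V)}
    (hF : E = s(a, b) ::ₘ F) {D : Finset V} (hD : ∀ v, v = a ∨ v = b → 4 ≤ d E {v} ∨ v ∈ D)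
    {E' : Multiset (Sym2 V)} (hsupp : ∀ e ∈ E', ∀ v ∈ e, v ∈ S \ D) (hloop : ∀ e ∈ E', ¬ e.IsDiag)
    (hlift : ∀ Z ⊆ S \ D, ∃ Z' ⊆ S, Z' \ D = Z ∧ d E' Z = d F Z') : Good (S \ D) E' := by
  have h6 := h.card
  have hdF : ∀ Z, d E Z = cr Z s(a, b) + d F Z := fun Z => by rw [hF, d_cons]
  have hone : ∀ w ∈ S, w ∉ D → 3 ≤ d F {w} := by
    intro w hw hwD
    have h1 := hdF {w}
    have h2 := h.good.three_le (by omega) hw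
    by_cases hwe : w = a ∨ w = b
    · have h3 := (hD w hwe).resolve_right hwD
      have : cr {w} s(a, b) ≤ 1 := by rw [cr_mk]; split_ifs <;> omega
      omega
    · push Not at hwe
      have : cr {w} s(a, b) = 0 := by simp [cr_mk, hwe.1.symm, hwe.2.symm]
      omega
  have hcompl : ∀ Z, d F (S \ Z) = d F Z := fun Z => d_compl (fun e he => h.good.supp e (by
    rw [hF]; exact Multiset.mem_cons_of_mem he)) Z
  have hle : ∀ Z, cr Z s(a, b) ≤ 1 := fun Z => by rw [cr_mk]; split_ifs <;> omega
  refine ⟨hsupp, hloop, ?_, ?_⟩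
  · intro Z hZ hne hne'
    obtain ⟨Z', hZ', rfl, hd⟩ := hlift Z hZ
    rw [hd]
    by_cases h2 : 2 ≤ Z'.card
    · by_cases h3 : 2 ≤ (S \ Z').card
      · have := h.good.cut4 Z' hZ' h2 h3
        have := hdF Z'
        have := hle Z'
        omega
      · have : (S \ Z').Nonempty := by
          rw [Finset.sdiff_nonempty]
          exact fun hsub => hne' (by rw [Finset.Subset.antisymm hZ' hsub])
        obtain ⟨w, hw⟩ := Finset.card_eq_one.1 (by have := this.card_pos; omega : (S \ Z').card = 1)
        have hwm : w ∈ S \ Z' := by simp [hw]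
        rw [← hcompl, hw]
        refine hone w (Finset.mem_sdiff.1 hwm).1 fun hwD => hne' ?_
        ext v
        simp only [Finset.mem_sdiff]
        refine ⟨fun hv => ⟨hZ' hv.1, hv.2⟩, fun hv => ⟨?_, hv.2⟩⟩
        by_contra hvZ
        have : v ∈ S \ Z' := Finset.mem_sdiff.2 ⟨hv.1, hvZ⟩
        rw [hw, Finset.mem_singleton] at this
        exact hv.2 (this ▸ hwD)
    · obtain ⟨v, hv⟩ := hne
      have hv' := Finset.mem_sdiff.1 hv
      obtain ⟨w, rfl⟩ := Finset.card_eq_one.1 (by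
        have := Finset.card_pos.2 ⟨v, hv'.1⟩; omega : Z'.card = 1)
      rw [Finset.mem_singleton] at hv'
      exact hone w (hZ' (by simp)) (hv'.1 ▸ hv'.2)
  · intro Z hZ hc hc'
    obtain ⟨Z', hZ', rfl, hd⟩ := hlift Z hZ
    rw [hd]
    have h2 : 2 ≤ Z'.card := hc.trans (Finset.card_le_card Finset.sdiff_subset)
    have hsub : (S \ D) \ (Z' \ D) ⊆ (S \ Z') \ D := by
      intro v; simp only [Finset.mem_sdiff]; tauto
    have h3 : 2 ≤ (S \ Z').card :=
      hc'.trans (Finset.card_le_card (hsub.trans Finset.sdiff_subset))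
    have h4 := h.good.cut4 Z' hZ' h2 h3
    have h5 := hdF Z'
    have h7 := hle Z'
    rcases Nat.lt_or_ge (d E Z') 5 with h8 | h8
    · by_contra hcon
      have h9 : cr Z' s(a, b) = 1 := by omega
      have hpair : ∀ P ⊆ S, 2 ≤ (P \ D).card → P.card = 2 → (∀ v ∈ P, d E {v} = 3) →
          a ∉ P ∧ b ∉ P := by
        intro P hPS hPD hP2 hP3
        have hPD' : P \ D = P := Finset.eq_of_subset_of_card_le Finset.sdiff_subset (by omega)
        have key : ∀ v, v = a ∨ v = b → v ∉ P := fun v hv hvP => by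
          rcases hD v hv with h10 | h10
          · have := hP3 v hvP; omega
          · rw [← hPD'] at hvP; exact (Finset.mem_sdiff.1 hvP).2 h10
        exact ⟨key a (Or.inl rfl), key b (Or.inr rfl)⟩
      rcases h.cubic_pair_of_cut hnc hZ' (by omega) h2 h3 with ⟨p2, p3⟩ | ⟨p2, p3⟩
      · obtain ⟨h10, h11⟩ := hpair Z' hZ' hc p2 p3
        simp [cr_mk, h10, h11] at h9
      · obtain ⟨h10, h11⟩ := hpair (S \ Z') Finset.sdiff_subset
          (hc'.trans (Finset.card_le_card hsub)) p2 p3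
        have haS : a ∈ S := h.good.supp s(a, b) (by rw [hF]; simp) a (by simp)
        have hbS : b ∈ S := h.good.supp s(a, b) (by rw [hF]; simp) b (by simp)
        simp only [Finset.mem_sdiff, haS, hbS, true_and, not_not] at h10 h11
        simp [cr_mk, h10, h11] at h9
    · omega

end Min

theorem d_cons_singleton {u v : V} (h : u ≠ v) (F : Multiset (Sym2 V)) (w : V) :
    d (s(u, v) ::ₘ F) {w} = (if w = u ∨ w = v then 1 else 0) + d F {w} := by
  rw [d_cons, cr_mk]
  simp only [Finset.mem_singleton, @eq_comm _ w]
  congr 1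
  split_ifs <;> grind

theorem d_lk_add {x x₁ x₂ : V} (h₁ : x ≠ x₁) (h₂ : x ≠ x₂) (R : Multiset (Sym2 V)) {w : V} (hw : w ≠ x) :
    d (lk x₁ x₂ + R) {w} + (if x₁ = w ∧ x₂ = w then 2 else 0) =
      d (s(x, x₁) ::ₘ s(x, x₂) ::ₘ R) {w} := by
  rw [d_add, d_cons_singleton h₁, d_cons_singleton h₂]
  have hlk : d (lk x₁ x₂) {w} = if x₁ = w ↔ x₂ = w then 0 else 1 := by
    unfold lk
    split_ifs with h1 h2 <;> simp_all [cr_mk]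
  rw [hlk]
  split_ifs <;> grind

theorem T.exists_ne {S : Finset V} {E : Multiset (Sym2 V)} (hT : T S E) (hG : Good S E) (v : V)
    (hv : d E {v} ≤ 5) : ∃ w ∈ S, w ≠ v ∧ 4 ≤ d E {w} := by
  rcases hT with ⟨p, q, r, hC⟩ | ⟨a, b, g, c, e, hX⟩
  · have hpq : p ≠ q := hG.ne_of_count (by rw [hC.pq]; norm_num)
    have := hC.dp
    have := hC.dq
    by_cases hpv : p = v
    · exact ⟨q, hC.hq, by rw [← hpv]; exact hpq.symm, by omega⟩
    · exact ⟨p, hC.hp, hpv, by omega⟩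
  · have h1 := (hX.degrees hG.supp).2.2.2.2
    exact ⟨e, (hX.mem_iff e).2 (by simp), by rintro rfl; omega, by omega⟩

namespace Min

variable {S : Finset V} {E : Multiset (Sym2 V)}

theorem exists_chain_of_delete (h : Min S E) (hnc : ∃ v ∈ S, 4 ≤ d E {v}) {u v : V}
    {F : Multiset (Sym2 V)} (hF : E = s(u, v) ::ₘ F) (hu : 4 ≤ d E {u}) (hv : 4 ≤ d E {v})
    (hn : ∃ w ∈ S, 4 ≤ d F {w}) : ∃ p q r, Chain3 S F p q r := by
  have hmem : ∀ e ∈ F, e ∈ E := fun e he => by rw [hF]; exact Multiset.mem_cons_of_mem he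
  have hG := h.good_of_lift hnc hF (D := ∅) (by
    rintro w (rfl | rfl)
    exacts [Or.inl hu, Or.inl hv]) (E' := F)
    (fun e he w hw => by simpa using h.good.supp e (hmem e he) w hw)
    (fun e he => h.good.loopless e (hmem e he))
    (fun Z hZ => ⟨Z, by simpa using hZ, by simp, rfl⟩)
  rw [Finset.sdiff_empty] at hG
  have := h.card
  rcases h.ih S F (by rw [hF]; exact .del (.refl F)) hG (by omega) (by rw [hF]; simp) hn with
    hC | ⟨a, b, g, c, e, hX⟩
  · exact hC
  · exact absurd hX (not_exc_of_card h.card)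

theorem count_ne_two_of_five (h : Min S E) (hnc : ∃ v ∈ S, 4 ≤ d E {v}) {a b : V}
    (ha : d E {a} = 5) (hb : d E {b} = 4) : E.count s(a, b) ≠ 2 := by
  intro hab
  have hne : a ≠ b := h.good.ne_of_count (by omega)
  obtain ⟨F, hF⟩ := Multiset.exists_cons_of_mem (Multiset.count_pos.1 (by omega : 0 < E.count s(a, b)))
  have hd : ∀ w, d E {w} = (if w = a ∨ w = b then 1 else 0) + d F {w} := fun w => by
    rw [hF, d_cons_singleton hne]
  have ha' := hd a
  have hb' := hd b
  simp only [true_or, or_true, if_true] at ha' hb'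
  have haS : a ∈ S := h.good.supp s(a, b) (by rw [hF]; simp) a (by simp)
  obtain ⟨p, q, r, hC⟩ := h.exists_chain_of_delete hnc hF (by omega) (by omega) ⟨a, haS, by omega⟩
  have hcount : ∀ p q, p ≠ b → q ≠ b → E.count s(p, q) = F.count s(p, q) := fun p q h1 h2 => by
    rw [hF, Multiset.count_cons_of_ne]
    simp only [ne_eq, Sym2.eq_iff]
    tauto
  have hn : ∀ w, d F {w} = 4 → w ≠ b := by rintro w hw rfl; omega
  have h4 : ∀ w, d F {w} = 4 → w ≠ a → d E {w} = 4 := fun w hw hwa => by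
    rw [hd, hw, if_neg (by simp [hwa, hn w hw])]
  have key : ∀ p q, p ∈ S → q ∈ S → d F {p} = 4 → d F {q} = 4 → F.count s(p, q) = 2 → p ≠ a →
      q ≠ a → False := fun p q hp hq dp dq hpq hpa hqa =>
    h.no_chain_two hp hq (h4 p dp hpa) (h4 q dq hqa)
      (by rw [hcount p q (hn p dp) (hn q dq), hpq])
  have hpq : p ≠ q := by
    rintro rfl
    have := Multiset.count_le_of_le s(p, p) (by rw [hF]; exact Multiset.le_cons_self F _ : F ≤ E)
    rw [h.good.count_self, hC.pq] at this
    omega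
  by_cases hqa : q = a
  · have h1 := hcount p q (hn p hC.dp) (hn q hC.dq)
    have h2 := hcount q r (hn q hC.dq) (hn r hC.dr)
    rw [hC.pq] at h1
    rw [hC.qr] at h2
    subst hqa
    have hrq : r ≠ q := (h.good.ne_of_count (by omega : 0 < E.count s(q, r))).symm
    have := sum_count_le E (p := q) (T := {b, p, r}) (by simp [hne, hpq.symm, hrq.symm])
    rw [Finset.sum_insert (by simp [(hn p hC.dp).symm, (hn r hC.dr).symm]),
      Finset.sum_pair hC.npr, Sym2.eq_swap (a := q) (b := p)] at this
    omega
  · by_cases hpa : p = a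
    · exact key q r hC.hq hC.hr hC.dq hC.dr hC.qr hqa (by rw [← hpa]; exact hC.npr.symm)
    · exact key p q hC.hp hC.hq hC.dp hC.dq hC.pq hpa hqa

theorem count_ne_two (h : Min S E) (hnc : ∃ v ∈ S, 4 ≤ d E {v}) {a b : V} (haS : a ∈ S) (hbS : b ∈ S)
    (ha : d E {a} = 4 ∨ d E {a} = 5) (hb : d E {b} = 4 ∨ d E {b} = 5)
    (hab : d E {a} = 4 ∨ d E {b} = 4) : E.count s(a, b) ≠ 2 := by
  rcases ha with ha | ha
  · rcases hb with hb | hb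
    · exact h.no_chain_two haS hbS ha hb
    · rw [Sym2.eq_swap]; exact h.count_ne_two_of_five hnc hb ha
  · exact h.count_ne_two_of_five hnc ha (by omega)

theorem degree_of_count (h : Min S E) (hnc : ∃ v ∈ S, 4 ≤ d E {v}) {x y : V} (hx : d E {x} = 3)
    (hc : 2 ≤ E.count s(x, y)) : 2 + 2 * E.count s(x, y) ≤ d E {y} := by
  have hne : x ≠ y := h.good.ne_of_count (by omega)
  have hm := Multiset.count_pos.1 (by omega : 0 < E.count s(x, y))
  have hX : ({x, y} : Finset V) ⊆ S := by
    intro v hv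
    simp only [Finset.mem_insert, Finset.mem_singleton] at hv
    exact h.good.supp _ hm v (by simpa using hv)
  have h1 := d_pair (E := E) hne
  have h2 := Finset.card_sdiff_add_card_eq_card hX
  have h6 := h.card
  have h3 := Finset.card_pair hne
  have h4 := h.good.cut4 _ hX (by omega) (by omega)
  rcases Nat.lt_or_ge (d E {x, y}) 5 with h5 | h5
  · rcases h.cubic_pair_of_cut hnc hX (by omega) (by omega) (by omega) with h7 | h7
    · have := h7.2 y (by simp)
      omega
    · omega
  · omega

theorem suppress (h : Min S E) (hnc : ∃ v ∈ S, 4 ≤ d E {v}) {x l x₁ x₂ : V} {R : Multiset (Sym2 V)}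
    (hE : E = s(x, l) ::ₘ s(x, x₁) ::ₘ s(x, x₂) ::ₘ R) (hR : ∀ e ∈ R, x ∉ e) (hl : 4 ≤ d E {l}) :
    Good (S \ {x}) (lk x₁ x₂ + R) := by
  have hm : ∀ y, s(x, y) ∈ E → x ≠ y := fun y hy =>
    h.good.ne_of_count (Multiset.count_pos.2 hy)
  have h₁ : x ≠ x₁ := hm x₁ (by rw [hE]; simp)
  have h₂ : x ≠ x₂ := hm x₂ (by rw [hE]; simp)
  have hxS : x ∈ S := h.good.supp s(x, l) (by rw [hE]; simp) x (by simp)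
  refine h.good_of_lift hnc hE ?_ ?_ ?_ fun Z hZ => ?_
  · rintro v (rfl | rfl)
    · right; simp
    · left; exact hl
  · intro e he v hv
    rw [Finset.mem_sdiff, Finset.mem_singleton]
    rcases Multiset.mem_add.1 he with he | he
    · obtain ⟨-, rfl⟩ := mem_lk he
      rcases Sym2.mem_iff.1 hv with rfl | rfl
      · exact ⟨h.good.supp s(x, v) (by rw [hE]; simp) v (by simp), h₁.symm⟩
      · exact ⟨h.good.supp s(x, v) (by rw [hE]; simp) v (by simp), h₂.symm⟩
    · exact ⟨h.good.supp e (by rw [hE]; simp [he]) v hv, by rintro rfl; exact hR e he hv⟩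
  · intro e he
    rcases Multiset.mem_add.1 he with he | he
    · obtain ⟨hne, rfl⟩ := mem_lk he
      simpa using hne
    · exact h.good.loopless e (by rw [hE]; simp [he])
  · have hxZ : x ∉ Z := fun hx => by simpa using hZ hx
    refine ⟨if x₁ ∈ Z then insert x Z else Z, ?_, ?_, d_suppress h₁.symm h₂.symm hR hxZ⟩
    · have := hZ.trans Finset.sdiff_subset
      split_ifs
      · exact Finset.insert_subset hxS this
      · exact this
    · split_ifs
      · ext v; simp only [Finset.mem_sdiff, Finset.mem_insert, Finset.mem_singleton]
        grind
      · ext v; simp only [Finset.mem_sdiff, Finset.mem_singleton]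
        grind

theorem d_suppressed (h : Min S E) {x l x₁ x₂ : V} {R : Multiset (Sym2 V)}
    (hE : E = s(x, l) ::ₘ s(x, x₁) ::ₘ s(x, x₂) ::ₘ R) {w : V} (hw : w ≠ x) :
    d E {w} = d (lk x₁ x₂ + R) {w} + (if w = l then 1 else 0) +
      (if x₁ = w ∧ x₂ = w then 2 else 0) := by
  have hm : ∀ y, s(x, y) ∈ E → x ≠ y := fun y hy =>
    h.good.ne_of_count (Multiset.count_pos.2 hy)
  have h₁ : x ≠ x₁ := hm x₁ (by rw [hE]; simp)
  have h₂ : x ≠ x₂ := hm x₂ (by rw [hE]; simp)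
  have hl : x ≠ l := hm l (by rw [hE]; simp)
  rw [add_right_comm, d_lk_add h₁ h₂ R hw, hE, d_cons_singleton hl]
  simp [hw, add_comm]

theorem T_suppress (h : Min S E) (hnc : ∃ v ∈ S, 4 ≤ d E {v}) {x l x₁ x₂ : V} {R : Multiset (Sym2 V)}
    (hE : E = s(x, l) ::ₘ s(x, x₁) ::ₘ s(x, x₂) ::ₘ R) (hR : ∀ e ∈ R, x ∉ e) (hl : 4 ≤ d E {l})
    (hn : ∃ w ∈ S \ {x}, 4 ≤ d (lk x₁ x₂ + R) {w}) : T (S \ {x}) (lk x₁ x₂ + R) := by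
  have hxS : x ∈ S := h.good.supp s(x, l) (by rw [hE]; simp) x (by simp)
  have hc : (S \ {x}).card + 1 = S.card := by
    have := Finset.card_sdiff_add_card_eq_card (Finset.singleton_subset_iff.2 hxS)
    simpa using this
  have := h.card
  refine h.of_card_lt ?_ (h.suppress hnc hE hR hl) (by omega) (by omega) hn
  rw [hE]
  exact .del (red_suppress x x₁ x₂ R)

theorem exists_noncubic_of_delete (h : Min S E) (hnc : ∃ v ∈ S, 4 ≤ d E {v}) {u v : V}
    {F : Multiset (Sym2 V)} (hF : E = s(u, v) ::ₘ F) (hu : 4 ≤ d E {u}) (hv : 4 ≤ d E {v}) :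
    ∃ w ∈ S, 4 ≤ d F {w} := by
  by_contra! hcon
  have hne : u ≠ v := h.good.ne_of_count (Multiset.count_pos.2 (by rw [hF]; simp))
  have hd : ∀ w, d E {w} = (if w = u ∨ w = v then 1 else 0) + d F {w} := fun w => by
    rw [hF, d_cons_singleton hne]
  have huS : u ∈ S := h.good.supp s(u, v) (by rw [hF]; simp) u (by simp)
  have hvS : v ∈ S := h.good.supp s(u, v) (by rw [hF]; simp) v (by simp)
  have h6 := h.card
  have hu' := hd u
  have hv' := hd v
  simp only [true_or, or_true, if_true] at hu' hv'
  have := hcon u huS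
  have := hcon v hvS
  have h4 : ∀ w ∈ S, d E {w} ≤ 4 := fun w hw => by
    have := hd w
    have := hcon w hw
    split_ifs at * <;> omega
  have hX : ({u, v} : Finset V) ⊆ S := by
    intro w hw
    simp only [Finset.mem_insert, Finset.mem_singleton] at hw
    rcases hw with rfl | rfl <;> assumption
  have h1 := d_pair (E := E) hne
  have h2 := Finset.card_sdiff_add_card_eq_card hX
  have h3 := Finset.card_pair hne
  have h5 := h.good.cut4 _ hX (by omega) (by omega)
  obtain ⟨u', hu'm, x, hx, hux⟩ : ∃ u' ∈ ({u} : Finset V), ∃ x ∈ S \ {u, v}, s(u', x) ∈ E := by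
    apply exists_of_ee_pos
    have h7 := d_union (E := E) (A := {u}) (B := S \ {u, v}) (by simp)
    have h8 : ({u} : Finset V) ∪ S \ {u, v} = S \ {v} := by
      ext w; simp only [Finset.mem_union, Finset.mem_sdiff, Finset.mem_insert, Finset.mem_singleton]
      grind
    rw [h8, d_compl h.good.supp, d_compl h.good.supp] at h7
    omega
  rw [Finset.mem_singleton] at hu'm
  subst hu'm
  simp only [Finset.mem_sdiff, Finset.mem_insert, Finset.mem_singleton, not_or] at hx
  have hx3 : d E {x} = 3 := by
    have := h.good.three_le (by omega) hx.1
    have := hcon x hx.1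
    have h7 := hd x
    rw [if_neg (by tauto)] at h7
    omega
  obtain ⟨x₁, x₂, R, hE, hR⟩ := exists_star h.good.loopless hx3 (by rw [Sym2.eq_swap]; exact hux)
  have hx12 : x₁ ≠ x₂ := by
    rintro rfl
    have h9 : 2 ≤ E.count s(x, x₁) := by
      rw [hE]
      refine le_trans ?_ (Multiset.count_le_count_cons _ _ _)
      simp
    have := h.degree_of_count hnc hx3 h9
    have := h4 x₁ (h.good.supp s(x, x₁) (by rw [hE]; simp) x₁ (by simp))
    omega
  have hds : ∀ w, w ≠ x → d E {w} = d (lk x₁ x₂ + R) {w} + (if w = u' then 1 else 0) := fun w hw => by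
    rw [h.d_suppressed hE hw, if_neg (c := x₁ = w ∧ x₂ = w) (by rintro ⟨rfl, rfl⟩; exact hx12 rfl)]
    simp
  have hdv := hds v (Ne.symm hx.2.2)
  rw [if_neg hne.symm] at hdv
  have hG := h.suppress hnc hE hR hu
  obtain ⟨w, hw, hwv, hw4⟩ := (h.T_suppress hnc hE hR hu
    ⟨v, by simpa using ⟨hvS, Ne.symm hx.2.2⟩, by omega⟩).exists_ne hG v (by omega)
  simp only [Finset.mem_sdiff, Finset.mem_singleton] at hw
  have h10 := hds w hw.2
  have h11 := hd w
  have h12 := hcon w hw.1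
  have h13 := h4 w hw.1
  split_ifs at h10 h11 <;> first | omega | grind

theorem count_eq_zero (h : Min S E) (hnc : ∃ v ∈ S, 4 ≤ d E {v}) {u v : V} (hu : 4 ≤ d E {u})
    (hv : 4 ≤ d E {v}) : E.count s(u, v) = 0 := by
  by_contra hcon
  have hne : u ≠ v := h.good.ne_of_count (by omega)
  obtain ⟨F, hF⟩ := Multiset.exists_cons_of_mem (Multiset.count_pos.1 (by omega : 0 < E.count s(u, v)))
  have hd : ∀ w, d E {w} = (if w = u ∨ w = v then 1 else 0) + d F {w} := fun w => by
    rw [hF, d_cons_singleton hne]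
  obtain ⟨p, q, r, hC⟩ := h.exists_chain_of_delete hnc hF hu hv (h.exists_noncubic_of_delete hnc hF hu hv)
  have key : ∀ p q, p ∈ S → q ∈ S → d F {p} = 4 → d F {q} = 4 → F.count s(p, q) = 2 →
      s(p, q) ≠ s(u, v) → False := fun p q hp hq dp dq hpq hn => by
    have hc : E.count s(p, q) = 2 := by rw [hF, Multiset.count_cons_of_ne hn, hpq]
    have hpq : p ≠ q := h.good.ne_of_count (by omega)
    have h1 := hd p
    have h2 := hd q
    refine h.count_ne_two hnc hp hq ?_ ?_ ?_ hc
    · split_ifs at h1 <;> omega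
    · split_ifs at h2 <;> omega
    · simp only [ne_eq, Sym2.eq_iff] at hn
      split_ifs at h1 h2 <;> first | omega | grind
  by_cases hpq : s(p, q) = s(u, v)
  · refine key q r hC.hq hC.hr hC.dq hC.dr hC.qr fun hqr => hC.npr ?_
    rw [← hqr, Sym2.eq_swap] at hpq
    exact Sym2.congr_right.1 hpq
  · exact key p q hC.hp hC.hq hC.dp hC.dq hC.pq hpq

end Min

theorem w4In_of_near_exc {E : Multiset (Sym2 V)} {a b g c e x : V} (hnd : [a, b, g, c, e, x].Nodup)
    (hbc : 1 ≤ E.count s(b, c)) (hbe : 2 ≤ E.count s(b, e)) (hgc : 1 ≤ E.count s(g, c))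
    (hge : 2 ≤ E.count s(g, e))
    (h : (1 ≤ E.count s(a, c) ∧ 1 ≤ E.count s(a, e) ∧
        ((1 ≤ E.count s(a, x) ∧ 1 ≤ E.count s(e, x) ∧ 1 ≤ E.count s(c, x)) ∨
          (1 ≤ E.count s(a, x) ∧ 2 ≤ E.count s(e, x)))) ∨
      (2 ≤ E.count s(a, e) ∧ 1 ≤ E.count s(a, x) ∧ 1 ≤ E.count s(c, x) ∧ 1 ≤ E.count s(e, x)) ∨
      (1 ≤ E.count s(a, c) ∧ 2 ≤ E.count s(a, e) ∧
        ((2 ≤ E.count s(e, x) ∧ 1 ≤ E.count s(c, x)) ∨ 3 ≤ E.count s(e, x)))) : W4In E := by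
  obtain ⟨φ, hφ, -, hφe⟩ := exists_labelling hnd a
  obtain rfl : φ 0 = a := hφe 0
  obtain rfl : φ 1 = b := hφe 1
  obtain rfl : φ 2 = g := hφe 2
  obtain rfl : φ 3 = c := hφe 3
  obtain rfl : φ 4 = e := hφe 4
  obtain rfl : φ 5 = x := hφe 5
  have key : ∀ {h0 a b g e : ℕ} (_ : [h0, a, b, g, e].Nodup) (_ : ∀ i ∈ [h0, a, b, g, e], i < 6)
      {dem : List (ℕ × ℕ)} (_ : dem.Perm (wheel (h0, a, b, g, e))) {x : ℕ}
      (_ : route (List.range 6) 4 dem x = true)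
      (_ : ∀ v < 6, ∀ u < v, x / 16 ^ (v * (v - 1) / 2 + u) % 16 ≤ E.count s(φ u, φ v)), W4In E :=
    fun hnd hlt _ hp _ hr hE =>
      w4In_of_route (n := 6) (by norm_num) hφ (by simp) hnd hlt hp hr (dom_of_count fun v hv u hu => by
        have h1 : idx u v = v * (v - 1) / 2 + u := by
          rw [idx, show Nat.blt u v = true by rwa [Nat.blt_eq]]; rfl
        rw [nth_eq, h1]
        exact hE v hv u hu)
  rcases h with ⟨h1, h2, ⟨h3, h4, h5⟩ | ⟨h3, h4⟩⟩ | ⟨h1, h2, h3, h4⟩ | ⟨h1, h2, ⟨h3, h4⟩ | h3⟩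
  · refine key (h0 := 3) (a := 5) (b := 0) (g := 2) (e := 1) (by decide) (by decide)
      (dem := [(3, 5), (3, 0), (3, 2), (3, 1), (5, 0), (0, 2), (2, 1), (1, 5)]) (by decide)
      (x := 76562302321627136) (by decide +kernel) fun v hv u hu => ?_
    interval_cases v <;> interval_cases u <;> norm_num <;> assumption
  · refine key (h0 := 4) (a := 5) (b := 0) (g := 3) (e := 2) (by decide) (by decide)
      (dem := [(4, 5), (4, 0), (4, 2), (5, 0), (0, 3), (3, 2), (4, 3), (2, 5)]) (by decide)
      (x := 144116296732184576) (by decide +kernel) fun v hv u hu => ?_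
    interval_cases v <;> interval_cases u <;> norm_num <;> assumption
  · refine key (h0 := 4) (a := 0) (b := 5) (g := 3) (e := 2) (by decide) (by decide)
      (dem := [(4, 0), (4, 5), (4, 2), (0, 5), (5, 3), (3, 2), (4, 3), (2, 0)]) (by decide)
      (x := 76562302338400256) (by decide +kernel) fun v hv u hu => ?_
    interval_cases v <;> interval_cases u <;> norm_num <;> assumption
  · refine key (h0 := 3) (a := 2) (b := 1) (g := 0) (e := 4) (by decide) (by decide)
      (dem := [(3, 2), (3, 1), (3, 0), (0, 4), (4, 2), (3, 4), (2, 1), (1, 0)]) (by decide)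
      (x := 148618796864704512) (by decide +kernel) fun v hv u hu => ?_
    interval_cases v <;> interval_cases u <;> norm_num <;> assumption
  · refine key (h0 := 4) (a := 3) (b := 2) (g := 5) (e := 1) (by decide) (by decide)
      (dem := [(4, 2), (4, 5), (4, 1), (3, 2), (1, 3), (4, 3), (2, 5), (5, 1)]) (by decide)
      (x := 216172791275261952) (by decide +kernel) fun v hv u hu => ?_
    interval_cases v <;> interval_cases u <;> norm_num <;> assumption

namespace Min

variable {S : Finset V} {E : Multiset (Sym2 V)}

theorem not_exc_suppress (h : Min S E) (hnc : ∃ v ∈ S, 4 ≤ d E {v}) {x l x₁ x₂ : V}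
    {R : Multiset (Sym2 V)} (hE : E = s(x, l) ::ₘ s(x, x₁) ::ₘ s(x, x₂) ::ₘ R)
    (hR : ∀ e ∈ R, x ∉ e) (hx : d E {x} = 3) (hl : 4 ≤ d E {l}) {a b g c e : V}
    (hX : Exc (S \ {x}) (lk x₁ x₂ + R) a b g c e)
    (hgc : (lk x₁ x₂ + R).count s(g, c) = 1) : False := by
  have hG := h.suppress hnc hE hR hl
  have hxe : ∀ y, s(x, y) ∈ E → y = a ∨ y = b ∨ y = g ∨ y = c ∨ y = e := fun y hy => by
    rw [← hX.mem_iff, Finset.mem_sdiff, Finset.mem_singleton]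
    exact ⟨h.good.supp _ hy y (by simp), (h.good.ne_of_count (Multiset.count_pos.2 hy)).symm⟩
  have hlS := hxe l (by rw [hE]; simp)
  have h1S := hxe x₁ (by rw [hE]; simp)
  have h2S := hxe x₂ (by rw [hE]; simp)
  have hxn : x ∉ [a, b, g, c, e] := fun hm => by
    have := (hX.mem_iff x).2 (by simpa using hm)
    simp at this
  have hds : ∀ w ∈ [a, b, g, c, e], d E {w} = d (lk x₁ x₂ + R) {w} + (if w = l then 1 else 0) +
      (if x₁ = w ∧ x₂ = w then 2 else 0) := fun w hw =>
    h.d_suppressed hE (by rintro rfl; exact hxn hw)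
  have hcx : ∀ y, E.count s(x, y) = (if y = l then 1 else 0) + (if y = x₁ then 1 else 0) +
      (if y = x₂ then 1 else 0) := fun y => by
    rw [hE, Multiset.count_cons, Multiset.count_cons, Multiset.count_cons,
      Multiset.count_eq_zero.2 fun hm => hR _ hm (by simp)]
    simp only [Sym2.congr_right]
    omega
  have hcE : ∀ p ∈ [a, b, g, c, e], ∀ q ∈ [a, b, g, c, e], (lk x₁ x₂ + R).count s(p, q) =
      E.count s(p, q) + (lk x₁ x₂).count s(p, q) := fun p hp q hq => by
    have hn : ∀ y, s(p, q) ≠ s(x, y) := fun y hy => by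
      have : x ∈ s(p, q) := by rw [hy]; simp
      rcases Sym2.mem_iff.1 this with rfl | rfl
      exacts [hxn hp, hxn hq]
    rw [hE, Multiset.count_cons_of_ne (hn _), Multiset.count_cons_of_ne (hn _),
      Multiset.count_cons_of_ne (hn _), Multiset.count_add, add_comm]
  have hlk : ∀ p q, (lk x₁ x₂).count s(p, q) =
      if x₁ ≠ x₂ ∧ ((p = x₁ ∧ q = x₂) ∨ (p = x₂ ∧ q = x₁)) then 1 else 0 := fun p q => by
    unfold lk
    by_cases h12 : x₁ = x₂
    · simp [h12]
    · simp [h12, Multiset.count_singleton]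
  obtain ⟨da, db, dg, dc, de⟩ := hX.degrees hG.supp
  rw [hgc] at dg dc
  have hnd := hX.nodup
  have hdeg := fun y => h.degree_of_count hnc (y := y) hx
  have hce : c ≠ e := by rintro rfl; simp at hnd
  have hc' : ∀ α ∈ [a, b, g], (lk x₁ x₂ + R).count s(α, c) = 1 ∧ (lk x₁ x₂ + R).count s(α, e) = 2 ∧
      d (lk x₁ x₂ + R) {α} = 3 ∧ α ∈ [a, b, g, c, e] ∧ α ≠ c ∧ α ≠ e := by
    intro α hα
    simp only [List.mem_cons, List.not_mem_nil, or_false] at hα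
    simp only [List.nodup_cons, List.mem_cons, List.not_mem_nil, or_false, not_or] at hnd
    rcases hα with rfl | rfl | rfl
    · exact ⟨hX.ac, hX.ae, da, by simp, hnd.1.2.2.1, hnd.1.2.2.2⟩
    · exact ⟨hX.bc, hX.be, db, by simp, hnd.2.1.2.1, hnd.2.1.2.2⟩
    · exact ⟨hgc, hX.ge, by omega, by simp, hnd.2.2.1.1, hnd.2.2.1.2⟩
  have he := hds e (by simp)
  have hα : ∀ α ∈ [a, b, g], l ≠ α ∧ ¬ (x₁ = α ∧ x₂ = α) := fun α hα => by
    obtain ⟨-, h2, h3, h4, -, -⟩ := hc' α hα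
    have h5 := hcE α h4 e (by simp)
    have h6 := hlk α e
    have h7 := hds α h4
    have h8 : d E {α} < 4 := by
      by_contra hcon
      have := h.count_eq_zero hnc (u := α) (v := e) (by omega) (by omega)
      split_ifs at h6 <;> omega
    refine ⟨by rintro rfl; omega, fun h9 => ?_⟩
    rw [if_pos h9] at h7
    omega
  have key : ∀ α β γ, [α, β, γ, c, e, x].Nodup → α ∈ [a, b, g] → β ∈ [a, b, g] → γ ∈ [a, b, g] →
      (x₁ = α ∨ x₁ = c ∨ x₁ = e) → (x₂ = α ∨ x₂ = c ∨ x₂ = e) → False := by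
    intro α β γ hnd' hα1 hβ hγ h1 h2
    have hle : l = c ∨ l = e := by
      rcases hlS with h | h | h | h
      exacts [absurd h (hα a (by simp)).1, absurd h (hα b (by simp)).1, absurd h (hα g (by simp)).1, h]
    obtain ⟨a1, a2, a3, a4, ac, ae⟩ := hc' α hα1
    obtain ⟨b1, b2, b3, b4, bc, be⟩ := hc' β hβ
    obtain ⟨g1, g2, g3, g4, gc, ge⟩ := hc' γ hγ
    rw [hcE α a4 c (by simp), hlk] at a1
    rw [hcE α a4 e (by simp), hlk] at a2
    rw [hcE β b4 c (by simp), hlk] at b1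
    rw [hcE β b4 e (by simp), hlk] at b2
    rw [hcE γ g4 c (by simp), hlk] at g1
    rw [hcE γ g4 e (by simp), hlk] at g2
    have hce0 := hX.ce
    rw [hcE c (by simp) e (by simp), hlk] at hce0
    have xa := hcx α
    have xc := hcx c
    have xe := hcx e
    have hdc := hds c (by simp)
    have hαl := (hα α hα1)
    have hdc' := hdeg c
    have hnd2 := hnd'
    simp only [List.nodup_cons, List.mem_cons, List.not_mem_nil, or_false, not_or] at hnd2
    obtain ⟨⟨n1, n2, -, -, -⟩, ⟨n3, -, -, -⟩, -⟩ := hnd2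
    have hβγ : ∀ δ w, δ ≠ α → δ ≠ c → δ ≠ e →
        ¬ (x₁ ≠ x₂ ∧ ((δ = x₁ ∧ w = x₂) ∨ (δ = x₂ ∧ w = x₁))) := fun δ w m1 m2 m3 => by
      rintro ⟨-, ⟨rfl, -⟩ | ⟨rfl, -⟩⟩
      · rcases h1 with h1 | h1 | h1 <;> contradiction
      · rcases h2 with h2 | h2 | h2 <;> contradiction
    rw [if_neg (hβγ β _ (Ne.symm n1) bc be)] at b1 b2
    rw [if_neg (hβγ γ _ (Ne.symm n2) gc ge)] at g1 g2
    refine h.noW (w4In_of_near_exc hnd' (by omega) (by omega) (by omega) (by omega) ?_)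
    · rw [Sym2.eq_swap (a := α) (b := x), Sym2.eq_swap (a := c) (b := x), Sym2.eq_swap (a := e) (b := x)]
      clear hc' hα hX hG hds hxn hcx hcE hlk hdeg hxe h1S h2S hlS hE hnd hnd' hβγ
      rcases h1 with rfl | rfl | rfl <;> rcases h2 with rfl | rfl | rfl <;> rcases hle with rfl | rfl <;>
        simp only [ac, ae, hce, ac.symm, ae.symm, hce.symm, ne_eq, not_true, not_false_eq_true, if_true,
          if_false, and_true, and_false, or_false, or_true,
          and_self, or_self] at a1 a2 hce0 xa xc xe hdc hαl <;> omega
  have h0 : ∀ p q, (p = a ∨ p = b ∨ p = g) → (q = a ∨ q = b ∨ q = g) →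
      (lk x₁ x₂ + R).count s(p, q) = 0 := by
    have hab := hX.ab
    have hag := hX.ag
    have hbg := hX.bg
    intro p q hp hq
    rcases hp with hp | hp | hp <;> rcases hq with hq | hq | hq <;> rw [hp, hq] <;>
      first
        | assumption
        | (rw [Sym2.eq_swap]; assumption)
        | exact hG.count_self _
  have hin : ∀ p q, (p = a ∨ p = b ∨ p = g) → (q = a ∨ q = b ∨ q = g) → x₁ = p → x₂ = q → False := by
    rintro p q hp hq rfl rfl
    have h12 : x₁ ≠ x₂ := fun h12 => (hα x₁ (by simpa using hp)).2 ⟨rfl, h12.symm⟩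
    have h5 := h0 x₁ x₂ hp hq
    rw [Multiset.count_add, hlk, if_pos ⟨h12, by simp⟩] at h5
    omega
  have ha6 : [a, b, g, c, e, x].Nodup :=
    (List.nodup_middle (l₁ := [a, b, g, c, e]) (l₂ := [])).2 (List.nodup_cons.2 ⟨hxn, hnd⟩)
  have hb6 : [b, a, g, c, e, x].Nodup := (List.Perm.swap b a _).nodup ha6
  have hg6 : [g, a, b, c, e, x].Nodup := (List.perm_middle (l₁ := [a, b])).nodup ha6
  have ka := key a b g ha6 (by simp) (by simp) (by simp)
  have kb := key b a g hb6 (by simp) (by simp) (by simp)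
  have kg := key g a b hg6 (by simp) (by simp) (by simp)
  rcases h1S with m | m | m | m
  · exact ka (.inl m) (by
      rcases h2S with k | k | k | k
      exacts [.inl k, (hin a b (by simp) (by simp) m k).elim, (hin a g (by simp) (by simp) m k).elim,
        .inr k])
  · exact kb (.inl m) (by
      rcases h2S with k | k | k | k
      exacts [(hin b a (by simp) (by simp) m k).elim, .inl k, (hin b g (by simp) (by simp) m k).elim,
        .inr k])
  · exact kg (.inl m) (by
      rcases h2S with k | k | k | k
      exacts [(hin g a (by simp) (by simp) m k).elim, (hin g b (by simp) (by simp) m k).elim, .inl k,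
        .inr k])
  · rcases h2S with k | k | k | k
    exacts [ka (.inr m) (.inl k), kb (.inr m) (.inl k), kg (.inr m) (.inl k), ka (.inr m) (.inr k)]

theorem adj_unique (h : Min S E) (hnc : ∃ v ∈ S, 4 ≤ d E {v}) {x l : V} (hx : d E {x} = 3)
    (hl : 4 ≤ d E {l}) (hxl : s(x, l) ∈ E) : d E {l} = 4 ∧ ∀ w ∈ S, 4 ≤ d E {w} → w = l := by
  obtain ⟨x₁, x₂, R, hE, hR⟩ := exists_star h.good.loopless hx hxl
  by_contra hcon
  have hlS := h.good.supp _ hxl l (by simp)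
  have hxS := h.good.supp _ hxl x (by simp)
  have hloop : ∀ y, x₁ = y ∧ x₂ = y → 6 + (if y = l then 2 else 0) ≤ d E {y} := by
    rintro y ⟨h1, h2⟩
    have h3 : 2 + (if y = l then 1 else 0) ≤ E.count s(x, y) := by
      rw [hE, h1, h2, Multiset.count_cons, Multiset.count_cons_self, Multiset.count_cons_self]
      simp only [Sym2.congr_right]
      omega
    have := h.degree_of_count hnc hx (y := y) (by omega)
    split_ifs at * <;> omega
  have hds : ∀ w, w ≠ x → _ := fun w hw => h.d_suppressed hE hw
  have hn : ∃ w ∈ S \ {x}, 4 ≤ d (lk x₁ x₂ + R) {w} := by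
    obtain ⟨w, hw, hw4⟩ : ∃ w ∈ S, 4 + (if w = l then 1 else 0) ≤ d E {w} := by
      by_cases h5 : d E {l} = 4
      · simp only [h5, true_and, not_forall] at hcon
        obtain ⟨w, hw, hw4, hne⟩ := hcon
        exact ⟨w, hw, by rw [if_neg hne]; omega⟩
      · exact ⟨l, hlS, by rw [if_pos rfl]; omega⟩
    have hwx : w ≠ x := by rintro rfl; omega
    refine ⟨w, by simp [hw, hwx], ?_⟩
    have h1 := hds w hwx
    have h2 := hloop w
    split_ifs at * <;> first | omega | grind
  have hG := h.suppress hnc hE hR hl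
  have hcount : ∀ p ∈ S \ {x}, ∀ q ∈ S \ {x}, 4 ≤ d (lk x₁ x₂ + R) {p} → 4 ≤ d (lk x₁ x₂ + R) {q} →
      (lk x₁ x₂ + R).count s(p, q) ≤ 1 := by
    intro p hp q hq hp4 hq4
    simp only [Finset.mem_sdiff, Finset.mem_singleton] at hp hq
    have h1 := hds p hp.2
    have h2 := hds q hq.2
    have h3 := h.count_eq_zero hnc (u := p) (v := q) (by omega) (by omega)
    have h4 : R.count s(p, q) ≤ E.count s(p, q) := Multiset.count_le_of_le _ (by
      rw [hE]
      exact ((Multiset.le_cons_self _ _).trans (Multiset.le_cons_self _ _)).trans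
        (Multiset.le_cons_self _ _))
    have h5 : (lk x₁ x₂).count s(p, q) ≤ 1 := by
      unfold lk
      split_ifs
      · simp
      · rw [Multiset.count_singleton]; split_ifs <;> simp
    rw [Multiset.count_add]
    omega
  rcases h.T_suppress hnc hE hR hl hn with ⟨p, q, r, hC⟩ | ⟨a, b, g, c, e, hX⟩
  · have := hcount p hC.hp q hC.hq (by rw [hC.dp]) (by rw [hC.dq])
    rw [hC.pq] at this
    omega
  · rcases hX.gc with hgc | hgc
    · exact h.not_exc_suppress hnc hE hR hx hl hX hgc
    · obtain ⟨-, -, dg, dc, -⟩ := hX.degrees hG.supp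
      have := hcount g ((hX.mem_iff g).2 (by simp)) c ((hX.mem_iff c).2 (by simp)) (by omega) (by omega)
      omega

end Min

theorem sum_d_singleton {S : Finset V} {E : Multiset (Sym2 V)} (hS : ∀ e ∈ E, ∀ v ∈ e, v ∈ S)
    (hE : ∀ e ∈ E, ¬ e.IsDiag) : ∑ v ∈ S, d E {v} = 2 * E.card := by
  induction E using Multiset.induction_on with
  | empty => simp
  | cons e E ih =>
    have ih' := ih (fun f hf => hS f (Multiset.mem_cons_of_mem hf))
      (fun f hf => hE f (Multiset.mem_cons_of_mem hf))
    have h1 := hS e (Multiset.mem_cons_self e E)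
    have h2 := hE e (Multiset.mem_cons_self e E)
    induction e using Sym2.ind with
    | _ u v =>
      rw [Sym2.mk_isDiag_iff] at h2
      have hu := h1 u (by simp)
      have hv := h1 v (by simp)
      have h3 : S.filter (fun w => w = u ∨ w = v) = {u, v} := by
        ext w; simp only [Finset.mem_filter, Finset.mem_insert, Finset.mem_singleton]
        grind
      simp_rw [d_cons_singleton h2]
      rw [Finset.sum_add_distrib, ih', ← Finset.card_filter, h3, Finset.card_pair h2,
        Multiset.card_cons]
      ring

namespace Min

variable {S : Finset V} {E : Multiset (Sym2 V)}

theorem exists_adj (h : Min S E) {v : V} (hv : v ∈ S) : ∃ w, s(v, w) ∈ E := by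
  have h3 := h.good.three_le (by have := h.card; omega) hv
  by_contra! hcon
  have : d E {v} = 0 := by
    refine d_eq_zero_of_supp (A := S \ {v}) (fun e he w hw => ?_) (.inl (by simp))
    rw [Finset.mem_sdiff, Finset.mem_singleton]
    refine ⟨h.good.supp e he w hw, ?_⟩
    rintro rfl
    obtain ⟨y, rfl⟩ := hw
    exact hcon y he
  omega

/-- Suppressing both ends of an edge joining two vertices of degree three. -/
theorem cubic_adj (h : Min S E) (hnc : ∃ v ∈ S, 4 ≤ d E {v}) (h7 : 7 ≤ S.card) {l : V}
    (hl : d E {l} = 4) (huniq : ∀ w ∈ S, 4 ≤ d E {w} → w = l) {x x' : V} (hxl : x ≠ l) (hxl' : x' ≠ l) :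
    s(x, x') ∉ E := by
  intro hxx
  have h6 := h.card
  have hxS := h.good.supp _ hxx x (by simp)
  have hxS' := h.good.supp _ hxx x' (by simp)
  have hle : ∀ w ∈ S, d E {w} ≤ 4 := fun w hw => by
    by_contra hcon
    rw [huniq w hw (by omega)] at hcon
    omega
  have h3 : ∀ w ∈ S, w ≠ l → d E {w} = 3 := fun w hw hwl => by
    have := h.good.three_le (by omega) hw
    by_contra hcon
    exact hwl (huniq w hw (by omega))
  have hsimple : ∀ u ∈ S, u ≠ l → ∀ w, E.count s(u, w) ≤ 1 := fun u hu hul w => by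
    by_contra hcon
    have h8 := h.degree_of_count hnc (h3 u hu hul) (y := w) (by omega)
    have h9 := hle w (h.good.supp s(u, w) (Multiset.count_pos.1 (by omega)) w (by simp))
    omega
  have hne : x ≠ x' := h.good.ne_of_count (Multiset.count_pos.2 hxx)
  obtain ⟨x₁, x₂, R, hE, hR⟩ := exists_star h.good.loopless (h3 x hxS hxl) hxx
  have hcx := hsimple x hxS hxl
  have hx1 : x₁ ≠ x' := by
    rintro rfl
    have := hcx x₁
    rw [hE, Multiset.count_cons_self, Multiset.count_cons_self] at this
    omega
  have hx2 : x₂ ≠ x' := by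
    rintro rfl
    have := hcx x₂
    rw [hE, Multiset.count_cons_self, Multiset.count_cons, Multiset.count_cons_self] at this
    omega
  have hx12 : x₁ ≠ x₂ := by
    rintro rfl
    have := hcx x₁
    rw [hE, Multiset.count_cons, Multiset.count_cons_self, Multiset.count_cons_self] at this
    omega
  have hm : ∀ u w, s(u, w) ∈ E → u ≠ w := fun u w hw => h.good.ne_of_count (Multiset.count_pos.2 hw)
  have hxx1 : x ≠ x₁ := hm x x₁ (by rw [hE]; simp)
  have hxx2 : x ≠ x₂ := hm x x₂ (by rw [hE]; simp)
  obtain ⟨y₁, y₂, R₂, hE₂, hR₂⟩ := exists_star (E := s(x', x) ::ₘ R) (x := x') (l := x)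
    (fun e he => by
      rcases Multiset.mem_cons.1 he with rfl | he
      · simpa using hne.symm
      · exact h.good.loopless e (by rw [hE]; simp [he]))
    (by
      have := h3 x' hxS' hxl'
      rw [hE, d_cons_singleton hne, d_cons_singleton hxx1, d_cons_singleton hxx2] at this
      rw [d_cons_singleton hne.symm]
      simpa [hne.symm, hx1.symm, hx2.symm] using this) (by simp)
  rw [Multiset.cons_inj_right] at hE₂
  subst hE₂
  have hy1 : x ≠ y₁ := by rintro rfl; exact hR s(x', x) (by simp) (by simp)
  have hy2 : x ≠ y₂ := by rintro rfl; exact hR s(x', x) (by simp) (by simp)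
  have hxy1 : x' ≠ y₁ := hm x' y₁ (by rw [hE]; simp)
  have hxy2 : x' ≠ y₂ := hm x' y₂ (by rw [hE]; simp)
  have hy12 : y₁ ≠ y₂ := by
    rintro rfl
    have h8 := hsimple x' hxS' hxl' y₁
    have h9 : 2 ≤ E.count s(x', y₁) := by
      rw [hE]
      refine le_trans ?_ (Multiset.count_le_of_le _ (((Multiset.le_cons_self _ _).trans
        (Multiset.le_cons_self _ _)).trans (Multiset.le_cons_self _ _)))
      rw [Multiset.count_cons_self, Multiset.count_cons_self]
      omega
    omega
  have hmS : ∀ e ∈ R₂, e ∈ E := fun e he => by rw [hE]; simp [he]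
  have hvS : ∀ u w, s(u, w) ∈ E → w ∈ S := fun u w hw => h.good.supp _ hw w (by simp)
  have hx1S := hvS x x₁ (by rw [hE]; simp)
  have hx2S := hvS x x₂ (by rw [hE]; simp)
  have hy1S := hvS x' y₁ (by rw [hE]; simp)
  have hy2S := hvS x' y₂ (by rw [hE]; simp)
  have hxR : ∀ e ∈ lk y₁ y₂ + R₂, x ∉ e := by
    intro e he
    rcases Multiset.mem_add.1 he with he | he
    · obtain ⟨-, rfl⟩ := mem_lk he
      simp [hy1, hy2]
    · exact hR e (by simp [he])
  have hxR' : ∀ e ∈ s(x, x₁) ::ₘ s(x, x₂) ::ₘ R₂, x' ∉ e := by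
    intro e he
    rcases Multiset.mem_cons.1 he with rfl | he
    · simp [hne.symm, hx1.symm]
    rcases Multiset.mem_cons.1 he with rfl | he
    · simp [hne.symm, hx2.symm]
    · exact hR₂ e he
  have hcard : (S \ {x, x'}).card + 2 = S.card := by
    rw [← Finset.card_pair hne]
    exact Finset.card_sdiff_add_card_eq_card (Finset.insert_subset hxS (by simpa using hxS'))
  have hG : Good (S \ {x, x'}) (lk x₁ x₂ + (lk y₁ y₂ + R₂)) := by
    refine h.good_of_lift hnc hE ?_ ?_ ?_ fun Z hZ => ?_
    · rintro v (rfl | rfl) <;> right <;> simp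
    · intro e he v hv
      simp only [Finset.mem_sdiff, Finset.mem_insert, Finset.mem_singleton, not_or]
      rcases Multiset.mem_add.1 he with he | he
      · obtain ⟨-, rfl⟩ := mem_lk he
        rcases Sym2.mem_iff.1 hv with rfl | rfl
        exacts [⟨hx1S, hxx1.symm, hx1⟩, ⟨hx2S, hxx2.symm, hx2⟩]
      rcases Multiset.mem_add.1 he with he | he
      · obtain ⟨-, rfl⟩ := mem_lk he
        rcases Sym2.mem_iff.1 hv with rfl | rfl
        exacts [⟨hy1S, hy1.symm, hxy1.symm⟩, ⟨hy2S, hy2.symm, hxy2.symm⟩]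
      · refine ⟨h.good.supp e (hmS e he) v hv, ?_, ?_⟩
        · rintro rfl; exact hR e (by simp [he]) hv
        · rintro rfl; exact hR₂ e he hv
    · intro e he
      rcases Multiset.mem_add.1 he with he | he
      · obtain ⟨h8, rfl⟩ := mem_lk he
        simpa using h8
      rcases Multiset.mem_add.1 he with he | he
      · obtain ⟨h8, rfl⟩ := mem_lk he
        simpa using h8
      · exact h.good.loopless e (hmS e he)
    · have hxZ : x ∉ Z := fun hx => by simpa using hZ hx
      have hxZ' : x' ∉ Z := fun hx => by simpa using hZ hx
      have hZS : Z ⊆ S := hZ.trans Finset.sdiff_subset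
      obtain ⟨Z₁, hZ₁, hxZ₁, hd₁⟩ : ∃ Z₁, (Z₁ = insert x Z ∨ Z₁ = Z) ∧ x' ∉ Z₁ ∧
          d (lk x₁ x₂ + (lk y₁ y₂ + R₂)) Z = d (s(x, x₁) ::ₘ s(x, x₂) ::ₘ (lk y₁ y₂ + R₂)) Z₁ := by
        refine ⟨_, ?_, ?_, d_suppress hxx1.symm hxx2.symm hxR hxZ⟩
        · split_ifs <;> simp
        · split_ifs <;> simp [hxZ', hne.symm]
      obtain ⟨Z₂, hZ₂, hd₂⟩ : ∃ Z₂, (Z₂ = insert x' Z₁ ∨ Z₂ = Z₁) ∧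
          d (lk y₁ y₂ + (s(x, x₁) ::ₘ s(x, x₂) ::ₘ R₂)) Z₁ =
            d (s(x', y₁) ::ₘ s(x', y₂) ::ₘ (s(x, x₁) ::ₘ s(x, x₂) ::ₘ R₂)) Z₂ := by
        refine ⟨_, ?_, d_suppress hxy1.symm hxy2.symm hxR' hxZ₁⟩
        split_ifs <;> simp
      refine ⟨Z₂, ?_, ?_, ?_⟩
      · intro v hv
        rcases hZ₂ with rfl | rfl <;> rcases hZ₁ with rfl | rfl <;>
          grind
      · ext v
        simp only [Finset.mem_sdiff, Finset.mem_insert, Finset.mem_singleton]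
        rcases hZ₂ with rfl | rfl <;> rcases hZ₁ with rfl | rfl <;>
          grind
      · rw [hd₁]
        have e1 : s(x, x₁) ::ₘ s(x, x₂) ::ₘ (lk y₁ y₂ + R₂) =
            lk y₁ y₂ + (s(x, x₁) ::ₘ s(x, x₂) ::ₘ R₂) := by
          rw [Multiset.add_cons, Multiset.add_cons]
        rw [e1, hd₂]
        simp only [d_cons]
        omega
  have hds : ∀ w, w ≠ x → w ≠ x' → d (lk x₁ x₂ + (lk y₁ y₂ + R₂)) {w} = d E {w} := by
    intro w hw hw'
    have e1 := d_lk_add hxx1 hxx2 (lk y₁ y₂ + R₂) hw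
    have e2 := d_lk_add hxy1 hxy2 R₂ hw'
    rw [if_neg (by rintro ⟨rfl, rfl⟩; exact hx12 rfl)] at e1
    rw [if_neg (by rintro ⟨rfl, rfl⟩; exact hy12 rfl)] at e2
    rw [hE, d_cons_singleton hne, if_neg (by tauto)]
    simp only [d_cons] at e1 e2 ⊢
    omega
  have hlS : l ∈ S := by
    obtain ⟨v, hv, hv4⟩ := hnc
    rwa [← huniq v hv hv4]
  have hT := h.of_card_lt (S' := S \ {x, x'}) (E' := lk x₁ x₂ + (lk y₁ y₂ + R₂)) (by
    rw [hE]
    exact .del ((red_suppress x x₁ x₂ _).trans ((red_suppress x' y₁ y₂ R₂).add_left _))) hG (by omega)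
    (by omega) ⟨l, by simp [hlS, hxl.symm, hxl'.symm], by rw [hds l hxl.symm hxl'.symm, hl]⟩
  obtain ⟨w, hw, hwl, hw4⟩ := hT.exists_ne hG l (by rw [hds l hxl.symm hxl'.symm, hl]; omega)
  simp only [Finset.mem_sdiff, Finset.mem_insert, Finset.mem_singleton, not_or] at hw
  rw [hds w hw.2.1 hw.2.2] at hw4
  exact hwl (huniq w hw.1 hw4)

theorem cubic (h : Min S E) : ¬ ∃ v ∈ S, 4 ≤ d E {v} := by
  intro hnc
  obtain ⟨l, hlS, hl⟩ := hnc
  have hnc : ∃ v ∈ S, 4 ≤ d E {v} := ⟨l, hlS, hl⟩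
  have h6 := h.card
  have hcub : ∀ y, s(l, y) ∈ E → d E {y} = 3 := fun y hy => by
    have := h.good.three_le (by omega) (h.good.supp _ hy y (by simp))
    by_contra hcon
    have := h.count_eq_zero hnc hl (v := y) (by omega)
    exact (Multiset.count_eq_zero.1 this) hy
  obtain ⟨y, hy⟩ := h.exists_adj hlS
  obtain ⟨hl4, huniq⟩ := h.adj_unique hnc (hcub y hy) hl (by rwa [Sym2.eq_swap])
  have h3 : ∀ w ∈ S, w ≠ l → d E {w} = 3 := fun w hw hwl => by
    have := h.good.three_le (by omega) hw
    by_contra hcon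
    exact hwl (huniq w hw (by omega))
  have h7 : 7 ≤ S.card := by
    have h8 := sum_d_singleton h.good.supp h.good.loopless
    rw [← Finset.add_sum_erase _ _ hlS, Finset.sum_congr rfl fun w hw =>
      h3 w (Finset.mem_of_mem_erase hw) (Finset.ne_of_mem_erase hw), Finset.sum_const,
      Finset.card_erase_of_mem hlS, hl4, smul_eq_mul] at h8
    omega
  obtain ⟨x, hxS, hxl, hx⟩ : ∃ x ∈ S, x ≠ l ∧ s(l, x) ∉ E := by
    by_contra! hcon
    have h8 := sum_count_le E (p := l) (T := S.erase l) (by simp)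
    have h9 : ∑ w ∈ S.erase l, 1 ≤ ∑ w ∈ S.erase l, E.count s(l, w) :=
      Finset.sum_le_sum fun w hw => Multiset.count_pos.2
        (hcon w (Finset.mem_of_mem_erase hw) (Finset.ne_of_mem_erase hw))
    rw [Finset.sum_const, Finset.card_erase_of_mem hlS, smul_eq_mul] at h9
    omega
  obtain ⟨x', hx'⟩ := h.exists_adj hxS
  exact h.cubic_adj hnc h7 hl4 huniq hxl (by rintro rfl; exact hx (by rwa [Sym2.eq_swap])) hx'

end Min

/-- A graph that is not cubic contains the wheel or one of the exceptional configurations. -/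
theorem w4In_or_T {S : Finset V} {E : Multiset (Sym2 V)} (hG : Good S E) (hc : 5 ≤ S.card)
    (hnc : ∃ v ∈ S, 4 ≤ d E {v}) : W4In E ∨ T S E := by
  induction hn : S.card + E.card using Nat.strong_induction_on generalizing S E with
  | _ n ih =>
    subst hn
    by_cases h5 : S.card = 5
    · exact base_five hG h5
    · by_contra! hcon
      refine Min.cubic (S := S) (E := E) ⟨hG, by omega, hcon.1, fun p q r hC => hcon.2 (.inl ⟨p, q, r, hC⟩),
        fun S' E' hR hG' h5' hlt hv => ?_⟩ hnc
      exact (ih _ hlt hG' h5' hv rfl).resolve_left fun hW => hcon.1 (.of_red hR hW)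

/-- Replacing one traversal of the edge `xz` in a walk by `xy, yz`. -/
theorem exists_walk_detour {x z : V} (y : V) (l : List V) (h : s(x, z) ∈ walkEdges l) :
    ∃ l' : List V, l'.head? = l.head? ∧ l'.getLast? = l.getLast? ∧
      s(x, z) ::ₘ walkEdges l' = s(x, y) ::ₘ s(y, z) ::ₘ walkEdges l := by
  induction l with
  | nil => simp [walkEdges] at h
  | cons a l ih =>
    cases l with
    | nil => simp [walkEdges] at h
    | cons b l =>
      have hw : ∀ (a b : V) (l : List V),
          walkEdges (a :: b :: l) = s(a, b) ::ₘ walkEdges (b :: l) := fun a b l => rfl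
      by_cases hab : s(x, z) = s(a, b)
      · refine ⟨a :: y :: b :: l, rfl, by simp, ?_⟩
        rw [hw, hw, hw, ← hab]
        rcases Sym2.eq_iff.1 hab with ⟨rfl, rfl⟩ | ⟨rfl, rfl⟩
        · rw [Multiset.cons_swap, Multiset.cons_swap (s(x, z))]
        · rw [Sym2.eq_swap (a := z) (b := y), Sym2.eq_swap (a := y) (b := x),
            Multiset.cons_swap, Multiset.cons_swap (s(x, z)), Multiset.cons_swap (s(y, z))]
      · rw [hw, Multiset.mem_cons] at h
        obtain ⟨l', h1, h2, h3⟩ := ih (h.resolve_left hab)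
        cases l' with
        | nil => simp at h1
        | cons c l' =>
          obtain rfl : c = b := by simpa using h1
          refine ⟨a :: c :: l', rfl, by simpa using h2, ?_⟩
          rw [hw, hw, Multiset.cons_swap, h3, Multiset.cons_swap (s(a, c)),
            Multiset.cons_swap (s(a, c))]

/-- Edge-disjoint walks in a reduction lift to edge-disjoint walks. -/
theorem Red.exists_walks {E F : Multiset (Sym2 V)} (h : Red E F) (φ : W → V)
    (P : Multiset (Sym2 W × List V))
    (hP : ∀ p ∈ P, ∃ u v : W, p.1 = s(u, v) ∧ IsWalk p.2 (φ u) (φ v))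
    (hF : (P.map fun p => walkEdges p.2).sum ≤ F) :
    ∃ P' : Multiset (Sym2 W × List V), P'.map Prod.fst = P.map Prod.fst ∧
      (∀ p ∈ P', ∃ u v : W, p.1 = s(u, v) ∧ IsWalk p.2 (φ u) (φ v)) ∧
      (P'.map fun p => walkEdges p.2).sum ≤ E := by
  induction h with
  | refl => exact ⟨P, rfl, hP, hF⟩
  | @del e E F _ ih =>
    obtain ⟨P', h1, h2, h3⟩ := ih hF
    exact ⟨P', h1, h2, h3.trans (Multiset.le_cons_self _ _)⟩
  | @split x y z E F _ ih =>
    obtain ⟨P', h1, h2, h3⟩ := ih hF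
    by_cases hm : s(x, z) ∈ (P'.map fun p => walkEdges p.2).sum
    · obtain ⟨A, hA, hxA⟩ := Multiset.mem_join.1 hm
      obtain ⟨p, hp, rfl⟩ := Multiset.mem_map.1 hA
      obtain ⟨P₀, rfl⟩ := Multiset.exists_cons_of_mem hp
      obtain ⟨l', e1, e2, e3⟩ := exists_walk_detour y p.2 hxA
      refine ⟨(p.1, l') ::ₘ P₀, by simpa using h1, ?_, ?_⟩
      · intro p' hp'
        rcases Multiset.mem_cons.1 hp' with rfl | hp'
        · obtain ⟨u, v, h5, h6, h7⟩ := h2 p hp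
          exact ⟨u, v, h5, e1.trans h6, e2.trans h7⟩
        · exact h2 p' (Multiset.mem_cons_of_mem hp')
      · rw [Multiset.map_cons, Multiset.sum_cons] at h3 ⊢
        rw [← Multiset.cons_le_cons_iff (s(x, z)), ← Multiset.cons_add, e3]
        rw [Multiset.cons_add, Multiset.cons_add, Multiset.cons_swap (s(x, z)),
          Multiset.cons_swap (s(x, z)), Multiset.cons_le_cons_iff, Multiset.cons_le_cons_iff]
        exact h3
    · exact ⟨P', h1, h2, (((Multiset.le_cons_of_notMem hm).1 h3).trans
        (Multiset.le_cons_self _ _)).trans (Multiset.le_cons_self _ _)⟩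

theorem W4In.hasW4Immersion {G : MG V} (h : W4In G.edges) : HasW4Immersion G := by
  obtain ⟨φ, hφ, hr⟩ := h
  refine ⟨φ, hφ, ?_, ?_⟩
  · intro w
    obtain ⟨e, he, hw⟩ := hr.mem_support (v := φ w) (by
      have : ∃ e ∈ w4Edges, w ∈ e := by
        simp only [w4Edges, Multiset.insert_eq_cons]
        fin_cases w <;> simp
      obtain ⟨e, he, hw⟩ := this
      exact ⟨_, Multiset.mem_map_of_mem _ he, Sym2.mem_map.2 ⟨w, hw, rfl⟩⟩)
    exact G.edge_support e he _ hw
  · let P : Multiset (Sym2 (Fin 5) × List V) :=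
      w4Edges.map fun e => (e, [φ e.out.1, φ e.out.2])
    have ho : ∀ e : Sym2 (Fin 5), s(e.out.1, e.out.2) = e := fun e => Quot.out_eq e
    obtain ⟨P', h1, h2, h3⟩ := hr.exists_walks φ P (by
      intro p hp
      obtain ⟨e, -, rfl⟩ := Multiset.mem_map.1 hp
      exact ⟨e.out.1, e.out.2, (ho e).symm, rfl, rfl⟩) (by
      apply le_of_eq
      rw [Multiset.map_map]
      have : ∀ e : Sym2 (Fin 5), walkEdges [φ e.out.1, φ e.out.2] = {Sym2.map φ e} := by
        intro e
        conv_rhs => rw [← ho e]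
        rfl
      simp only [Function.comp_def, this]
      rw [← Multiset.sum_map_singleton (w4Edges.map (Sym2.map φ)), Multiset.map_map]
      rfl)
    refine ⟨P', ?_, h2, h3⟩
    rw [h1, Multiset.map_map]
    simp

theorem one_le_d_walkEdges {X : Finset V} {l : List V} {u v : V} (h : IsWalk l u v)
    (hX : ¬(u ∈ X ↔ v ∈ X)) : 1 ≤ d (walkEdges l) X := by
  induction l generalizing u with
  | nil => simp [IsWalk] at h
  | cons a l ih =>
    obtain ⟨h1, h2⟩ := h
    obtain rfl : a = u := by simpa using h1
    cases l with
    | nil =>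
      obtain rfl : a = v := by simpa using h2
      exact absurd Iff.rfl hX
    | cons b l =>
      have hw : walkEdges (a :: b :: l) = s(a, b) ::ₘ walkEdges (b :: l) := rfl
      rw [hw, d_cons, cr_mk]
      split_ifs with hab
      · have := ih (u := b) ⟨rfl, by simpa using h2⟩ (by tauto)
        omega
      · omega

theorem four_le_d_of_immersionVia {G : MG V} {φ : Fin 5 → V}
    (h : ImmersionVia G w4Edges φ) : 4 ≤ d G.edges {φ 0} := by
  obtain ⟨hφ, -, P, h1, h2, h3⟩ := h
  refine le_trans ?_ (d_mono h3 _)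
  have key : ∀ Q : Multiset (Sym2 (Fin 5) × List V),
      (∀ p ∈ Q, ∃ u v : Fin 5, p.1 = s(u, v) ∧ IsWalk p.2 (φ u) (φ v)) →
      d (Q.map Prod.fst) {0} ≤ d (Q.map fun p => walkEdges p.2).sum {φ 0} := by
    intro Q
    induction Q using Multiset.induction_on with
    | empty => simp
    | cons p Q ih =>
      intro hQ
      have := ih fun p' hp' => hQ p' (Multiset.mem_cons_of_mem hp')
      obtain ⟨u, v, huv, hw⟩ := hQ p (Multiset.mem_cons_self _ _)
      rw [Multiset.map_cons, Multiset.map_cons, Multiset.sum_cons, d_cons, d_add, huv, cr_mk]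
      split_ifs with hc
      · omega
      · have := one_le_d_walkEdges (X := {φ 0}) hw (by
          simpa [hφ.eq_iff] using hc)
        omega
  refine le_trans ?_ (key P h2)
  rw [h1]
  simp [w4Edges]

theorem dcut_eq_d (G : MG V) (X : Finset V) : dcut G X = d G.edges X := by
  rw [d_eq_card_filter]
  unfold dcut cutEdges
  congr 1
  refine Multiset.filter_congr fun e _ => ?_
  induction e using Sym2.ind with
  | _ a b =>
    rw [cr_mk]
    constructor
    · rintro ⟨u, v, he, hu, hv⟩
      rcases Sym2.eq_iff.1 he with ⟨rfl, rfl⟩ | ⟨rfl, rfl⟩ <;> simp [hu, hv]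
    · intro h
      by_cases ha : a ∈ X
      · exact ⟨a, b, rfl, ha, fun hb => h (by simp [ha, hb])⟩
      · exact ⟨b, a, Sym2.eq_swap, by_contra fun hb => h (by simp [ha, hb]), ha⟩

theorem deg_eq_d (G : MG V) (v : V) : deg G v = d G.edges {v} := by
  rw [d_eq_card_filter]
  unfold deg
  congr 1
  refine Multiset.filter_congr fun e he => ?_
  have hl := G.loopless e he
  induction e using Sym2.ind with
  | _ a b =>
    have hab : a ≠ b := hl
    rw [cr_mk]
    by_cases ha : v = a <;> by_cases hb : v = b <;> simp_all [eq_comm]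

theorem good_of_edgeConn {G : MG V} (h3 : EdgeConn G 3) (h4 : InternallyEdgeConn G 4) :
    Good G.verts G.edges where
  supp := G.edge_support
  loopless := G.loopless
  cut3 := fun X h1 h2 h5 => dcut_eq_d G X ▸ h3 X h1 h2 h5
  cut4 := fun X h1 h2 h5 => dcut_eq_d G X ▸ h4 X h1 h2 h5

/-- Collapsing everything but `p, q, r` when no edge meets `q` or joins `p` and `r`. -/
theorem collapse_edges {S : Finset V} {p q r y : V} (hpr : p ≠ r)
    (hp : p ∈ S) (hr : r ∈ S) (hy : y ∈ S \ {p, q, r})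
    (R : Multiset (Sym2 V)) (hS : ∀ e ∈ R, ∀ v ∈ e, v ∈ S) (hq : ∀ e ∈ R, q ∉ e)
    (hl : ∀ e ∈ R, ¬e.IsDiag) (hR : s(p, r) ∉ R) :
    (R.map (Sym2.map (collapseFun (S \ {p, q, r}) y))).filter (fun e => ¬e.IsDiag) =
      Multiset.replicate (d R {p}) s(y, p) + Multiset.replicate (d R {r}) s(r, y) := by
  induction R using Multiset.induction_on with
  | empty => simp
  | cons e R ih =>
    have ih := ih (fun e he => hS e (Multiset.mem_cons_of_mem he))
      (fun e he => hq e (Multiset.mem_cons_of_mem he))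
      (fun e he => hl e (Multiset.mem_cons_of_mem he))
      (fun he => hR (Multiset.mem_cons_of_mem he))
    have hS := hS e (Multiset.mem_cons_self _ _)
    have hq := hq e (Multiset.mem_cons_self _ _)
    have hl := hl e (Multiset.mem_cons_self _ _)
    have hne : e ≠ s(p, r) := fun h => hR (h ▸ Multiset.mem_cons_self _ _)
    have hyp : y ≠ p := by rintro rfl; simp at hy
    have hyr : y ≠ r := by rintro rfl; simp at hy
    rw [Multiset.map_cons, Multiset.filter_cons, ih, d_cons, d_cons]
    have key : ∀ a b : V, e = s(a, b) → (a = p ∨ a = r ∨ b ≠ p ∧ b ≠ r) →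
        (if ¬(Sym2.map (collapseFun (S \ {p, q, r}) y) e).IsDiag then
          {Sym2.map (collapseFun (S \ {p, q, r}) y) e} else 0) =
        Multiset.replicate (cr {p} e) s(y, p) + Multiset.replicate (cr {r} e) s(r, y) := by
      rintro a b rfl h
      have ha := hS a (by simp)
      have hb := hS b (by simp)
      have haq : a ≠ q := by rintro rfl; simp at hq
      have hbq : b ≠ q := by rintro rfl; simp at hq
      have hab : a ≠ b := hl
      rw [cr_mk, cr_mk, Sym2.map_mk]
      simp only [collapseFun, Finset.mem_sdiff, Finset.mem_insert, Finset.mem_singleton,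
        Sym2.mk_isDiag_iff]
      by_cases hap : a = p
      · subst hap
        have hbr : b ≠ r := by rintro rfl; exact hne rfl
        simp [hb, hbq, hab.symm, hbr, hyp.symm, hpr, Sym2.eq_swap (a := y)]
      · by_cases har : a = r
        · subst har
          have hbp : b ≠ p := by rintro rfl; exact hne Sym2.eq_swap
          simp [hb, hbq, hab.symm, hbp, hyr.symm, hap]
        · obtain ⟨hbp, hbr⟩ : b ≠ p ∧ b ≠ r := by tauto
          simp [ha, hb, haq, hbq, hap, har, hbp, hbr]
    have key' : (if ¬(Sym2.map (collapseFun (S \ {p, q, r}) y) e).IsDiag then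
          {Sym2.map (collapseFun (S \ {p, q, r}) y) e} else 0) =
        Multiset.replicate (cr {p} e) s(y, p) + Multiset.replicate (cr {r} e) s(r, y) := by
      obtain ⟨a, b, rfl⟩ : ∃ a b, e = s(a, b) := by
        induction e using Sym2.ind with
        | _ a b => exact ⟨a, b, rfl⟩
      by_cases h : a = p ∨ a = r ∨ b ≠ p ∧ b ≠ r
      · exact key a b rfl h
      · exact key b a Sym2.eq_swap (by tauto)
    rw [key', Multiset.replicate_add, Multiset.replicate_add]
    abel

theorem Chain3.chainOfSausages {G : MG V} {p q r : V} (h : Chain3 G.verts G.edges p q r)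
    (hcard : 6 ≤ G.verts.card) : ChainOfSausages G {p, q, r} 3 := by
  have hne : ∀ u v : V, G.edges.count s(u, v) = 2 → u ≠ v := by
    rintro u v huv rfl
    exact G.loopless s(u, u) (Multiset.count_pos.1 (by omega)) rfl
  have hpq := hne p q h.pq
  have hqr := hne q r h.qr
  have hpr := h.npr
  have hsub : ({p, q, r} : Finset V) ⊆ G.verts := by
    intro v hv
    simp only [Finset.mem_insert, Finset.mem_singleton] at hv
    rcases hv with rfl | rfl | rfl
    exacts [h.hp, h.hq, h.hr]
  have hc3 : ({p, q, r} : Finset V).card = 3 := by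
    rw [Finset.card_insert_of_notMem (by simp [hpq, hpr]), Finset.card_pair hqr]
  obtain ⟨y, hy⟩ : (G.verts \ {p, q, r}).Nonempty := by
    rw [← Finset.card_pos, Finset.card_sdiff_of_subset hsub]
    omega
  have hyp : y ≠ p := by rintro rfl; simp at hy
  have hyq : y ≠ q := by rintro rfl; simp at hy
  have hyr : y ≠ r := by rintro rfl; simp at hy
  have hab : s(p, q) ≠ s(q, r) := by
    intro h
    rcases Sym2.eq_iff.1 h with ⟨h1, h2⟩ | ⟨h1, h2⟩
    exacts [hpq h1, hpr h1]
  obtain ⟨R, hR⟩ := Multiset.le_iff_exists_add.1 (show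
      Multiset.replicate 2 s(p, q) + Multiset.replicate 2 s(q, r) ≤ G.edges by
    rw [Multiset.le_iff_count]
    intro e
    rw [Multiset.count_add, Multiset.count_replicate, Multiset.count_replicate]
    by_cases h1 : s(p, q) = e
    · subst h1
      rw [if_pos rfl, if_neg hab.symm, h.pq]
    · rw [if_neg h1]
      split_ifs with h2
      · rw [← h2, h.qr]
      · exact Nat.zero_le _)
  have hmem : ∀ e ∈ R, e ∈ G.edges := fun e he => hR ▸ Multiset.mem_add.2 (.inr he)
  have hpR : s(p, r) ∉ R := fun h' =>
    Multiset.count_eq_zero.1 h.pr (hmem _ h')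
  have hd : ∀ X, d G.edges X = 2 * cr X s(p, q) + 2 * cr X s(q, r) + d R X := by
    intro X
    rw [hR, d_add, d_add]
    simp only [d, Multiset.map_replicate, Multiset.sum_replicate, smul_eq_mul]
  have dp : d R {p} = 2 := by
    have := hd {p}
    rw [h.dp] at this
    simp [hpq.symm, hpr.symm] at this
    omega
  have dr : d R {r} = 2 := by
    have := hd {r}
    rw [h.dr] at this
    simp [hpr, hqr] at this
    omega
  have dq : d R {q} = 0 := by
    have := hd {q}
    rw [h.dq] at this
    simp [hpq, hqr.symm] at this
    omega
  have hq : ∀ e ∈ R, q ∉ e := by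
    intro e he hqe
    obtain ⟨R', rfl⟩ := Multiset.exists_cons_of_mem he
    obtain ⟨w, rfl⟩ := Sym2.mem_iff_exists.1 hqe
    have hqw : q ≠ w := fun h' => G.loopless _ (hmem _ he) h'
    rw [d_cons, cr_mk, if_neg (by simp [hqw.symm])] at dq
    omega
  refine ⟨hsub, hc3, by omega, y, hy, ![y, p, q, r], ?_, ?_, ?_⟩
  · rw [← List.nodup_ofFn]
    simp [hyp, hyq, hyr, hpq, hpr, hqr]
  · ext v
    have hcp : collapseFun (G.verts \ {p, q, r}) y p = p := by simp [collapseFun]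
    have hcq : collapseFun (G.verts \ {p, q, r}) y q = q := by simp [collapseFun]
    have hcr : collapseFun (G.verts \ {p, q, r}) y r = r := by simp [collapseFun]
    have hcy : collapseFun (G.verts \ {p, q, r}) y y = y := by simp [collapseFun]
    simp only [mapGraph, Finset.mem_image, Finset.mem_univ, true_and]
    constructor
    · rintro ⟨i, rfl⟩
      fin_cases i
      exacts [⟨y, (Finset.mem_sdiff.1 hy).1, hcy⟩, ⟨p, h.hp, hcp⟩, ⟨q, h.hq, hcq⟩,
        ⟨r, h.hr, hcr⟩]
    · rintro ⟨w, hw, rfl⟩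
      by_cases h' : w ∈ G.verts \ {p, q, r}
      · exact ⟨0, by simp [collapseFun, h']⟩
      · have : w = p ∨ w = q ∨ w = r := by
          simp only [Finset.mem_sdiff, Finset.mem_insert, Finset.mem_singleton] at h'
          tauto
        rcases this with rfl | rfl | rfl
        exacts [⟨1, hcp.symm⟩, ⟨2, hcq.symm⟩, ⟨3, hcr.symm⟩]
  · have h1 := collapse_edges (q := q) hpr h.hp h.hr hy R
      (fun e he => G.edge_support e (hmem e he)) hq (fun e he => G.loopless e (hmem e he)) hpR
    have h2 : cycleEdges (3 + 1) ![y, p, q, r] = {s(y, p), s(p, q), s(q, r), s(r, y)} := rfl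
    rw [h2]
    simp only [mapGraph]
    rw [hR, Multiset.map_add, Multiset.filter_add, h1, dp, dr]
    have hm1 : Sym2.map (collapseFun (G.verts \ {p, q, r}) y) s(p, q) = s(p, q) := by
      simp [collapseFun]
    have hm2 : Sym2.map (collapseFun (G.verts \ {p, q, r}) y) s(q, r) = s(q, r) := by
      simp [collapseFun]
    rw [Multiset.map_add, Multiset.map_replicate, Multiset.map_replicate, hm1, hm2,
      Multiset.filter_eq_self.2]
    · simp only [Multiset.insert_eq_cons, ← Multiset.singleton_add, nsmul_add,
        Multiset.nsmul_singleton]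
      abel
    · intro e he
      rcases Multiset.mem_add.1 he with he | he
      · rw [Multiset.eq_of_mem_replicate he]; exact hpq
      · rw [Multiset.eq_of_mem_replicate he]; exact hqr

/-- Let `G` be a `3`-edge-connected, internally `4`-edge-connected
graph which is sausage reduced and has at least `6` vertices. Then `G` has no
immersion of `W₄` if and only if `G` is cubic. -/
theorem statement_0 {V : Type} (G : MG V)
    (h3 : EdgeConn G 3) (h4 : InternallyEdgeConn G 4)
    (hsr : SausageReduced G) (hcard : 6 ≤ G.verts.card) :
    ¬ HasW4Immersion G ↔ Cubic G := by
  have hG := good_of_edgeConn h3 h4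
  constructor
  · intro hn
    by_contra hc
    obtain ⟨v, hv, hdv⟩ : ∃ v ∈ G.verts, 4 ≤ d G.edges {v} := by
      unfold Cubic at hc
      push Not at hc
      obtain ⟨v, hv, hdv⟩ := hc
      rw [deg_eq_d] at hdv
      have := hG.three_le (by omega) hv
      exact ⟨v, hv, by omega⟩
    rcases w4In_or_T hG (by omega) ⟨v, hv, hdv⟩ with h | ⟨p, q, r, h⟩ | ⟨a, b, g, c, e, h⟩
    · exact hn h.hasW4Immersion
    · exact hsr ⟨_, 3, le_rfl, h.chainOfSausages hcard⟩
    · exact not_exc_of_card hcard h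
  · rintro hc ⟨φ, h⟩
    have h1 := four_le_d_of_immersionVia h
    have h2 := hc (φ 0) (h.2.1 0)
    rw [deg_eq_d] at h2
    omega

end PaperW4
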